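/- Tame L² estimates for the Dirichlet problem and the divergence-free projection (Proposition 8.1, estimates (8.2), (8.3), (8.6)): Let x : Ω → ℝⁿ be smooth with invertible Jacobian satisfying the coordinate condition with constant c₁. Let q : Ω → ℝ be smooth with q = 0 on ∂Ω and set W^a = g^{ab} ∂_b q. Then there are constants K₁ depending only on n, r and c₁ such that: (a) for r ≥ 0, ‖W‖_r ≤ K₁ Σ_{s=0}^{r−1} ‖g‖_{r−1−s,∞} ‖Δq‖_s + K₁ ‖g‖_{r,∞} ‖W‖₀; (b) for r ≥ 1, ‖W‖_r + ‖q‖_{r+1} ≤ K₁ Σ_{s=0}^{r−1} ‖g‖_{r−s,∞} ‖Δq‖_s; and (c) if P is the orthogonal projection onto divergence-free vector fields, defined by P U^a = U^a − g^{ab} ∂_b p_U where Δ p_U = div U and p_U = 0 on ∂Ω, then for every smooth vector field U and r ≥ 0, ‖P U‖_r ≤ K₁ Σ_{s=0}^{r} ‖g‖_{r−s,∞} ‖U‖_s. -/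

import Mathlib

open scoped BigOperators
open Set Matrix

noncomputable section

abbrev E' (n : ℕ) := EuclideanSpace ℝ (Fin n)

def Ball (n : ℕ) : Set (E' n) := Metric.closedBall 0 1

def Sphere' (n : ℕ) : Set (E' n) := Metric.sphere 0 1

variable {n : ℕ} {F : Type*} [NormedAddCommGroup F] [NormedSpace ℝ F]

/-- Partial derivative `∂u/∂y^a`. -/
def pd (a : Fin n) (u : E' n → ℝ) (y : E' n) : ℝ :=
  fderiv ℝ u y (EuclideanSpace.single a 1)

/-- Jacobian matrix `∂x^i/∂y^a`. -/
def jacM (x : E' n → E' n) (y : E' n) : Matrix (Fin n) (Fin n) ℝ :=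
  Matrix.of fun i a => pd a (fun z => x z i) y

/-- Metric `g_{ab} = Σ_i (∂x^i/∂y^a)(∂x^i/∂y^b)`. -/
def gMet (x : E' n → E' n) (y : E' n) : Matrix (Fin n) (Fin n) ℝ :=
  (jacM x y)ᵀ * jacM x y

def kappa (x : E' n → E' n) (y : E' n) : ℝ := (jacM x y).det

/-- Eulerian derivative `∂_i u = (∂y^a/∂x^i) ∂_a u`. -/
def epd (x : E' n → E' n) (i : Fin n) (u : E' n → ℝ) (y : E' n) : ℝ :=
  ∑ a, (jacM x y)⁻¹ a i * pd a u y

/-- Laplace–Beltrami operator `Δq = κ⁻¹ ∂_a (κ g^{ab} ∂_b q)`. -/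
def lapl (x : E' n → E' n) (q : E' n → ℝ) (y : E' n) : ℝ :=
  (kappa x y)⁻¹ *
    ∑ a, pd a (fun z => kappa x z * ∑ b, (gMet x z)⁻¹ a b * pd b q z) y

/-- Lagrangian divergence `div W = κ⁻¹ ∂_a (κ W^a)`. -/
def divL (x : E' n → E' n) (W : E' n → Fin n → ℝ) (y : E' n) : ℝ :=
  (kappa x y)⁻¹ * ∑ a, pd a (fun z => kappa x z * W z a) y

/-- Eulerian divergence `div u = ∂_k u^k`. -/
def divE (x : E' n → E' n) (u : E' n → Fin n → ℝ) (y : E' n) : ℝ :=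
  ∑ k, epd x k (fun z => u z k) y

/-- Eulerian curl `curl u_{ij} = ∂_i u_j − ∂_j u_i`. -/
def curlE (x : E' n → E' n) (u : E' n → Fin n → ℝ) (i j : Fin n) (y : E' n) : ℝ :=
  epd x i (fun z => u z j) y - epd x j (fun z => u z i) y

/-- Exterior unit (with respect to `g`) normal derivative on the unit sphere. -/
def gradN (x : E' n → E' n) (p : E' n → ℝ) (y : E' n) : ℝ :=
  (∑ a, ∑ b, (gMet x y)⁻¹ a b * y b * pd a p y) /
    Real.sqrt (∑ a, ∑ b, (gMet x y)⁻¹ a b * y a * y b)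

/-- Coordinate condition `|∂x/∂y|² + |∂y/∂x|² ≤ c₁²`. -/
def coordCond (x : E' n → E' n) (c₁ : ℝ) (y : E' n) : Prop :=
  (∑ i, ∑ a, (jacM x y i a) ^ 2) + (∑ i, ∑ a, ((jacM x y)⁻¹ i a) ^ 2) ≤ c₁ ^ 2

/-- Physical condition `∇_N p ≤ −c₀` on the boundary. -/
def physCond (x : E' n → E' n) (p : E' n → ℝ) (c₀ : ℝ) : Prop :=
  ∀ y ∈ Sphere' n, gradN x p y ≤ -c₀

/-- Material (time) derivative at fixed `y`. -/
def Dt (u : ℝ → E' n → F) : ℝ → E' n → F := fun t y => deriv (fun s => u s y) t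

/-- Iterated time derivative. -/
def Dts (k : ℕ) (u : ℝ → E' n → F) : ℝ → E' n → F := Dt^[k] u

/-- Joint space-time smoothness. -/
def SmoothST (u : ℝ → E' n → F) : Prop :=
  ContDiff ℝ (⊤ : ℕ∞) fun p : ℝ × E' n => u p.1 p.2

/-- `L²` Sobolev norm of order `r` on the unit ball. -/
def sobNorm (r : ℕ) (u : E' n → F) : ℝ :=
  ∑ j ∈ Finset.range (r + 1), (∫ y in Ball n, ‖iteratedFDeriv ℝ j u y‖ ^ 2) ^ ((1:ℝ)/2)

/-- `C^k` supremum norm on the unit ball. -/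
def ckNorm (k : ℕ) (u : E' n → F) : ℝ :=
  ∑ j ∈ Finset.range (k + 1), ⨆ y ∈ Ball n, ‖iteratedFDeriv ℝ j u y‖

/-- Hölder norm of order `a` on the set `s`. -/
def holderNormOn (s : Set (E' n)) (a : ℝ) (u : E' n → F) : ℝ :=
  if a ≤ 0 then ⨆ y ∈ s, ‖u y‖
  else
    (⨆ z ∈ s, ⨆ w ∈ s,
        ‖iteratedFDeriv ℝ (⌈a⌉₊ - 1) u z - iteratedFDeriv ℝ (⌈a⌉₊ - 1) u w‖ /
          ‖z - w‖ ^ (a - ((⌈a⌉₊ : ℝ) - 1))) +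
      ⨆ y ∈ s, ‖u y‖

/-- Hölder norm of order `a` on the unit ball. -/
def holderNorm (a : ℝ) (u : E' n → F) : ℝ := holderNormOn (Ball n) a u

/-- Space-time norm `|||u|||_{a,k}`. -/
def stNorm (T : ℝ) (a : ℝ) (k : ℕ) (u : ℝ → E' n → F) : ℝ :=
  ⨆ t ∈ Icc (0:ℝ) T, ∑ j ∈ Finset.range (k + 1), holderNorm a fun y => Dts j u t y

/-- The defining property of the pressure `p = Ψ(x)`:
`Δp = −(∂_i V^k)(∂_k V^i)` in `Ω`, `p = 0` on `∂Ω`. -/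
def IsPressure (x v : E' n → E' n) (p : E' n → ℝ) : Prop :=
  ContDiff ℝ (⊤ : ℕ∞) p ∧ (∀ y ∈ Sphere' n, p y = 0) ∧
    ∀ y ∈ Ball n,
      lapl x p y = -∑ i, ∑ k, epd x i (fun z => v z k) y * epd x k (fun z => v z i) y

/-- The pressure, selected by choice. -/
def pressureFn (x v : E' n → E' n) : E' n → ℝ := Classical.epsilon (IsPressure x v)

/-- The Euler map `Φ(x)_i = D_t² x_i + ∂_i p`. -/
def eulerMap (x : ℝ → E' n → E' n) : ℝ → E' n → Fin n → ℝ := fun t y i =>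
  Dts 2 x t y i + epd (x t) i (pressureFn (x t) (Dt x t)) y

/-- First variational derivative `Φ'(x)δx`. -/
def eulerMap' (x δx : ℝ → E' n → E' n) : ℝ → E' n → Fin n → ℝ := fun t y i =>
  deriv (fun r : ℝ => eulerMap (fun s z => x s z + r • δx s z) t y i) 0

/-- Second variational derivative `Φ''(x)(δx, εx)`. -/
def eulerMap'' (x δx εx : ℝ → E' n → E' n) : ℝ → E' n → Fin n → ℝ := fun t y i =>
  deriv (fun r : ℝ =>
    deriv (fun s : ℝ => eulerMap (fun τ z => x τ z + r • δx τ z + s • εx τ z) t y i) 0) 0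

/-- Modified linearized operator `L₁ δx = Φ'(x)δx − δx^k ∂_k Φ^i + δx^i div Φ`. -/
def modLin (x δx : ℝ → E' n → E' n) : ℝ → E' n → Fin n → ℝ := fun t y i =>
  eulerMap' x δx t y i
    - (∑ k, δx t y k * epd (x t) k (fun z => eulerMap x t z i) y)
    + δx t y i * ∑ k, epd (x t) k (fun z => eulerMap x t z k) y

open MeasureTheory
open scoped ENNReal NNReal Topology

/-- Globally smooth real functions on `E' n`. -/
abbrev Sm (u : E' n → ℝ) : Prop := ContDiff ℝ (⊤ : ℕ∞) u

/-- Lebesgue measure on the open unit ball. -/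
abbrev ballMeas (n : ℕ) : Measure (E' n) := volume.restrict (Metric.ball 0 1)

section PartialDerivatives

lemma Sm.diff {u : E' n → ℝ} (hu : Sm u) (y : E' n) : DifferentiableAt ℝ u y :=
  (hu.differentiable (by simp)) y

lemma Sm.pd {u : E' n → ℝ} (hu : Sm u) (a : Fin n) : Sm (pd a u) := by
  have h : ContDiff ℝ (⊤ : ℕ∞) (fderiv ℝ u) := hu.fderiv_right (by simp)
  exact h.clm_apply contDiff_const

lemma Sm.const (c : ℝ) : Sm (fun _ : E' n => c) := contDiff_const

lemma Sm.mul {u v : E' n → ℝ} (hu : Sm u) (hv : Sm v) : Sm (fun y => u y * v y) :=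
  ContDiff.mul hu hv

lemma Sm.add {u v : E' n → ℝ} (hu : Sm u) (hv : Sm v) : Sm (fun y => u y + v y) :=
  ContDiff.add hu hv

lemma Sm.sub {u v : E' n → ℝ} (hu : Sm u) (hv : Sm v) : Sm (fun y => u y - v y) :=
  ContDiff.sub hu hv

lemma Sm.pow {u : E' n → ℝ} (hu : Sm u) (m : ℕ) : Sm (fun y => u y ^ m) :=
  ContDiff.pow hu m

lemma Sm.sum {κ : Type*} {s : Finset κ} {u : κ → E' n → ℝ} (hu : ∀ c ∈ s, Sm (u c)) :
    Sm (fun y => ∑ c ∈ s, u c y) := ContDiff.sum hu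

/-- The coordinate `y ↦ y a` as a continuous linear functional. -/
def coordCLM (a : Fin n) : E' n →L[ℝ] ℝ := EuclideanSpace.proj a

lemma Sm.coord (a : Fin n) : Sm (fun y : E' n => y a) :=
  (coordCLM a).contDiff

lemma pd_const (a : Fin n) (c : ℝ) (y : E' n) : pd a (fun _ => c) y = 0 := by
  simp [pd]

lemma pd_coord (a b : Fin n) (y : E' n) :
    pd a (fun z : E' n => z b) y = if a = b then 1 else 0 := by
  have := (coordCLM b).hasFDerivAt (x := y)
  have h2 : HasFDerivAt (fun z : E' n => z b) (coordCLM b) y := this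
  simp only [pd, h2.fderiv]
  simp [coordCLM, eq_comm]

lemma pd_mul {u v : E' n → ℝ} (hu : Sm u) (hv : Sm v) (a : Fin n) (y : E' n) :
    pd a (fun z => u z * v z) y = pd a u y * v y + u y * pd a v y := by
  have := ((hu.diff y).hasFDerivAt.mul (hv.diff y).hasFDerivAt).fderiv
  have h2 : fderiv ℝ (fun z => u z * v z) y = u y • fderiv ℝ v y + v y • fderiv ℝ u y := this
  simp only [pd, h2]
  simp
  ring

lemma pd_add {u v : E' n → ℝ} (hu : Sm u) (hv : Sm v) (a : Fin n) (y : E' n) :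
    pd a (fun z => u z + v z) y = pd a u y + pd a v y := by
  simp [pd, fderiv_fun_add (hu.diff y) (hv.diff y)]

lemma pd_sub {u v : E' n → ℝ} (hu : Sm u) (hv : Sm v) (a : Fin n) (y : E' n) :
    pd a (fun z => u z - v z) y = pd a u y - pd a v y := by
  simp [pd, fderiv_fun_sub (hu.diff y) (hv.diff y)]

lemma pd_sum {κ : Type*} {s : Finset κ} {u : κ → E' n → ℝ} (hu : ∀ c ∈ s, Sm (u c))
    (a : Fin n) (y : E' n) :
    pd a (fun z => ∑ c ∈ s, u c z) y = ∑ c ∈ s, pd a (u c) y := by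
  simp [pd, fderiv_fun_sum (fun c hc => (hu c hc).diff y)]

lemma pd_comm {u : E' n → ℝ} (hu : Sm u) (a b : Fin n) (y : E' n) :
    pd a (pd b u) y = pd b (pd a u) y := by
  have h : ContDiff ℝ (⊤ : ℕ∞) (fderiv ℝ u) := hu.fderiv_right (by simp)
  have key : ∀ b c : Fin n, pd c (pd b u) y =
      fderiv ℝ (fderiv ℝ u) y (EuclideanSpace.single c 1) (EuclideanSpace.single b 1) := by
    intro b c
    have hd : DifferentiableAt ℝ (fderiv ℝ u) y := (h.differentiable (by simp)) y
    have : pd b u = fun z => fderiv ℝ u z (EuclideanSpace.single b 1) := rfl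
    rw [this, pd, fderiv_clm_apply hd (by fun_prop)]
    simp
  have hs : IsSymmSndFDerivAt ℝ u y :=
    (contDiff_infty.1 hu 2).contDiffAt.isSymmSndFDerivAt
      (by simp [minSmoothness_of_isRCLikeNormedField])
  rw [key, key]
  exact hs _ _

lemma pd_eqOn_ball {u v : E' n → ℝ} (h : EqOn u v (Metric.ball 0 1)) (a : Fin n) :
    EqOn (pd a u) (pd a v) (Metric.ball 0 1) := by
  intro y hy
  have : u =ᶠ[𝓝 y] v := h.eventuallyEq_of_mem (Metric.isOpen_ball.mem_nhds hy)
  simp [pd, this.fderiv_eq]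

end PartialDerivatives

section GradedBounds

variable {ι : Type*} {p : ℝ≥0∞} {N R : ι → ℕ → ℝ≥0∞}

/-- `Graded p R d k u` : for a family `u` of functions on the unit ball, the `L^p` norms of the
derivatives of order `j < d` are bounded by a constant times `R (k + j)`, uniformly in the
family. -/
def Graded (p : ℝ≥0∞) (R : ι → ℕ → ℝ≥0∞) : ℕ → ℕ → (ι → E' n → ℝ) → Prop
  | 0, _, _ => True
  | d + 1, k, u => (∃ C : ℝ≥0, ∀ i, eLpNorm (u i) p (ballMeas n) ≤ C * R i k) ∧
      ∀ a, Graded p R d (k + 1) (fun i => pd a (u i))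

/-- Families of weights `N`, `R` for which the weights `R` absorb multiplication by `N`. -/
structure Weights (N R : ι → ℕ → ℝ≥0∞) : Prop where
  mul : ∀ k l, ∃ C : ℝ≥0, ∀ i, N i k * R i l ≤ C * R i (k + l)
  one : ∃ C : ℝ≥0, ∀ i, 1 ≤ C * N i 0
  mono : ∀ k, ∃ C : ℝ≥0, ∀ i, R i k ≤ C * R i (k + 1)

lemma Sm.aesm {u : E' n → ℝ} (hu : Sm u) : AEStronglyMeasurable u (ballMeas n) :=
  hu.continuous.aestronglyMeasurable

lemma ae_ballMeas {P : E' n → Prop} (h : ∀ y ∈ Metric.ball (0 : E' n) 1, P y) :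
    ∀ᵐ y ∂(ballMeas n), P y :=
  (ae_restrict_iff' Metric.isOpen_ball.measurableSet).2 (Filter.Eventually.of_forall h)

lemma Graded.congr {d k : ℕ} {u v : ι → E' n → ℝ} (hu : Graded p R d k u)
    (h : ∀ i, EqOn (u i) (v i) (Metric.ball 0 1)) : Graded p R d k v := by
  induction d generalizing k u v with
  | zero => trivial
  | succ d ih =>
    refine ⟨?_, fun a => ih (hu.2 a) fun i => pd_eqOn_ball (h i) a⟩
    obtain ⟨C, hC⟩ := hu.1
    refine ⟨C, fun i => ?_⟩
    rw [← eLpNorm_congr_ae (ae_ballMeas (h i))]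
    exact hC i

lemma Graded.pred {d k : ℕ} {u : ι → E' n → ℝ} (hu : Graded p R (d + 1) k u) :
    Graded p R d k u := by
  induction d generalizing k u with
  | zero => trivial
  | succ d ih => exact ⟨hu.1, fun a => ih (hu.2 a)⟩

lemma Graded.shift (hR : ∀ k, ∃ C : ℝ≥0, ∀ i, R i k ≤ C * R i (k + 1)) {d k : ℕ}
    {u : ι → E' n → ℝ} (hu : Graded p R d k u) : Graded p R d (k + 1) u := by
  induction d generalizing k u with
  | zero => trivial
  | succ d ih =>
    refine ⟨?_, fun a => ih (hu.2 a)⟩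
    obtain ⟨C, hC⟩ := hu.1
    obtain ⟨D, hD⟩ := hR k
    refine ⟨C * D, fun i => (hC i).trans ?_⟩
    rw [ENNReal.coe_mul, mul_assoc]
    gcongr
    exact hD i

lemma Graded.add [Fact (1 ≤ p)] {d k : ℕ} {u v : ι → E' n → ℝ} (su : ∀ i, Sm (u i))
    (sv : ∀ i, Sm (v i)) (hu : Graded p R d k u) (hv : Graded p R d k v) :
    Graded p R d k (fun i y => u i y + v i y) := by
  induction d generalizing k u v with
  | zero => trivial
  | succ d ih =>
    refine ⟨?_, fun a => ?_⟩
    · obtain ⟨C, hC⟩ := hu.1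
      obtain ⟨D, hD⟩ := hv.1
      refine ⟨C + D, fun i => (eLpNorm_add_le (su i).aesm (sv i).aesm Fact.out).trans ?_⟩
      rw [ENNReal.coe_add, add_mul]
      exact add_le_add (hC i) (hD i)
    · have := ih (fun i => (su i).pd a) (fun i => (sv i).pd a) (hu.2 a) (hv.2 a)
      exact this.congr fun i y _ => (pd_add (su i) (sv i) a y).symm

lemma Graded.zero {d k : ℕ} : Graded p R d k (fun (_ : ι) (_ : E' n) => (0 : ℝ)) := by
  induction d generalizing k with
  | zero => trivial
  | succ d ih =>
    refine ⟨⟨0, fun i => by simp⟩, fun a => ?_⟩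
    exact (ih (k := k + 1)).congr fun i y _ => (pd_const a 0 y).symm

lemma Graded.sum [Fact (1 ≤ p)] {κ : Type*} {s : Finset κ} {d k : ℕ} {u : κ → ι → E' n → ℝ}
    (su : ∀ c i, Sm (u c i)) (hu : ∀ c ∈ s, Graded p R d k (u c)) :
    Graded p R d k (fun i y => ∑ c ∈ s, u c i y) := by
  classical
  induction s using Finset.induction_on with
  | empty => simpa using Graded.zero
  | insert c s hc ih =>
    simp only [Finset.sum_insert hc]
    refine Graded.add (su c) (fun i => Sm.sum fun c _ => su c i) (hu c (by simp)) ?_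
    exact ih fun c hc => hu c (by simp [hc])

lemma Graded.mul [Fact (1 ≤ p)] (hNR : ∀ k l, ∃ C : ℝ≥0, ∀ i, N i k * R i l ≤ C * R i (k + l))
    {d k l : ℕ} {b u : ι → E' n → ℝ} (sb : ∀ i, Sm (b i)) (su : ∀ i, Sm (u i))
    (hb : Graded ∞ N d k b) (hu : Graded p R d l u) :
    Graded p R d (k + l) (fun i y => b i y * u i y) := by
  induction d generalizing k l b u with
  | zero => trivial
  | succ d ih =>
    refine ⟨?_, fun a => ?_⟩
    · obtain ⟨C, hC⟩ := hb.1
      obtain ⟨D, hD⟩ := hu.1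
      obtain ⟨K, hK⟩ := hNR k l
      refine ⟨C * D * K, fun i => ?_⟩
      calc eLpNorm (fun y => b i y * u i y) p (ballMeas n)
          ≤ (1 : ℝ≥0) * eLpNorm (b i) ∞ (ballMeas n) * eLpNorm (u i) p (ballMeas n) :=
            eLpNorm_le_eLpNorm_top_mul_eLpNorm p _ (su i).aesm (fun x y => x * y) 1
              (Filter.Eventually.of_forall fun y => by simp)
        _ ≤ (1 : ℝ≥0) * (C * N i k) * (D * R i l) := by
            gcongr
            exacts [hC i, hD i]
        _ = C * D * (N i k * R i l) := by simp; ring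
        _ ≤ C * D * (K * R i (k + l)) := mul_le_mul' le_rfl (hK i)
        _ = _ := by push_cast; ring
    · have h1 := ih (fun i => (sb i).pd a) su (hb.2 a) hu.pred
      have h2 := ih sb (fun i => (su i).pd a) hb.pred (hu.2 a)
      rw [add_right_comm] at h1
      rw [← add_assoc] at h2
      refine (Graded.add (fun i => ((sb i).pd a).mul (su i)) (fun i => (sb i).mul ((su i).pd a))
        h1 h2).congr fun i y _ => (pd_mul (sb i) (su i) a y).symm

lemma Graded.fixed (hN : ∃ C : ℝ≥0, ∀ i, 1 ≤ C * N i 0)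
    (hm : ∀ k, ∃ C : ℝ≥0, ∀ i, N i k ≤ C * N i (k + 1)) {d : ℕ} {s : E' n → ℝ} (hs : Sm s) :
    Graded ∞ N d 0 (fun _ => s) := by
  induction d generalizing s with
  | zero => trivial
  | succ d ih =>
    refine ⟨?_, fun a => (ih (hs.pd a)).shift hm⟩
    obtain ⟨C, hC⟩ := hN
    obtain ⟨M, hM⟩ := (isCompact_closedBall (0 : E' n) 1).exists_bound_of_continuousOn
      hs.continuous.continuousOn
    have hle : eLpNorm s ∞ (ballMeas n) ≤ ENNReal.ofReal M := by
      rw [eLpNorm_exponent_top]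
      exact eLpNormEssSup_le_of_ae_bound
        (ae_ballMeas fun y hy => hM y (Metric.ball_subset_closedBall hy))
    refine ⟨M.toNNReal * C, fun i => hle.trans ?_⟩
    calc ENNReal.ofReal M = ENNReal.ofReal M * 1 := by simp
      _ ≤ ENNReal.ofReal M * (C * N i 0) := by gcongr; exact hC i
      _ = _ := by rw [ENNReal.coe_mul, mul_assoc]; rfl

lemma Graded.smul_fixed [Fact (1 ≤ p)] (hN : Weights N N) (hR : Weights N R) {d l : ℕ}
    {s : E' n → ℝ} {u : ι → E' n → ℝ} (hs : Sm s) (su : ∀ i, Sm (u i)) (hu : Graded p R d l u) :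
    Graded p R d l (fun i y => s y * u i y) := by
  have := Graded.mul hR.mul (fun _ => hs) su (Graded.fixed hN.one hN.mono (d := d) hs) hu
  rwa [zero_add] at this

lemma Graded.sub [Fact (1 ≤ p)] (hN : Weights N N) (hR : Weights N R) {d k : ℕ}
    {u v : ι → E' n → ℝ} (su : ∀ i, Sm (u i))
    (sv : ∀ i, Sm (v i)) (hu : Graded p R d k u) (hv : Graded p R d k v) :
    Graded p R d k (fun i y => u i y - v i y) := by
  have h := Graded.smul_fixed hN hR (s := fun _ => -1) contDiff_const sv hv
  refine (Graded.add su (fun i => contDiff_const.mul (sv i)) hu h).congr fun i y _ => ?_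
  simp [sub_eq_add_neg]

end GradedBounds

section BallIntegrals

lemma mem_ball_iff_sum (y : E' n) :
    y ∈ Metric.ball (0 : E' n) 1 ↔ ∑ c, y c ^ 2 < 1 := by
  rw [mem_ball_zero_iff, ← EuclideanSpace.real_norm_sq_eq, sq_lt_one_iff₀ (norm_nonneg _)]

lemma mem_sphere_iff_sum (y : E' n) : y ∈ Sphere' n ↔ ∑ c, y c ^ 2 = 1 := by
  rw [Sphere', mem_sphere_zero_iff_norm, ← EuclideanSpace.real_norm_sq_eq,
    pow_eq_one_iff_of_nonneg (norm_nonneg _) two_ne_zero]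

lemma Sm.integrable {u : E' n → ℝ} (hu : Sm u) : Integrable u (ballMeas n) :=
  ((hu.continuous.continuousOn (s := Metric.closedBall 0 1)).integrableOn_compact
    (isCompact_closedBall _ _)).mono_set Metric.ball_subset_closedBall

lemma Sm.exists_bound {u : E' n → ℝ} (hu : Sm u) :
    ∃ M : ℝ, 0 ≤ M ∧ ∀ y ∈ Metric.ball (0 : E' n) 1, |u y| ≤ M := by
  obtain ⟨M, hM⟩ := (isCompact_closedBall (0 : E' n) 1).exists_bound_of_continuousOn
    hu.continuous.continuousOn
  exact ⟨M, (norm_nonneg _).trans (hM 0 (by simp)),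
    fun y hy => hM y (Metric.ball_subset_closedBall hy)⟩

/-- Extension by zero of a smooth function vanishing on the unit sphere is Lipschitz. -/
lemma exists_lipschitzWith_indicator {u : E' n → ℝ} (hu : Sm u) (h0 : ∀ y ∈ Sphere' n, u y = 0)
    (a : Fin n) : ∃ L, LipschitzWith L ((Metric.ball (0 : E' n) 1).indicator u) := by
  have hc : Continuous (fderiv ℝ u) := (hu.continuous_fderiv (by simp))
  obtain ⟨M, hM⟩ := (isCompact_closedBall (0 : E' n) 1).exists_bound_of_continuousOn
    hc.continuousOn
  have hL : LipschitzOnWith M.toNNReal u (Metric.closedBall 0 1) := by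
    refine (convex_closedBall (0 : E' n) 1).lipschitzOnWith_of_nnnorm_fderiv_le
      (fun y _ => hu.diff y) fun y hy => ?_
    rw [← NNReal.coe_le_coe, coe_nnnorm]
    exact (hM y hy).trans (Real.le_coe_toNNReal M)
  have key : ∀ x ∈ Metric.ball (0 : E' n) 1, ∀ z ∉ Metric.ball (0 : E' n) 1,
      ‖u x‖ ≤ M.toNNReal * dist x z := by
    intro x hx z hz
    rw [mem_ball_zero_iff] at hx hz
    obtain ⟨w, hw, hxw⟩ : ∃ w ∈ Sphere' n, dist x w ≤ 1 - ‖x‖ := by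
      by_cases hx0 : x = 0
      · refine ⟨EuclideanSpace.single a 1, by simp [Sphere'], by simp [hx0]⟩
      · have hpos : 0 < ‖x‖ := norm_pos_iff.2 hx0
        refine ⟨‖x‖⁻¹ • x, by simp [Sphere', norm_smul, hpos.ne'], ?_⟩
        have : ‖x‖⁻¹ • x - x = (‖x‖⁻¹ - 1) • x := by rw [sub_smul, one_smul]
        rw [dist_comm, dist_eq_norm, this, norm_smul, Real.norm_eq_abs,
          abs_of_nonneg (sub_nonneg.2 ((one_le_inv₀ hpos).2 hx.le))]
        rw [sub_mul, inv_mul_cancel₀ hpos.ne', one_mul]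
    have hxz : 1 - ‖x‖ ≤ dist x z := by
      have := norm_sub_norm_le z x
      rw [dist_comm, dist_eq_norm]
      linarith
    have h1 := hL.dist_le_mul x (by simpa using hx.le) w
      (Metric.sphere_subset_closedBall hw)
    rw [h0 w hw, dist_zero_right] at h1
    exact h1.trans (by gcongr; exact hxw.trans hxz)
  refine ⟨M.toNNReal, LipschitzWith.of_dist_le_mul fun x z => ?_⟩
  by_cases hx : x ∈ Metric.ball (0 : E' n) 1 <;> by_cases hz : z ∈ Metric.ball (0 : E' n) 1
  · rw [indicator_of_mem hx, indicator_of_mem hz]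
    exact hL.dist_le_mul x (Metric.ball_subset_closedBall hx) z
      (Metric.ball_subset_closedBall hz)
  · rw [indicator_of_mem hx, indicator_of_notMem hz, dist_zero_right]
    exact key x hx z hz
  · rw [indicator_of_notMem hx, indicator_of_mem hz, dist_zero_left, dist_comm x z]
    exact key z hz x hx
  · rw [indicator_of_notMem hx, indicator_of_notMem hz, dist_self]
    positivity

lemma integral_pd_eq_zero {u : E' n → ℝ} (hu : Sm u) (h0 : ∀ y ∈ Sphere' n, u y = 0)
    (a : Fin n) : ∫ y, pd a u y ∂(ballMeas n) = 0 := by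
  obtain ⟨L, hL⟩ := exists_lipschitzWith_indicator hu h0 a
  have hcs : HasCompactSupport ((Metric.ball (0 : E' n) 1).indicator u) :=
    HasCompactSupport.intro (isCompact_closedBall (0 : E' n) 1) fun y hy =>
      indicator_of_notMem (fun h => hy (Metric.ball_subset_closedBall h)) _
  have key := LipschitzWith.integral_lineDeriv_mul_eq (μ := (volume : Measure (E' n)))
    (LipschitzWith.const (1 : ℝ)) hL hcs (-EuclideanSpace.single a (1 : ℝ))
  have hs : ∀ᵐ y : E' n, y ∉ Metric.sphere (0 : E' n) 1 :=
    measure_eq_zero_iff_ae_notMem.1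
      (Measure.addHaar_sphere_of_ne_zero volume 0 one_ne_zero)
  have hae : (fun y => lineDeriv ℝ ((Metric.ball (0 : E' n) 1).indicator u) y
      (EuclideanSpace.single a (1 : ℝ))) =ᵐ[volume]
      (Metric.ball (0 : E' n) 1).indicator (pd a u) := by
    filter_upwards [hs] with y hy
    by_cases hyb : y ∈ Metric.ball (0 : E' n) 1
    · rw [indicator_of_mem hyb]
      have : (Metric.ball (0 : E' n) 1).indicator u =ᶠ[𝓝 y] u := by
        filter_upwards [Metric.isOpen_ball.mem_nhds hyb] with z hz
        exact indicator_of_mem hz u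
      rw [this.lineDeriv_eq, (hu.diff y).lineDeriv_eq_fderiv]
      rfl
    · rw [indicator_of_notMem hyb]
      have : (Metric.ball (0 : E' n) 1).indicator u =ᶠ[𝓝 y] fun _ => 0 := by
        have hyc : y ∈ (Metric.closedBall (0 : E' n) 1)ᶜ := by
          simp only [Metric.mem_sphere, Metric.mem_ball, mem_compl_iff,
            Metric.mem_closedBall] at *
          exact fun h => hyb (lt_of_le_of_ne h hy)
        filter_upwards [Metric.isClosed_closedBall.isOpen_compl.mem_nhds hyc] with z hz
        exact indicator_of_notMem (fun h => hz (Metric.ball_subset_closedBall h)) u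
      rw [this.lineDeriv_eq]
      simp [lineDeriv]
  have hlc : ∀ x v : E' n, lineDeriv ℝ (fun _ : E' n => (1 : ℝ)) x v = 0 := by
    intro x v; simp [lineDeriv]
  simp only [hlc, zero_mul, integral_zero, neg_neg, mul_one] at key
  rw [integral_congr_ae hae, integral_indicator Metric.isOpen_ball.measurableSet] at key
  exact key.symm

lemma integral_mul_pd {u v : E' n → ℝ} (hu : Sm u) (hv : Sm v) (h0 : ∀ y ∈ Sphere' n, v y = 0)
    (a : Fin n) :
    ∫ y, u y * pd a v y ∂(ballMeas n) = - ∫ y, pd a u y * v y ∂(ballMeas n) := by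
  have h := integral_pd_eq_zero (hu.mul hv) (fun y hy => by simp [h0 y hy]) a
  have e : ∀ y, pd a (fun z => u z * v z) y = _ := pd_mul hu hv a
  have h' : ∫ y, pd a (fun z => u z * v z) y ∂(ballMeas n) = 0 := h
  simp only [e] at h'
  rw [integral_add ((hu.pd a).mul hv).integrable (hu.mul (hv.pd a)).integrable] at h'
  linarith

/-- A vector field acting as a derivation. -/
def fieldDeriv (s : Fin n → E' n → ℝ) (u : E' n → ℝ) (y : E' n) : ℝ := ∑ a, s a y * pd a u y

/-- Coordinate divergence of a vector field. -/
def fieldDiv (s : Fin n → E' n → ℝ) (y : E' n) : ℝ := ∑ a, pd a (s a) y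

/-- Smooth vector fields tangent to the unit sphere: they preserve functions vanishing on the
sphere and can be integrated by parts over the ball without boundary terms. -/
structure TangentField (s : Fin n → E' n → ℝ) : Prop where
  smooth : ∀ a, Sm (s a)
  bdry : ∀ u : E' n → ℝ, Sm u → (∀ y ∈ Sphere' n, u y = 0) →
    ∀ y ∈ Sphere' n, fieldDeriv s u y = 0
  integral : ∀ u : E' n → ℝ, Sm u →
    ∫ y, fieldDeriv s u y ∂(ballMeas n) = - ∫ y, fieldDiv s y * u y ∂(ballMeas n)

lemma Sm.fieldDeriv {s : Fin n → E' n → ℝ} {u : E' n → ℝ} (hs : ∀ a, Sm (s a)) (hu : Sm u) :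
    Sm (fieldDeriv s u) := Sm.sum fun a _ => (hs a).mul (hu.pd a)

lemma Sm.fieldDiv {s : Fin n → E' n → ℝ} (hs : ∀ a, Sm (s a)) :
    Sm (fieldDiv s) := Sm.sum fun a _ => (hs a).pd a

/-- Defining function of the unit ball. -/
def rho (y : E' n) : ℝ := 1 - ∑ c, y c ^ 2

lemma Sm.rho : Sm (rho : E' n → ℝ) :=
  contDiff_const.sub (Sm.sum fun c _ => (Sm.coord c).pow 2)

/-- The field `(1 - |y|²) ∂_c`. -/
def radialField (c : Fin n) (a : Fin n) (y : E' n) : ℝ := if a = c then rho y else 0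

/-- The rotation field `y^i ∂_j - y^j ∂_i`. -/
def rotField (i j : Fin n) (a : Fin n) (y : E' n) : ℝ :=
  (if a = j then y i else 0) - (if a = i then y j else 0)

lemma radialField_deriv (c : Fin n) (u : E' n → ℝ) (y : E' n) :
    fieldDeriv (radialField c) u y = rho y * pd c u y := by
  simp [fieldDeriv, radialField]

lemma rotField_deriv (i j : Fin n) (u : E' n → ℝ) (y : E' n) :
    fieldDeriv (rotField i j) u y = y i * pd j u y - y j * pd i u y := by
  simp [fieldDeriv, rotField, sub_mul, Finset.sum_sub_distrib]

lemma rho_sphere {y : E' n} (hy : y ∈ Sphere' n) : rho y = 0 := by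
  rw [mem_sphere_iff_sum] at hy
  simp [rho, hy]

lemma tangentField_radial (c : Fin n) : TangentField (radialField (n := n) c) := by
  have hsm : ∀ a, Sm (radialField (n := n) c a) := by
    intro a
    by_cases h : a = c
    · have e : radialField (n := n) c a = rho := by ext z; simp [radialField, h]
      rw [e]; exact Sm.rho
    · have e : radialField (n := n) c a = fun _ => 0 := by ext z; simp [radialField, h]
      rw [e]; exact Sm.const 0
  refine ⟨hsm, fun u _ _ y hy => by simp [radialField_deriv, rho_sphere hy], fun u hu => ?_⟩
  have h1 : ∀ y : E' n, fieldDiv (radialField c) y = pd c rho y := by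
    intro y
    rw [fieldDiv, Finset.sum_eq_single c]
    · congr 1; ext z; simp [radialField]
    · intro b _ hb
      have : radialField (n := n) c b = fun _ => 0 := by ext z; simp [radialField, hb]
      rw [this, pd_const]
    · simp
  simp only [radialField_deriv, h1]
  have := integral_mul_pd hu Sm.rho (fun y hy => rho_sphere hy) c
  simp only [mul_comm (rho _), mul_comm (pd c rho _)]
  rw [this, neg_neg]

lemma fderiv_eq_zero_of_tangent {u : E' n → ℝ} (hu : Sm u) (h0 : ∀ y ∈ Sphere' n, u y = 0)
    {y v : E' n} (hy : y ∈ Sphere' n) (hv : inner ℝ y v = 0) : fderiv ℝ u y v = 0 := by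
  have hy1 : ‖y‖ = 1 := by simpa [Sphere'] using hy
  let c : ℝ → ℝ := fun t => (Real.sqrt (1 + t ^ 2 * ‖v‖ ^ 2))⁻¹
  have hpos : ∀ t : ℝ, 0 < 1 + t ^ 2 * ‖v‖ ^ 2 := fun t => by positivity
  have hnorm : ∀ t : ℝ, ‖y + t • v‖ ^ 2 = 1 + t ^ 2 * ‖v‖ ^ 2 := by
    intro t
    rw [norm_add_sq_real, inner_smul_right, hv, hy1, norm_smul, mul_pow, Real.norm_eq_abs,
      sq_abs]
    ring
  have hc : HasDerivAt c 0 0 := by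
    have h1 : HasDerivAt (fun t : ℝ => 1 + t ^ 2 * ‖v‖ ^ 2) 0 0 := by
      have := ((hasDerivAt_pow 2 (0 : ℝ)).mul_const (‖v‖ ^ 2)).const_add 1
      simpa using this
    have h2 := (h1.sqrt (hpos 0).ne').inv (Real.sqrt_pos.2 (hpos 0)).ne'
    have h3 : HasDerivAt c _ 0 := h2
    convert h3 using 1
    simp
  have hg : HasDerivAt (fun t : ℝ => c t • (y + t • v)) v 0 := by
    have h1 : HasDerivAt (fun t : ℝ => y + t • v) v 0 := by
      simpa using ((hasDerivAt_id (0 : ℝ)).smul_const v).const_add y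
    have h2 : HasDerivAt (fun t : ℝ => c t • (y + t • v)) _ 0 := hc.smul h1
    convert h2 using 1
    simp [c]
  have hz : (fun t : ℝ => u (c t • (y + t • v))) = fun _ => 0 := by
    ext t
    refine h0 _ ?_
    have : ‖y + t • v‖ = Real.sqrt (1 + t ^ 2 * ‖v‖ ^ 2) := by
      rw [← hnorm t, Real.sqrt_sq (norm_nonneg _)]
    have hp := Real.sqrt_pos.2 (hpos t)
    rw [Sphere', mem_sphere_zero_iff_norm, norm_smul, this, norm_inv, Real.norm_eq_abs,
      abs_of_pos hp, inv_mul_cancel₀ hp.ne']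
  have hcomp : HasDerivAt (fun t : ℝ => u (c t • (y + t • v))) (fderiv ℝ u y v) 0 := by
    have hd : HasFDerivAt u (fderiv ℝ u y) (c 0 • (y + (0 : ℝ) • v)) := by
      simpa [c] using (hu.diff y).hasFDerivAt
    exact hd.comp_hasDerivAt 0 hg
  rw [hz] at hcomp
  exact hcomp.unique (hasDerivAt_const _ _)

lemma integral_eq_zero_of_forall_pow {G : E' n → ℝ} (hG : Sm G)
    (h : ∀ m : ℕ, ∫ y, (1 - (∑ c, y c ^ 2) ^ m) * G y ∂(ballMeas n) = 0) :
    ∫ y, G y ∂(ballMeas n) = 0 := by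
  have hs : Sm (fun y : E' n => ∑ c, y c ^ 2) := Sm.sum fun c _ => (Sm.coord c).pow 2
  have h1 : ∀ m : ℕ, ∫ y, G y ∂(ballMeas n) =
      ∫ y, (∑ c, y c ^ 2) ^ m * G y ∂(ballMeas n) := by
    intro m
    have := h m
    simp only [sub_mul, one_mul] at this
    rw [integral_sub hG.integrable (((hs.pow m).mul hG).integrable)] at this
    linarith
  have hlim : Filter.Tendsto
      (fun m : ℕ => ∫ y, (∑ c, y c ^ 2) ^ m * G y ∂(ballMeas n)) Filter.atTop
      (𝓝 (∫ _, (0 : ℝ) ∂(ballMeas n))) := by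
    refine tendsto_integral_of_dominated_convergence (fun y => ‖G y‖)
      (fun m => ((hs.pow m).mul hG).aesm) hG.integrable.norm (fun m => ?_) ?_
    · refine ae_ballMeas fun y hy => ?_
      rw [mem_ball_iff_sum] at hy
      have h0 : 0 ≤ ∑ c, y c ^ 2 := Finset.sum_nonneg fun c _ => sq_nonneg _
      rw [norm_mul, norm_pow, Real.norm_of_nonneg h0]
      exact mul_le_of_le_one_left (norm_nonneg _) (pow_le_one₀ h0 hy.le)
    · refine ae_ballMeas fun y hy => ?_
      rw [mem_ball_iff_sum] at hy
      have h0 : 0 ≤ ∑ c, y c ^ 2 := Finset.sum_nonneg fun c _ => sq_nonneg _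
      simpa using (tendsto_pow_atTop_nhds_zero_of_lt_one h0 hy).mul_const (G y)
  simp only [← h1, integral_zero] at hlim
  exact tendsto_nhds_unique tendsto_const_nhds hlim

lemma tangentField_of_orthogonal {s : Fin n → E' n → ℝ} (hs : ∀ a, Sm (s a))
    (ho : ∀ y, ∑ a, s a y * y a = 0) : TangentField s := by
  refine ⟨hs, fun u hu h0 y hy => ?_, fun u hu => ?_⟩
  · have hv : fderiv ℝ u y (WithLp.toLp 2 fun a => s a y) = 0 := by
      refine fderiv_eq_zero_of_tangent hu h0 hy ?_
      simpa [PiLp.inner_apply, mul_comm] using ho y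
    have hd : (WithLp.toLp 2 fun a => s a y : E' n) =
        ∑ a, s a y • EuclideanSpace.single a (1 : ℝ) := by
      ext b
      simp [Pi.single_apply]
    rw [hd] at hv
    simpa [fieldDeriv, pd] using hv
  · have hG : Sm (fun y => fieldDiv s y * u y + fieldDeriv s u y) :=
      ((Sm.fieldDiv hs).mul hu).add (Sm.fieldDeriv hs hu)
    have hsum : Sm (fun y : E' n => ∑ c, y c ^ 2) := Sm.sum fun c _ => (Sm.coord c).pow 2
    suffices h : ∫ y, fieldDiv s y * u y + fieldDeriv s u y ∂(ballMeas n) = 0 by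
      rw [integral_add ((Sm.fieldDiv hs).mul hu).integrable
        (Sm.fieldDeriv hs hu).integrable] at h
      linarith
    refine integral_eq_zero_of_forall_pow hG fun m => ?_
    have hη : Sm (fun y : E' n => 1 - (∑ c, y c ^ 2) ^ m) := contDiff_const.sub (hsum.pow m)
    have hpη : ∀ y : E' n, ∃ k : ℝ, ∀ a,
        pd a (fun y : E' n => 1 - (∑ c, y c ^ 2) ^ m) y = k * y a := by
      intro y
      have h1 : ∀ a, pd a (fun y : E' n => ∑ c, y c ^ 2) y = 2 * y a := by
        intro a
        rw [pd_sum (u := fun (c : Fin n) (y : E' n) => y c ^ 2)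
          (fun c _ => (Sm.coord c).pow 2)]
        have : ∀ c, pd a (fun z : E' n => z c ^ 2) y = if a = c then 2 * y c else 0 := by
          intro c
          simp only [pow_two]
          rw [pd_mul (Sm.coord c) (Sm.coord c), pd_coord]
          split_ifs <;> ring
        simp [this]
      have h2 : HasFDerivAt (fun y : E' n => 1 - (∑ c, y c ^ 2) ^ m) _ y :=
        ((hsum.diff y).hasFDerivAt.pow m).const_sub 1
      refine ⟨-(m * (∑ c, y c ^ 2) ^ (m - 1)) * 2, fun a => ?_⟩
      have h3 := h1 a
      simp only [pd] at h3 ⊢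
      rw [h2.fderiv]
      simp [h3]
      ring
    have h1 : ∀ a, ∫ y, pd a (fun y => s a y * u y * (1 - (∑ c, y c ^ 2) ^ m)) y
        ∂(ballMeas n) = 0 := by
      intro a
      by_cases hm : m = 0
      · subst hm
        simp [pd_const]
      refine integral_pd_eq_zero (((hs a).mul hu).mul hη) (fun y hy => ?_) a
      rw [mem_sphere_iff_sum] at hy
      simp [hy]
    have h2 : ∫ y, ∑ a, pd a (fun y => s a y * u y * (1 - (∑ c, y c ^ 2) ^ m)) y
        ∂(ballMeas n) = 0 := by
      rw [integral_finsetSum _ fun a _ => ((((hs a).mul hu).mul hη).pd a).integrable]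
      simp [h1]
    rw [← h2]
    congr 1
    ext y
    obtain ⟨k, hk⟩ := hpη y
    have h3 : ∀ a, pd a (fun y => s a y * u y * (1 - (∑ c, y c ^ 2) ^ m)) y =
        (pd a (s a) y * u y + s a y * pd a u y) * (1 - (∑ c, y c ^ 2) ^ m) +
          k * u y * (s a y * y a) := by
      intro a
      rw [pd_mul ((hs a).mul hu) hη, pd_mul (hs a) hu, hk]
      ring
    simp only [h3]
    rw [Finset.sum_add_distrib, ← Finset.mul_sum, ho y, ← Finset.sum_mul,
      Finset.sum_add_distrib, ← Finset.sum_mul]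
    simp only [fieldDiv, fieldDeriv]
    ring

lemma tangentField_rot (i j : Fin n) : TangentField (rotField (n := n) i j) := by
  refine tangentField_of_orthogonal (fun a => ?_) fun y => ?_
  · refine ContDiff.sub ?_ ?_ <;> split_ifs
    exacts [Sm.coord i, contDiff_const, Sm.coord j, contDiff_const]
  · simp [rotField, sub_mul, Finset.sum_sub_distrib]
    ring

end BallIntegrals

section Energy

/-- The `L²` norm over the unit ball. -/
def normL2 (u : E' n → ℝ) : ℝ := Real.sqrt (∫ y, u y ^ 2 ∂(ballMeas n))

lemma normL2_nonneg (u : E' n → ℝ) : 0 ≤ normL2 u := Real.sqrt_nonneg _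

lemma normL2_sq (u : E' n → ℝ) : normL2 u ^ 2 = ∫ y, u y ^ 2 ∂(ballMeas n) :=
  Real.sq_sqrt (integral_nonneg fun _ => sq_nonneg _)

lemma abs_integral_mul_le {u v : E' n → ℝ} (hu : Sm u) (hv : Sm v) :
    |∫ y, u y * v y ∂(ballMeas n)| ≤ normL2 u * normL2 v := by
  have hq : ∀ t : ℝ, 0 ≤ normL2 v ^ 2 * (t * t) +
      2 * (∫ y, u y * v y ∂(ballMeas n)) * t + normL2 u ^ 2 := by
    intro t
    have h : 0 ≤ ∫ y, (u y + t * v y) ^ 2 ∂(ballMeas n) := integral_nonneg fun _ => sq_nonneg _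
    have e : ∀ y, (u y + t * v y) ^ 2 = t * t * v y ^ 2 + (2 * t * (u y * v y) + u y ^ 2) := by
      intro y; ring
    simp only [e] at h
    rw [integral_add ((Sm.const _).mul (hv.pow 2)).integrable
      (((Sm.const _).mul (hu.mul hv)).add (hu.pow 2)).integrable,
      integral_add ((Sm.const _).mul (hu.mul hv)).integrable (hu.pow 2).integrable,
      integral_const_mul, integral_const_mul] at h
    rw [normL2_sq, normL2_sq]
    linarith
  have hd := discrim_le_zero hq
  rw [discrim] at hd
  rw [← Real.sqrt_sq (mul_nonneg (normL2_nonneg u) (normL2_nonneg v))]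
  exact Real.abs_le_sqrt (by nlinarith)

lemma normL2_le_of_sq_le {u : E' n → ℝ} {c : ℝ} (hc : 0 ≤ c)
    (h : ∫ y, u y ^ 2 ∂(ballMeas n) ≤ c ^ 2) : normL2 u ≤ c :=
  (Real.sqrt_le_sqrt h).trans (Real.sqrt_sq hc).le

lemma normL2_mul_le {s u : E' n → ℝ} (hs : Sm s) (hu : Sm u) {M : ℝ} (hM : 0 ≤ M)
    (hb : ∀ y ∈ Metric.ball (0 : E' n) 1, |s y| ≤ M) :
    normL2 (fun y => s y * u y) ≤ M * normL2 u := by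
  refine normL2_le_of_sq_le (mul_nonneg hM (normL2_nonneg u)) ?_
  rw [mul_pow, normL2_sq, ← integral_const_mul]
  refine integral_mono_ae ((hs.mul hu).pow 2).integrable
    ((Sm.const _).mul (hu.pow 2)).integrable (ae_ballMeas fun y hy => ?_)
  simp only [mul_pow]
  exact mul_le_mul_of_nonneg_right
    (sq_le_sq' (abs_le.1 (hb y hy)).1 (abs_le.1 (hb y hy)).2) (sq_nonneg _)

/-- The Dirichlet seminorm. -/
def normGrad (u : E' n → ℝ) : ℝ := Real.sqrt (∑ b, normL2 (pd b u) ^ 2)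

lemma normGrad_nonneg (u : E' n → ℝ) : 0 ≤ normGrad u := Real.sqrt_nonneg _

lemma normGrad_sq (u : E' n → ℝ) : normGrad u ^ 2 = ∑ b, normL2 (pd b u) ^ 2 :=
  Real.sq_sqrt (Finset.sum_nonneg fun _ _ => sq_nonneg _)

lemma normL2_pd_le (u : E' n → ℝ) (b : Fin n) : normL2 (pd b u) ≤ normGrad u := by
  refine Real.le_sqrt_of_sq_le ?_
  exact Finset.single_le_sum (f := fun b => normL2 (pd b u) ^ 2)
    (fun _ _ => sq_nonneg _) (Finset.mem_univ b)

/-- Poincaré inequality on the unit ball. -/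
lemma normL2_le_normGrad {u : E' n → ℝ} (hu : Sm u) (h0 : ∀ y ∈ Sphere' n, u y = 0)
    (a : Fin n) : normL2 u ≤ 2 * normL2 (pd a u) := by
  have h := integral_mul_pd (Sm.coord a) (hu.mul hu) (fun y hy => by simp [h0 y hy]) a
  have e : ∀ y, pd a (fun z => u z * u z) y = _ := pd_mul hu hu a
  simp only [e, pd_coord, if_true, one_mul] at h
  have hsq : normL2 u ^ 2 = -∫ y, (2 * y a * u y) * pd a u y ∂(ballMeas n) := by
    rw [normL2_sq, ← integral_neg, eq_comm]
    have h2 : -∫ y, y a * (pd a u y * u y + u y * pd a u y) ∂(ballMeas n) =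
      ∫ y, u y * u y ∂(ballMeas n) := by rw [h, neg_neg]
    rw [← integral_neg] at h2
    convert h2 using 2
    · ext y; ring
    · ext y; ring
  have hb : ∀ y ∈ Metric.ball (0 : E' n) 1, |2 * y a| ≤ 2 := by
    intro y hy
    have h1 : |y a| ≤ ‖y‖ := by simpa using PiLp.norm_apply_le y a
    rw [mem_ball_zero_iff] at hy
    rw [abs_mul, abs_two]
    linarith
  have h1 := abs_integral_mul_le (((Sm.const 2).mul (Sm.coord a)).mul hu) (hu.pd a)
  have h2 := normL2_mul_le ((Sm.const 2).mul (Sm.coord a)) hu zero_le_two hb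
  have h3 : normL2 u ^ 2 ≤ 2 * normL2 u * normL2 (pd a u) := by
    rw [hsq]
    refine (neg_le_abs _).trans (h1.trans ?_)
    gcongr
    exact normL2_nonneg _
  by_contra! hlt
  have hp := normL2_nonneg (pd a u)
  nlinarith

/-- Energy estimate for a Dirichlet problem in divergence form, where a tangential derivative may
fall on the right-hand side. -/
lemma energy_estimate {s : Fin n → E' n → ℝ} (hs : TangentField s) {lam : ℝ} (hl : 0 < lam)
    (hn : 0 < n) :
    ∃ C : ℝ, 0 ≤ C ∧ ∀ (A : Fin n → Fin n → E' n → ℝ) (u f₀ f₁ : E' n → ℝ)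
      (V : Fin n → E' n → ℝ), (∀ a b, Sm (A a b)) → Sm u → Sm f₀ → Sm f₁ → (∀ a, Sm (V a)) →
      (∀ y ∈ Sphere' n, u y = 0) →
      (∀ y ∈ Metric.ball (0 : E' n) 1, ∀ ξ : Fin n → ℝ,
        lam * ∑ a, ξ a ^ 2 ≤ ∑ a, ∑ b, A a b y * ξ a * ξ b) →
      (∀ y ∈ Metric.ball (0 : E' n) 1, fieldDiv V y = fieldDeriv s f₀ y + f₁ y) →
      normGrad u ≤ C * (∑ a, normL2 (fun y => (∑ b, A a b y * pd b u y) - V a y)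
        + normL2 f₀ + normL2 f₁) := by
  obtain ⟨M, hM0, hM⟩ : ∃ M : ℝ, 0 ≤ M ∧ ∀ y ∈ Metric.ball (0 : E' n) 1,
    |fieldDiv s y| ≤ M := (Sm.fieldDiv hs.smooth).exists_bound
  choose m hm0 hm using fun a => (hs.smooth a).exists_bound
  have hm1 : 0 ≤ ∑ a, m a := Finset.sum_nonneg fun a _ => hm0 a
  refine ⟨lam⁻¹ * (1 + (2 * M + ∑ a, m a) + 2), by positivity, ?_⟩
  intro A u f₀ f₁ V hA hu hf₀ hf₁ hV h0 hell hdiv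
  set G := normGrad u with hG
  have hG0 : 0 ≤ G := normGrad_nonneg u
  have hAu : ∀ a, Sm (fun y => ∑ b, A a b y * pd b u y) :=
    fun a => Sm.sum fun b _ => (hA a b).mul (hu.pd b)
  set Φ : Fin n → E' n → ℝ := fun a y => (∑ b, A a b y * pd b u y) - V a y with hΦ
  have hΦs : ∀ a, Sm (Φ a) := fun a => (hAu a).sub (hV a)
  have hPoin : normL2 u ≤ 2 * G :=
    (normL2_le_normGrad hu h0 ⟨0, hn⟩).trans (by gcongr; exact normL2_pd_le u _)
  -- the quadratic form
  have h1 : lam * G ^ 2 ≤ ∑ a, ∫ y, Φ a y * pd a u y ∂(ballMeas n) +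
      ∑ a, ∫ y, V a y * pd a u y ∂(ballMeas n) := by
    rw [← Finset.sum_add_distrib]
    have e1 : ∀ a, ∫ y, Φ a y * pd a u y ∂(ballMeas n) + ∫ y, V a y * pd a u y ∂(ballMeas n) =
        ∫ y, (∑ b, A a b y * pd b u y) * pd a u y ∂(ballMeas n) := by
      intro a
      rw [← integral_add ((hΦs a).mul (hu.pd a)).integrable ((hV a).mul (hu.pd a)).integrable]
      congr 1; ext y; simp only [hΦ]; ring
    simp only [e1]
    rw [hG, normGrad_sq, ← integral_finsetSum _ fun a _ => ((hAu a).mul (hu.pd a)).integrable]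
    simp only [normL2_sq]
    rw [← integral_finsetSum _ fun a _ => ((hu.pd a).pow 2).integrable, ← integral_const_mul]
    refine integral_mono_ae
      ((Sm.const lam).mul (Sm.sum fun a _ => (hu.pd a).pow 2)).integrable
      (Sm.sum fun a _ => (hAu a).mul (hu.pd a)).integrable (ae_ballMeas fun y hy => ?_)
    refine (hell y hy fun a => pd a u y).trans (le_of_eq ?_)
    refine Finset.sum_congr rfl fun a _ => ?_
    rw [Finset.sum_mul]
    exact Finset.sum_congr rfl fun b _ => by ring
  have h2 : ∑ a, ∫ y, Φ a y * pd a u y ∂(ballMeas n) ≤ (∑ a, normL2 (Φ a)) * G := by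
    rw [Finset.sum_mul]
    refine Finset.sum_le_sum fun a _ => (le_abs_self _).trans
      ((abs_integral_mul_le (hΦs a) (hu.pd a)).trans ?_)
    gcongr
    exacts [normL2_nonneg _, normL2_pd_le u a]
  have h3 : ∑ a, ∫ y, V a y * pd a u y ∂(ballMeas n) =
      (∫ y, (fieldDiv s y * f₀ y) * u y ∂(ballMeas n)) +
      (∑ a, ∫ y, (s a y * f₀ y) * pd a u y ∂(ballMeas n)) -
      ∫ y, f₁ y * u y ∂(ballMeas n) := by
    have i1 : ∑ a, ∫ y, V a y * pd a u y ∂(ballMeas n) =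
        -∫ y, fieldDiv V y * u y ∂(ballMeas n) := by
      simp only [fun a => integral_mul_pd (hV a) hu h0 a, fieldDiv, Finset.sum_mul]
      rw [integral_finsetSum _ fun a _ => (((hV a).pd a).mul hu).integrable,
        Finset.sum_neg_distrib]
    have i2 : ∫ y, fieldDiv V y * u y ∂(ballMeas n) =
        ∫ y, fieldDeriv s f₀ y * u y + f₁ y * u y ∂(ballMeas n) := by
      refine integral_congr_ae (ae_ballMeas fun y hy => ?_)
      simp only [hdiv y hy, add_mul]
    have i3 := hs.integral _ (hf₀.mul hu)
    have e3 : ∀ y, fieldDeriv s (fun z => f₀ z * u z) y =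
        fieldDeriv s f₀ y * u y + ∑ a, (s a y * f₀ y) * pd a u y := by
      intro y
      simp only [fieldDeriv, pd_mul hf₀ hu, Finset.sum_mul, ← Finset.sum_add_distrib]
      exact Finset.sum_congr rfl fun a _ => by ring
    simp only [e3] at i3
    rw [integral_add ((Sm.fieldDeriv hs.smooth hf₀).mul hu).integrable
      (Sm.sum fun a _ => ((hs.smooth a).mul hf₀).mul (hu.pd a)).integrable,
      integral_finsetSum _ fun a _ => (((hs.smooth a).mul hf₀).mul (hu.pd a)).integrable] at i3
    rw [i1, i2, integral_add ((Sm.fieldDeriv hs.smooth hf₀).mul hu).integrable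
      (hf₁.mul hu).integrable]
    have i4 : ∫ y, (fieldDiv s y * f₀ y) * u y ∂(ballMeas n) =
      ∫ y, fieldDiv s y * (f₀ y * u y) ∂(ballMeas n) := by congr 1; ext y; ring
    rw [i4]
    linarith
  have h4 : |∫ y, (fieldDiv s y * f₀ y) * u y ∂(ballMeas n)| ≤ M * normL2 f₀ * (2 * G) := by
    refine (abs_integral_mul_le ((Sm.fieldDiv hs.smooth).mul hf₀) hu).trans ?_
    exact mul_le_mul (normL2_mul_le (Sm.fieldDiv hs.smooth) hf₀ hM0 hM) hPoin (normL2_nonneg u)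
      (mul_nonneg hM0 (normL2_nonneg f₀))
  have h5 : ∑ a, ∫ y, (s a y * f₀ y) * pd a u y ∂(ballMeas n) ≤
      (∑ a, m a) * normL2 f₀ * G := by
    rw [Finset.sum_mul, Finset.sum_mul]
    refine Finset.sum_le_sum fun a _ => (le_abs_self _).trans
      ((abs_integral_mul_le ((hs.smooth a).mul hf₀) (hu.pd a)).trans ?_)
    exact mul_le_mul (normL2_mul_le (hs.smooth a) hf₀ (hm0 a) (hm a)) (normL2_pd_le u a)
      (normL2_nonneg _) (mul_nonneg (hm0 a) (normL2_nonneg f₀))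
  have h6 : |∫ y, f₁ y * u y ∂(ballMeas n)| ≤ normL2 f₁ * (2 * G) := by
    refine (abs_integral_mul_le hf₁ hu).trans ?_
    gcongr
    exact normL2_nonneg _
  have hP : 0 ≤ ∑ a, normL2 (Φ a) := Finset.sum_nonneg fun a _ => normL2_nonneg _
  have hf₀n := normL2_nonneg f₀
  have hf₁n := normL2_nonneg f₁
  have h7 : lam * G ^ 2 ≤ ((∑ a, normL2 (Φ a)) + (2 * M + ∑ a, m a) * normL2 f₀
      + 2 * normL2 f₁) * G := by
    rw [h3] at h1
    have := (abs_le.1 h4).2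
    have := (abs_le.1 h6).1
    linarith
  have h8 : lam * G ≤ (∑ a, normL2 (Φ a)) + (2 * M + ∑ a, m a) * normL2 f₀ + 2 * normL2 f₁ := by
    rcases hG0.eq_or_lt with h | h
    · rw [← h, mul_zero]; positivity
    · refine le_of_mul_le_mul_right ?_ h
      linarith
  rw [mul_assoc, ← div_eq_inv_mul, le_div_iff₀ hl, mul_comm G]
  refine h8.trans ?_
  have hM2 : 0 ≤ 2 * M + ∑ a, m a := by positivity
  nlinarith [mul_nonneg hM2 hP, mul_nonneg hM2 hf₁n]

lemma eLpNorm_eq_normL2 {u : E' n → ℝ} (hu : Sm u) :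
    eLpNorm u 2 (ballMeas n) = ENNReal.ofReal (normL2 u) := by
  have hm : MemLp u 2 (ballMeas n) :=
    (memLp_two_iff_integrable_sq hu.aesm).2 (hu.pow 2).integrable
  rw [hm.eLpNorm_eq_integral_rpow_norm (by simp) (by simp), normL2, Real.sqrt_eq_rpow]
  simp

end Energy

section Families

variable {ι : Type*} {p : ℝ≥0∞} {N R : ι → ℕ → ℝ≥0∞}

lemma Graded.succ_intro {d k : ℕ} {u : ι → E' n → ℝ} (h : Graded p R 1 k u)
    (h' : ∀ a, Graded p R d (k + 1) (fun i => pd a (u i))) : Graded p R (d + 1) k u :=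
  ⟨h.1, h'⟩

lemma Graded.one_of_succ {d k : ℕ} {u : ι → E' n → ℝ} (h : Graded p R (d + 1) k u) :
    Graded p R 1 k u :=
  ⟨h.1, fun _ => trivial⟩

lemma Graded.one_of_bound (hN : Weights N R) {u : ι → E' n → ℝ} {M : ℝ}
    (h : ∀ i, ∀ y ∈ Metric.ball (0 : E' n) 1, |u i y| ≤ M) : Graded ∞ N 1 0 u := by
  refine ⟨?_, fun _ => trivial⟩
  obtain ⟨C, hC⟩ := hN.one
  refine ⟨M.toNNReal * C, fun i => ?_⟩
  have hle : eLpNorm (u i) ∞ (ballMeas n) ≤ ENNReal.ofReal M := by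
    rw [eLpNorm_exponent_top]
    exact eLpNormEssSup_le_of_ae_bound (ae_ballMeas fun y hy => h i y hy)
  calc _ ≤ ENNReal.ofReal M * 1 := by simpa using hle
    _ ≤ ENNReal.ofReal M * (C * N i 0) := by gcongr; exact hC i
    _ = _ := by rw [ENNReal.coe_mul, mul_assoc]; rfl

/-- A bounded family whose derivatives inherit every bound of the family itself satisfies bounds
of all orders. -/
lemma Graded.of_bootstrap (hN : Weights N R) {u : ι → E' n → ℝ} {M : ℝ}
    (h : ∀ i, ∀ y ∈ Metric.ball (0 : E' n) 1, |u i y| ≤ M)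
    (hd : ∀ d, Graded ∞ N d 0 u → ∀ a, Graded ∞ N d 1 (fun i => pd a (u i))) (d : ℕ) :
    Graded ∞ N d 0 u := by
  induction d with
  | zero => trivial
  | succ d ih => exact Graded.succ_intro (Graded.one_of_bound hN h) (hd d ih)

lemma exists_positive_extension {D : E' n → ℝ} (hD : Sm D) {δ : ℝ} (hδ : 0 < δ) :
    ∃ m : E' n → ℝ, Sm m ∧ (∀ y, 0 < m y) ∧ ∀ y, δ ≤ D y → m y = D y := by
  let χ : E' n → ℝ := fun y => Real.smoothTransition (2 / δ * D y - 1)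
  have hχ : Sm χ := Real.smoothTransition.contDiff.comp
    ((contDiff_const.mul hD).sub contDiff_const)
  refine ⟨fun y => χ y * D y + (1 - χ y), (hχ.mul hD).add (contDiff_const.sub hχ), ?_, ?_⟩
  · intro y
    have h1 := Real.smoothTransition.le_one (2 / δ * D y - 1)
    rcases (Real.smoothTransition.nonneg (2 / δ * D y - 1)).eq_or_lt with h | h
    · simp [χ, ← h]
    · have h2 : 0 < D y := by
        by_contra! hc
        have h3 : 2 / δ * D y - 1 ≤ 0 := by
          have : 2 / δ * D y ≤ 0 := mul_nonpos_of_nonneg_of_nonpos (by positivity) hc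
          linarith
        rw [Real.smoothTransition.zero_of_nonpos h3] at h
        exact lt_irrefl _ h
      have h3 : 0 < χ y * D y := mul_pos h h2
      have h4 : 0 ≤ 1 - χ y := sub_nonneg.2 h1
      linarith
  · intro y hy
    have : χ y = 1 := Real.smoothTransition.one_of_one_le (by
      have : 2 / δ * δ ≤ 2 / δ * D y := by gcongr
      rw [div_mul_cancel₀ _ hδ.ne'] at this
      linarith)
    simp [this]

lemma exists_smooth_recip {D : E' n → ℝ} (hD : Sm D) {δ : ℝ} (hδ : 0 < δ) :
    ∃ e : E' n → ℝ, Sm e ∧ (∀ y, 0 < e y) ∧ ∀ y, δ ≤ D y → e y * D y = 1 := by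
  obtain ⟨m, hm, hp, he⟩ := exists_positive_extension hD hδ
  refine ⟨fun y => (m y)⁻¹, ContDiff.inv hm fun y => (hp y).ne', fun y => inv_pos.2 (hp y), ?_⟩
  intro y hy
  rw [← he y hy, inv_mul_cancel₀ (hp y).ne']

lemma Graded.recip (hN : Weights N N) {D e : ι → E' n → ℝ} (sD : ∀ i, Sm (D i))
    (se : ∀ i, Sm (e i)) (hD : ∀ d, Graded ∞ N d 0 (D)) {M : ℝ}
    (hM : ∀ i, ∀ y ∈ Metric.ball (0 : E' n) 1, |e i y| ≤ M)
    (he : ∀ i, ∀ y ∈ Metric.ball (0 : E' n) 1, e i y * D i y = 1) (d : ℕ) :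
    Graded ∞ N d 0 e := by
  refine Graded.of_bootstrap hN hM (fun d h a => ?_) d
  have h1 := Graded.mul hN.mul se (fun i => (sD i).pd a) h ((hD (d + 1)).2 a)
  have h2 := Graded.mul hN.mul se (fun i => (se i).mul ((sD i).pd a)) h h1
  have h3 := Graded.smul_fixed hN hN (s := fun _ => -1) contDiff_const
    (fun i => (se i).mul ((se i).mul ((sD i).pd a))) h2
  refine Graded.congr (by simpa using h3) fun i y hy => ?_
  have h4 : pd a (fun z => e i z * D i z) y = 0 := by
    have : EqOn (fun z => e i z * D i z) (fun _ => 1) (Metric.ball 0 1) := fun z hz => he i z hz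
    rw [pd_eqOn_ball this a hy, pd_const]
  rw [pd_mul (se i) (sD i)] at h4
  have h5 := he i y hy
  change -(e i y * (e i y * pd a (D i) y)) = pd a (e i) y
  have : pd a (e i) y = pd a (e i) y * (e i y * D i y) := by rw [h5, mul_one]
  rw [this]
  linear_combination (-e i y) * h4

/-- Uniformly elliptic families of coefficients with controlled derivatives. -/
structure EllipticFamily (N : ι → ℕ → ℝ≥0∞) (A : Fin n → Fin n → ι → E' n → ℝ) (lam : ℝ) :
    Prop where
  smooth : ∀ a b i, Sm (A a b i)
  graded : ∀ a b d, Graded ∞ N d 0 (A a b)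
  pos : 0 < lam
  elliptic : ∀ i, ∀ y ∈ Ball n, ∀ ξ : Fin n → ℝ,
    lam * ∑ a, ξ a ^ 2 ≤ ∑ a, ∑ b, A a b i y * ξ a * ξ b

/-- The defect `A ∇u - V`. -/
def fluxDefect (A : Fin n → Fin n → ι → E' n → ℝ) (u : ι → E' n → ℝ)
    (V : Fin n → ι → E' n → ℝ) (a : Fin n) (i : ι) (y : E' n) : ℝ :=
  (∑ b, A a b i y * pd b (u i) y) - V a i y

/-- A family of Dirichlet problems whose data are controlled to order `e + 1` at level `k`, and
whose solutions are controlled to order `e`. -/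
structure DirichletData (A : Fin n → Fin n → ι → E' n → ℝ) (R : ι → ℕ → ℝ≥0∞) (e k : ℕ)
    (u : ι → E' n → ℝ) (V : Fin n → ι → E' n → ℝ) : Prop where
  su : ∀ i, Sm (u i)
  sV : ∀ a i, Sm (V a i)
  bdry : ∀ i, ∀ y ∈ Sphere' n, u i y = 0
  grad : ∀ b, Graded 2 R e k (fun i => pd b (u i))
  flux : ∀ a, Graded 2 R (e + 1) k (fluxDefect A u V a)
  div : Graded 2 R e (k + 1) (fun i => fieldDiv (fun a => V a i))

lemma Sm.fluxDefect {A : Fin n → Fin n → ι → E' n → ℝ} {u : ι → E' n → ℝ}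
    {V : Fin n → ι → E' n → ℝ} (sA : ∀ a b i, Sm (A a b i)) (su : ∀ i, Sm (u i))
    (sV : ∀ a i, Sm (V a i)) (a : Fin n) (i : ι) : Sm (fluxDefect A u V a i) :=
  (Sm.sum fun b _ => (sA a b i).mul ((su i).pd b)).sub (sV a i)

lemma energy_family {A : Fin n → Fin n → ι → E' n → ℝ} {lam : ℝ} (hA : EllipticFamily N A lam)
    (hn : 0 < n) {s : Fin n → E' n → ℝ} (hs : TangentField s) {u f₀ f₁ : ι → E' n → ℝ}
    {V : Fin n → ι → E' n → ℝ} {k : ℕ} (su : ∀ i, Sm (u i)) (sf₀ : ∀ i, Sm (f₀ i))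
    (sf₁ : ∀ i, Sm (f₁ i)) (sV : ∀ a i, Sm (V a i)) (h0 : ∀ i, ∀ y ∈ Sphere' n, u i y = 0)
    (hdiv : ∀ i, ∀ y ∈ Metric.ball (0 : E' n) 1,
      fieldDiv (fun a => V a i) y = fieldDeriv s (f₀ i) y + f₁ i y)
    (hF : ∀ a, Graded 2 R 1 k (fluxDefect A u V a)) (hf₀ : Graded 2 R 1 k f₀)
    (hf₁ : Graded 2 R 1 k f₁) (b : Fin n) : Graded 2 R 1 k (fun i => pd b (u i)) := by
  obtain ⟨C, hC0, hC⟩ := energy_estimate hs hA.pos hn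
  choose c hc using fun a => (hF a).1
  obtain ⟨c₀, hc₀⟩ := hf₀.1
  obtain ⟨c₁, hc₁⟩ := hf₁.1
  refine ⟨⟨C.toNNReal * (∑ a, c a + c₀ + c₁), fun i => ?_⟩, fun _ => trivial⟩
  have h := hC (fun a b => A a b i) (u i) (f₀ i) (f₁ i) (fun a => V a i)
    (fun a b => hA.smooth a b i) (su i) (sf₀ i) (sf₁ i) (fun a => sV a i) (h0 i)
    (fun y hy => hA.elliptic i y (Metric.ball_subset_closedBall hy)) (hdiv i)
  have hFs : ∀ a, 0 ≤ normL2 (fluxDefect A u V a i) := fun a => normL2_nonneg _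
  calc eLpNorm (pd b (u i)) 2 (ballMeas n) = ENNReal.ofReal (normL2 (pd b (u i))) :=
        eLpNorm_eq_normL2 ((su i).pd b)
    _ ≤ ENNReal.ofReal (C * (∑ a, normL2 (fluxDefect A u V a i) + normL2 (f₀ i)
          + normL2 (f₁ i))) := ENNReal.ofReal_le_ofReal ((normL2_pd_le _ b).trans h)
    _ = ENNReal.ofReal C * (∑ a, eLpNorm (fluxDefect A u V a i) 2 (ballMeas n)
          + eLpNorm (f₀ i) 2 (ballMeas n) + eLpNorm (f₁ i) 2 (ballMeas n)) := by
        rw [ENNReal.ofReal_mul hC0, ENNReal.ofReal_add (add_nonneg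
          (Finset.sum_nonneg fun a _ => hFs a) (normL2_nonneg _)) (normL2_nonneg _),
          ENNReal.ofReal_add (Finset.sum_nonneg fun a _ => hFs a) (normL2_nonneg _),
          ENNReal.ofReal_sum_of_nonneg fun a _ => hFs a, eLpNorm_eq_normL2 (sf₀ i),
          eLpNorm_eq_normL2 (sf₁ i)]
        simp only [fun a => eLpNorm_eq_normL2 (Sm.fluxDefect hA.smooth su sV a i)]
    _ ≤ ENNReal.ofReal C * (∑ a, c a * R i k + c₀ * R i k + c₁ * R i k) := by
        gcongr with a _
        exacts [hc a i, hc₀ i, hc₁ i]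
    _ = _ := by
        push_cast
        rw [← Finset.sum_mul, ← add_mul, ← add_mul, ← mul_assoc]
        rfl

/-- The Lie derivative of a vector field. -/
def lieField (s V : Fin n → E' n → ℝ) (a : Fin n) (y : E' n) : ℝ :=
  fieldDeriv s (V a) y - ∑ c, V c y * pd c (s a) y

lemma Sm.lieField {s V : Fin n → E' n → ℝ} (hs : ∀ a, Sm (s a)) (hV : ∀ a, Sm (V a))
    (a : Fin n) : Sm (lieField s V a) :=
  (Sm.fieldDeriv hs (hV a)).sub (Sm.sum fun c _ => (hV c).mul ((hs a).pd c))

lemma pd_fieldDeriv {s : Fin n → E' n → ℝ} {u : E' n → ℝ} (hs : ∀ a, Sm (s a)) (hu : Sm u)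
    (b : Fin n) (y : E' n) :
    pd b (fieldDeriv s u) y = ∑ c, pd b (s c) y * pd c u y + fieldDeriv s (pd b u) y := by
  have : pd b (fieldDeriv s u) y = pd b (fun z => ∑ c, s c z * pd c u z) y := rfl
  rw [this, pd_sum fun c _ => (hs c).mul (hu.pd c), fieldDeriv, ← Finset.sum_add_distrib]
  refine Finset.sum_congr rfl fun c _ => ?_
  rw [pd_mul (hs c) (hu.pd c), pd_comm hu]

lemma fieldDiv_lieField {s V : Fin n → E' n → ℝ} (hs : ∀ a, Sm (s a)) (hV : ∀ a, Sm (V a))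
    (y : E' n) :
    fieldDiv (lieField s V) y =
      fieldDeriv s (fieldDiv V) y + -∑ c, V c y * pd c (fieldDiv s) y := by
  have h1 : ∀ a, pd a (lieField s V a) y = ∑ c, pd a (s c) y * pd c (V a) y
      + fieldDeriv s (pd a (V a)) y
      - ∑ c, (pd a (V c) y * pd c (s a) y + V c y * pd c (pd a (s a)) y) := by
    intro a
    have : pd a (lieField s V a) y =
      pd a (fun z => fieldDeriv s (V a) z - ∑ c, V c z * pd c (s a) z) y := rfl
    rw [this, pd_sub (Sm.fieldDeriv hs (hV a)) (Sm.sum fun c _ => (hV c).mul ((hs a).pd c)),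
      pd_fieldDeriv hs (hV a), pd_sum fun c _ => (hV c).mul ((hs a).pd c)]
    congr 1
    refine Finset.sum_congr rfl fun c _ => ?_
    rw [pd_mul (hV c) ((hs a).pd c), pd_comm (hs a)]
  have h2 : fieldDeriv s (fieldDiv V) y = ∑ a, fieldDeriv s (pd a (V a)) y := by
    have : ∀ c, pd c (fieldDiv V) y = ∑ a, pd c (pd a (V a)) y :=
      fun c => pd_sum (fun a _ => (hV a).pd a) c y
    simp only [fieldDeriv, this, Finset.mul_sum]
    exact Finset.sum_comm
  have h3 : ∀ c, pd c (fieldDiv s) y = ∑ a, pd c (pd a (s a)) y :=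
    fun c => pd_sum (fun a _ => (hs a).pd a) c y
  rw [fieldDiv]
  simp only [h1, h2, h3, Finset.sum_sub_distrib, Finset.sum_add_distrib, Finset.mul_sum]
  rw [Finset.sum_comm (f := fun a c => pd a (V c) y * pd c (s a) y),
    Finset.sum_comm (f := fun a c => V c y * pd c (pd a (s a)) y)]
  simp only [mul_comm (pd _ (s _) y) (pd _ (V _) y)]
  ring

lemma fluxDefect_lie {A : Fin n → Fin n → ι → E' n → ℝ} {u : ι → E' n → ℝ}
    {V : Fin n → ι → E' n → ℝ} (sA : ∀ a b i, Sm (A a b i)) (su : ∀ i, Sm (u i))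
    (sV : ∀ a i, Sm (V a i)) {s : Fin n → E' n → ℝ} (hs : ∀ a, Sm (s a)) (a : Fin n) (i : ι)
    (y : E' n) :
    fluxDefect A (fun i => fieldDeriv s (u i)) (fun a i => lieField s (fun a => V a i) a) a i y =
      ((fieldDeriv s (fluxDefect A u V a i) y
        - ∑ c, pd c (s a) y * fluxDefect A u V c i y)
      + ∑ b, ∑ c, A a b i y * (pd b (s c) y * pd c (u i) y))
      + (∑ c, ∑ b, pd c (s a) y * (A c b i y * pd b (u i) y)
      - ∑ c, ∑ b, s c y * (pd c (A a b i) y * pd b (u i) y)) := by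
  have h1 : ∀ c, pd c (fluxDefect A u V a i) y =
      ∑ b, (pd c (A a b i) y * pd b (u i) y + A a b i y * pd c (pd b (u i)) y)
        - pd c (V a i) y := by
    intro c
    have : pd c (fluxDefect A u V a i) y =
      pd c (fun z => (∑ b, A a b i z * pd b (u i) z) - V a i z) y := rfl
    rw [this, pd_sub (Sm.sum fun b _ => (sA a b i).mul ((su i).pd b)) (sV a i),
      pd_sum fun b _ => (sA a b i).mul ((su i).pd b)]
    simp only [fun b => pd_mul (sA a b i) ((su i).pd b)]
  have h2 : fieldDeriv s (fluxDefect A u V a i) y =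
      ∑ c, ∑ b, s c y * (pd c (A a b i) y * pd b (u i) y)
      + ∑ c, ∑ b, s c y * (A a b i y * pd c (pd b (u i)) y)
      - fieldDeriv s (V a i) y := by
    simp only [fieldDeriv, h1, mul_sub, Finset.sum_sub_distrib, Finset.sum_add_distrib, mul_add,
      Finset.mul_sum]
  have h3 : ∑ c, pd c (s a) y * fluxDefect A u V c i y =
      ∑ c, ∑ b, pd c (s a) y * (A c b i y * pd b (u i) y) - ∑ c, V c i y * pd c (s a) y := by
    simp only [fluxDefect, mul_sub, Finset.sum_sub_distrib, Finset.mul_sum]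
    congr 1
    exact Finset.sum_congr rfl fun c _ => mul_comm _ _
  have h4 : ∑ b, A a b i y * pd b (fieldDeriv s (u i)) y =
      ∑ b, ∑ c, A a b i y * (pd b (s c) y * pd c (u i) y)
      + ∑ c, ∑ b, s c y * (A a b i y * pd c (pd b (u i)) y) := by
    rw [Finset.sum_comm (f := fun c b => s c y * (A a b i y * pd c (pd b (u i)) y)),
      ← Finset.sum_add_distrib]
    refine Finset.sum_congr rfl fun b _ => ?_
    rw [pd_fieldDeriv hs (su i), mul_add, Finset.mul_sum, fieldDeriv, Finset.mul_sum]
    congr 1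
    exact Finset.sum_congr rfl fun c _ => by ring
  rw [h2, h3, fluxDefect, h4, lieField]
  ring

end Families

section Tangential

variable {ι : Type*} {N R : ι → ℕ → ℝ≥0∞} {A : Fin n → Fin n → ι → E' n → ℝ} {lam : ℝ}
  {u : ι → E' n → ℝ} {V : Fin n → ι → E' n → ℝ} {s : Fin n → E' n → ℝ} {e k : ℕ}

lemma Graded.fieldDeriv (hN : Weights N N) (hR : Weights N R) {w : ι → E' n → ℝ}
    (hs : ∀ a, Sm (s a)) (sw : ∀ i, Sm (w i)) {d : ℕ}
    (hw : ∀ c, Graded 2 R d k (fun i => pd c (w i))) :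
    Graded 2 R d k (fun i => fieldDeriv s (w i)) :=
  Graded.sum (fun c i => (hs c).mul ((sw i).pd c)) fun c _ =>
    Graded.smul_fixed hN hR (hs c) (fun i => (sw i).pd c) (hw c)

lemma DirichletData.graded_V (hN : Weights N N) (hR : Weights N R) (hA : EllipticFamily N A lam)
    (h : DirichletData A R e k u V) (a : Fin n) : Graded 2 R e k (V a) := by
  have h1 : Graded 2 R e k (fun i y => ∑ b, A a b i y * pd b (u i) y) := by
    refine Graded.sum (fun b i => (hA.smooth a b i).mul ((h.su i).pd b)) fun b _ => ?_
    have := Graded.mul hR.mul (hA.smooth a b) (fun i => (h.su i).pd b) (hA.graded a b e) (h.grad b)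
    rwa [zero_add] at this
  refine (Graded.sub hN hR (fun i => Sm.sum fun b _ => (hA.smooth a b i).mul ((h.su i).pd b))
    (fun i => Sm.fluxDefect hA.smooth h.su h.sV a i) h1 (h.flux a).pred).congr fun i y _ => ?_
  simp [fluxDefect]

lemma DirichletData.graded_flux_lie (hN : Weights N N) (hR : Weights N R)
    (hA : EllipticFamily N A lam) (h : DirichletData A R (e + 1) k u V) (hs : ∀ a, Sm (s a))
    (a : Fin n) :
    Graded 2 R (e + 1) (k + 1) (fluxDefect A (fun i => fieldDeriv s (u i))
      (fun a i => lieField s (fun a => V a i) a) a) := by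
  have sF := Sm.fluxDefect hA.smooth h.su h.sV
  have sg : ∀ (b : Fin n) (i : ι), Sm (pd b (u i)) := fun b i => (h.su i).pd b
  have t1 : Graded 2 R (e + 1) (k + 1) (fun i => fieldDeriv s (fluxDefect A u V a i)) :=
    Graded.fieldDeriv hN hR hs (sF a) fun c => (h.flux a).2 c
  have t2 : Graded 2 R (e + 1) (k + 1)
      (fun i y => ∑ c, pd c (s a) y * fluxDefect A u V c i y) :=
    Graded.sum (fun c i => ((hs a).pd c).mul (sF c i)) fun c _ =>
      Graded.smul_fixed hN hR ((hs a).pd c) (sF c) ((h.flux c).pred.shift hR.mono)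
  have t3 : Graded 2 R (e + 1) (k + 1)
      (fun i y => ∑ b, ∑ c, A a b i y * (pd b (s c) y * pd c (u i) y)) := by
    refine Graded.sum (fun b i => Sm.sum fun c _ => (hA.smooth a b i).mul
      (((hs c).pd b).mul (sg c i))) fun b _ => Graded.sum (fun c i => (hA.smooth a b i).mul
      (((hs c).pd b).mul (sg c i))) fun c _ => ?_
    have := Graded.mul hR.mul (hA.smooth a b) (fun i => ((hs c).pd b).mul (sg c i))
      (hA.graded a b (e + 1)) (Graded.smul_fixed hN hR ((hs c).pd b) (sg c)
        ((h.grad c).shift hR.mono))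
    rwa [zero_add] at this
  have t4 : Graded 2 R (e + 1) (k + 1)
      (fun i y => ∑ c, ∑ b, pd c (s a) y * (A c b i y * pd b (u i) y)) := by
    refine Graded.sum (fun c i => Sm.sum fun b _ => ((hs a).pd c).mul
      ((hA.smooth c b i).mul (sg b i))) fun c _ => Graded.sum (fun b i => ((hs a).pd c).mul
      ((hA.smooth c b i).mul (sg b i))) fun b _ => ?_
    have := Graded.mul hR.mul (hA.smooth c b) (sg b) (hA.graded c b (e + 1))
      ((h.grad b).shift hR.mono)
    rw [zero_add] at this
    exact Graded.smul_fixed hN hR ((hs a).pd c) (fun i => (hA.smooth c b i).mul (sg b i)) this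
  have t5 : Graded 2 R (e + 1) (k + 1)
      (fun i y => ∑ c, ∑ b, s c y * (pd c (A a b i) y * pd b (u i) y)) := by
    refine Graded.sum (fun c i => Sm.sum fun b _ => (hs c).mul
      (((hA.smooth a b i).pd c).mul (sg b i))) fun c _ => Graded.sum (fun b i => (hs c).mul
      (((hA.smooth a b i).pd c).mul (sg b i))) fun b _ => ?_
    have := Graded.mul hR.mul (fun i => (hA.smooth a b i).pd c) (sg b)
      ((hA.graded a b (e + 2)).2 c) (h.grad b)
    rw [zero_add, add_comm 1 k] at this
    exact Graded.smul_fixed hN hR (hs c) (fun i => ((hA.smooth a b i).pd c).mul (sg b i)) this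
  have s1 : ∀ i, Sm (fieldDeriv s (fluxDefect A u V a i)) := fun i => Sm.fieldDeriv hs (sF a i)
  have s2 : ∀ i, Sm (fun y => ∑ c, pd c (s a) y * fluxDefect A u V c i y) :=
    fun i => Sm.sum fun c _ => ((hs a).pd c).mul (sF c i)
  have s3 : ∀ i, Sm (fun y => ∑ b, ∑ c, A a b i y * (pd b (s c) y * pd c (u i) y)) :=
    fun i => Sm.sum fun b _ => Sm.sum fun c _ => (hA.smooth a b i).mul
      (((hs c).pd b).mul (sg c i))
  have s4 : ∀ i, Sm (fun y => ∑ c, ∑ b, pd c (s a) y * (A c b i y * pd b (u i) y)) :=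
    fun i => Sm.sum fun c _ => Sm.sum fun b _ => ((hs a).pd c).mul
      ((hA.smooth c b i).mul (sg b i))
  have s5 : ∀ i, Sm (fun y => ∑ c, ∑ b, s c y * (pd c (A a b i) y * pd b (u i) y)) :=
    fun i => Sm.sum fun c _ => Sm.sum fun b _ => (hs c).mul
      (((hA.smooth a b i).pd c).mul (sg b i))
  refine (Graded.add (fun i => ((s1 i).sub (s2 i)).add (s3 i)) (fun i => (s4 i).sub (s5 i))
    (Graded.add (fun i => (s1 i).sub (s2 i)) s3 (Graded.sub hN hR s1 s2 t1 t2) t3)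
    (Graded.sub hN hR s4 s5 t4 t5)).congr fun i y _ => ?_
  exact (fluxDefect_lie hA.smooth h.su h.sV hs a i y).symm

lemma DirichletData.graded_div_remainder (hN : Weights N N) (hR : Weights N R)
    (hA : EllipticFamily N A lam) (h : DirichletData A R e k u V) (hs : ∀ a, Sm (s a)) :
    Graded 2 R e k (fun i y => -∑ c, V c i y * pd c (fieldDiv s) y) := by
  have sd := Sm.fieldDiv hs
  have h1 : Graded 2 R e k (fun i y => ∑ c, pd c (fieldDiv s) y * V c i y) :=
    Graded.sum (fun c i => (sd.pd c).mul (h.sV c i)) fun c _ =>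
      Graded.smul_fixed hN hR (sd.pd c) (h.sV c) (h.graded_V hN hR hA c)
  have h2 := Graded.smul_fixed hN hR (s := fun _ => -1) contDiff_const
    (fun i => Sm.sum fun c _ => (sd.pd c).mul (h.sV c i)) h1
  refine h2.congr fun i y _ => ?_
  simp [mul_comm]

/-- Differentiating a Dirichlet problem along a tangential field. -/
lemma DirichletData.lie (hN : Weights N N) (hR : Weights N R) (hA : EllipticFamily N A lam)
    (h : DirichletData A R (e + 1) k u V) (hs : TangentField s) :
    DirichletData A R e (k + 1) (fun i => fieldDeriv s (u i))
      (fun a i => lieField s (fun a => V a i) a) where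
  su i := Sm.fieldDeriv hs.smooth (h.su i)
  sV a i := Sm.lieField hs.smooth (fun a => h.sV a i) a
  bdry i := hs.bdry _ (h.su i) (h.bdry i)
  grad b := by
    have t1 : Graded 2 R e (k + 1) (fun i y => ∑ c, pd b (s c) y * pd c (u i) y) :=
      Graded.sum (fun c i => ((hs.smooth c).pd b).mul ((h.su i).pd c)) fun c _ =>
        Graded.smul_fixed hN hR ((hs.smooth c).pd b) (fun i => (h.su i).pd c)
          ((h.grad c).pred.shift hR.mono)
    have t2 : Graded 2 R e (k + 1) (fun i => fieldDeriv s (pd b (u i))) :=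
      Graded.fieldDeriv hN hR hs.smooth (fun i => (h.su i).pd b) fun c => (h.grad b).2 c
    exact (Graded.add (fun i => Sm.sum fun c _ => ((hs.smooth c).pd b).mul ((h.su i).pd c))
      (fun i => Sm.fieldDeriv hs.smooth ((h.su i).pd b)) t1 t2).congr
      fun i y _ => (pd_fieldDeriv hs.smooth (h.su i) b y).symm
  flux a := h.graded_flux_lie hN hR hA hs.smooth a
  div := by
    have sd : ∀ i, Sm (fieldDiv fun a => V a i) := fun i => Sm.fieldDiv fun a => h.sV a i
    have t1 : Graded 2 R e (k + 2) (fun i => fieldDeriv s (fieldDiv fun a => V a i)) :=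
      Graded.fieldDeriv hN hR hs.smooth sd fun c => h.div.2 c
    have t2 := ((h.graded_div_remainder hN hR hA hs.smooth).pred.shift hR.mono).shift hR.mono
    refine (Graded.add (fun i => Sm.fieldDeriv hs.smooth (sd i)) (fun i => ?_) t1 t2).congr
      fun i y _ => (fieldDiv_lieField hs.smooth (fun a => h.sV a i) y).symm
    exact ContDiff.neg (Sm.sum fun c _ => (h.sV c i).mul ((Sm.fieldDiv hs.smooth).pd c))

/-- The energy estimate for a tangential derivative of the solution. -/
lemma DirichletData.tangential_grad (hN : Weights N N) (hR : Weights N R)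
    (hA : EllipticFamily N A lam) (hn : 0 < n) (h : DirichletData A R 1 k u V)
    (hs : TangentField s) (b : Fin n) :
    Graded 2 R 1 (k + 1) (fun i => pd b (fieldDeriv s (u i))) := by
  have sd : ∀ i, Sm (fieldDiv fun a => V a i) := fun i => Sm.fieldDiv fun a => h.sV a i
  exact energy_family hA hn hs (f₀ := fun i => fieldDiv fun a => V a i)
    (f₁ := fun i y => -∑ c, V c i y * pd c (fieldDiv s) y)
    (fun i => Sm.fieldDeriv hs.smooth (h.su i)) sd
    (fun i => ContDiff.neg (Sm.sum fun c _ => (h.sV c i).mul ((Sm.fieldDiv hs.smooth).pd c)))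
    (fun a i => Sm.lieField hs.smooth (fun a => h.sV a i) a)
    (fun i => hs.bdry _ (h.su i) (h.bdry i))
    (fun i y _ => fieldDiv_lieField hs.smooth (fun a => h.sV a i) y)
    (fun a => h.graded_flux_lie hN hR hA hs.smooth a) h.div
    ((h.graded_div_remainder hN hR hA hs.smooth).shift hR.mono) b

end Tangential

section SmoothGraded

variable {ι : Type*} {p : ℝ≥0∞} {N R : ι → ℕ → ℝ≥0∞} {d k : ℕ}

/-- Families of smooth functions with graded bounds. -/
structure SmGraded (p : ℝ≥0∞) (R : ι → ℕ → ℝ≥0∞) (d k : ℕ) (w : ι → E' n → ℝ) : Prop where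
  smooth : ∀ i, Sm (w i)
  graded : Graded p R d k w

lemma SmGraded.congr {v w : ι → E' n → ℝ} (hv : SmGraded p R d k v) (h : ∀ i y, v i y = w i y) :
    SmGraded p R d k w := by
  have : v = w := funext fun i => funext fun y => h i y
  rwa [← this]

variable [Fact (1 ≤ p)]

lemma SmGraded.add {v w : ι → E' n → ℝ} (hv : SmGraded p R d k v) (hw : SmGraded p R d k w) :
    SmGraded p R d k (fun i y => v i y + w i y) :=
  ⟨fun i => (hv.smooth i).add (hw.smooth i), Graded.add hv.smooth hw.smooth hv.graded hw.graded⟩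

lemma SmGraded.sub (hN : Weights N N) (hR : Weights N R) {v w : ι → E' n → ℝ}
    (hv : SmGraded p R d k v) (hw : SmGraded p R d k w) :
    SmGraded p R d k (fun i y => v i y - w i y) :=
  ⟨fun i => (hv.smooth i).sub (hw.smooth i),
    Graded.sub hN hR hv.smooth hw.smooth hv.graded hw.graded⟩

lemma SmGraded.sum {κ : Type*} {t : Finset κ} {w : κ → ι → E' n → ℝ}
    (hw : ∀ c, SmGraded p R d k (w c)) : SmGraded p R d k (fun i y => ∑ c ∈ t, w c i y) :=
  ⟨fun i => Sm.sum fun c _ => (hw c).smooth i,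
    Graded.sum (fun c => (hw c).smooth) fun c _ => (hw c).graded⟩

lemma SmGraded.smul (hN : Weights N N) (hR : Weights N R) {s : E' n → ℝ} (hs : Sm s)
    {w : ι → E' n → ℝ} (hw : SmGraded p R d k w) : SmGraded p R d k (fun i y => s y * w i y) :=
  ⟨fun i => hs.mul (hw.smooth i), Graded.smul_fixed hN hR hs hw.smooth hw.graded⟩

lemma SmGraded.mul (hR : Weights N R) {b w : ι → E' n → ℝ} (hb : SmGraded ∞ N d 0 b)
    (hw : SmGraded p R d k w) : SmGraded p R d k (fun i y => b i y * w i y) :=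
  ⟨fun i => (hb.smooth i).mul (hw.smooth i), by
    have := Graded.mul hR.mul hb.smooth hw.smooth hb.graded hw.graded
    rwa [zero_add] at this⟩

lemma SmGraded.fixed (hN : Weights N N) {s : E' n → ℝ} (hs : Sm s) :
    SmGraded ∞ N d 0 (fun _ => s) :=
  ⟨fun _ => hs, Graded.fixed hN.one hN.mono hs⟩

end SmoothGraded

section NormalDerivatives

/-- A symmetric matrix is recovered from its products with the tangential fields `y_i ∂_j - y_j ∂_i`
and `(1 - |y|²) ∂_i` and from its pairing with a matrix that is nondegenerate in the direction
`y`. -/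
lemma hessian_recovery (y : Fin n → ℝ) (H A S Q : Fin n → Fin n → ℝ) (e E r : ℝ)
    (hr : r = ∑ c, y c ^ 2) (hsymm : ∀ a b, H a b = H b a)
    (hS : ∀ a b, S a b = ∑ i, y i * (y i * H a b - y a * H i b))
    (hQ : ∀ a b, Q a b = r * S a b + y a * ∑ c, y c * S b c)
    (he : e * (∑ a, ∑ b, A a b * y a * y b + (1 - r)) = 1)
    (hE : E = e * ((r * (r * ∑ a, ∑ b, A a b * H a b) - ∑ a, ∑ b, A a b * Q a b) +
      ∑ a, ∑ b, y a * (y b * ((1 - r) * H a b)))) (a b : Fin n) :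
    H a b = (Q a b + y a * (y b * E)) + (r + 1) * ((1 - r) * H a b) := by
  set h : Fin n → ℝ := fun b => ∑ i, y i * H i b with hh
  set G : ℝ := ∑ a, y a * h a with hG
  have h1 : ∀ a b, r * H a b = S a b + y a * h b := by
    intro a b
    rw [hS, hr, hh, Finset.mul_sum, Finset.sum_mul, ← Finset.sum_add_distrib]
    exact Finset.sum_congr rfl fun c _ => by ring
  have h2 : ∀ b, r * h b = (∑ c, y c * S b c) + y b * G := by
    intro b
    rw [hG, hh, Finset.mul_sum, Finset.mul_sum, ← Finset.sum_add_distrib]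
    refine Finset.sum_congr rfl fun c _ => ?_
    have := h1 b c
    rw [hsymm b c] at this
    linear_combination y c * this
  have h3 : ∀ a b, r * (r * H a b) = Q a b + y a * (y b * G) := by
    intro a b
    rw [hQ]
    linear_combination r * h1 a b + y a * h2 b
  have h4 : r * (r * ∑ a, ∑ b, A a b * H a b) =
      ∑ a, ∑ b, A a b * Q a b + (∑ a, ∑ b, A a b * y a * y b) * G := by
    simp only [Finset.mul_sum, Finset.sum_mul, ← Finset.sum_add_distrib]
    exact Finset.sum_congr rfl fun a _ => Finset.sum_congr rfl fun b _ => by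
      linear_combination A a b * h3 a b
  have h5 : ∑ a, ∑ b, y a * (y b * ((1 - r) * H a b)) = (1 - r) * G := by
    rw [hG, hh]
    simp only [Finset.mul_sum]
    exact Finset.sum_congr rfl fun a _ => Finset.sum_congr rfl fun b _ => by
      rw [hsymm a b]; ring
  have h6 : E = G := by
    rw [hE, h4, h5]
    linear_combination G * he
  rw [h6]
  linear_combination h3 a b

variable {ι : Type*} {N R : ι → ℕ → ℝ≥0∞} {A : Fin n → Fin n → ι → E' n → ℝ} {lam : ℝ}
  {u : ι → E' n → ℝ} {V : Fin n → ι → E' n → ℝ} {e k : ℕ}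

lemma EllipticFamily.radial_lower_bound (hA : EllipticFamily N A lam) (i : ι) {y : E' n}
    (hy : y ∈ Ball n) :
    min lam 1 ≤ ∑ a, ∑ b, A a b i y * y a * y b + (1 - ∑ c, y c ^ 2) := by
  have h1 := hA.elliptic i y hy fun a => y a
  have h2 : ∑ c, y c ^ 2 ≤ 1 := by
    rw [← EuclideanSpace.real_norm_sq_eq, sq_le_one_iff₀ (norm_nonneg _)]
    simpa [Ball] using hy
  have h3 : 0 ≤ ∑ c, y c ^ 2 := Finset.sum_nonneg fun c _ => sq_nonneg _
  nlinarith [min_le_left lam 1, min_le_right lam 1]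

lemma EllipticFamily.exists_radial_recip (hN : Weights N N) (hA : EllipticFamily N A lam) :
    ∃ ε : ι → E' n → ℝ, (∀ i, ∀ y ∈ Ball n,
      ε i y * (∑ a, ∑ b, A a b i y * y a * y b + (1 - ∑ c, y c ^ 2)) = 1) ∧
      ∀ d, SmGraded ∞ N d 0 ε := by
  have hm : 0 < min lam 1 := lt_min hA.pos one_pos
  have sD : ∀ d, SmGraded ∞ N d 0 (fun (i : ι) (y : E' n) =>
      (∑ a, ∑ b, A a b i y * (y a * y b)) + rho y) := fun d =>
    SmGraded.add (SmGraded.sum fun a => SmGraded.sum fun b =>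
      SmGraded.mul hN ⟨hA.smooth a b, hA.graded a b d⟩
        (SmGraded.fixed hN ((Sm.coord a).mul (Sm.coord b)))) (SmGraded.fixed hN Sm.rho)
  choose ε hε hpos hmul using fun i => exists_smooth_recip ((sD 0).smooth i) hm
  have hlow : ∀ i, ∀ y ∈ Ball n,
      min lam 1 ≤ (∑ a, ∑ b, A a b i y * (y a * y b)) + rho y := fun i y hy => by
    simpa only [mul_assoc, rho] using hA.radial_lower_bound i hy
  refine ⟨ε, fun i y hy => ?_, fun d => ⟨hε, ?_⟩⟩
  · simpa only [mul_assoc, rho] using hmul i y (hlow i y hy)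
  · refine Graded.recip hN (sD 0).smooth hε (fun d => (sD d).graded) (M := (min lam 1)⁻¹)
      (fun i y hy => ?_) (fun i y hy => hmul i y (hlow i y (Metric.ball_subset_closedBall hy))) d
    have hy' := Metric.ball_subset_closedBall hy
    have h1 := hmul i y (hlow i y hy')
    rw [abs_of_pos (hpos i y), eq_inv_of_mul_eq_one_left h1]
    exact inv_anti₀ hm (hlow i y hy')

/-- Control of all second derivatives from the tangential ones and from the equation. -/
lemma DirichletData.grad_succ (hN : Weights N N) (hR : Weights N R) (hA : EllipticFamily N A lam)
    (h : DirichletData A R (e + 1) k u V)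
    (ht : ∀ s, TangentField s → ∀ b,
      Graded 2 R (e + 1) (k + 1) (fun i => pd b (fieldDeriv s (u i)))) (b : Fin n) :
    Graded 2 R (e + 2) k (fun i => pd b (u i)) := by
  obtain ⟨ε, hε, sε⟩ := hA.exists_radial_recip hN
  have sg : ∀ b, SmGraded 2 R (e + 1) (k + 1) (fun i => pd b (u i)) := fun b =>
    ⟨fun i => (h.su i).pd b, (h.grad b).shift hR.mono⟩
  have st : ∀ s, TangentField s → ∀ b,
      SmGraded 2 R (e + 1) (k + 1) (fun i => fieldDeriv s (pd b (u i))) := by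
    intro s hs b
    refine SmGraded.congr (SmGraded.sub hN hR
      ⟨fun i => (Sm.fieldDeriv hs.smooth (h.su i)).pd b, ht s hs b⟩
      (SmGraded.sum (t := Finset.univ) fun c =>
        SmGraded.smul hN hR ((hs.smooth c).pd b) (sg c))) fun i y => ?_
    rw [pd_fieldDeriv hs.smooth (h.su i)]
    ring
  have sA : ∀ a b, SmGraded ∞ N (e + 1) 0 (A a b) := fun a b =>
    ⟨hA.smooth a b, hA.graded a b _⟩
  have sc : ∀ c : Fin n, Sm (fun y : E' n => y c) := Sm.coord
  have sr : Sm (fun y : E' n => ∑ c, y c ^ 2) := Sm.sum fun c _ => (Sm.coord c).pow 2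
  -- the equation
  have sf : SmGraded 2 R (e + 1) (k + 1)
      (fun i y => ∑ a, ∑ b, A a b i y * pd a (pd b (u i)) y) := by
    have sF := Sm.fluxDefect hA.smooth h.su h.sV
    refine SmGraded.congr (SmGraded.sub hN hR (SmGraded.add
      ⟨fun i => Sm.fieldDiv fun a => h.sV a i, h.div⟩
      (SmGraded.sum (t := Finset.univ) fun a =>
        (⟨fun i => (sF a i).pd a, (h.flux a).2 a⟩ :
          SmGraded 2 R (e + 1) (k + 1) fun i => pd a (fluxDefect A u V a i))))
      (SmGraded.sum (t := Finset.univ) fun a => SmGraded.sum (t := Finset.univ) fun b =>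
        (⟨fun i => ((hA.smooth a b i).pd a).mul ((h.su i).pd b), ?_⟩ :
          SmGraded 2 R (e + 1) (k + 1) fun i y => pd a (A a b i) y * pd b (u i) y)))
      fun i y => ?_
    · have := Graded.mul hR.mul (fun i => (hA.smooth a b i).pd a) (fun i => (h.su i).pd b)
        ((hA.graded a b (e + 2)).2 a) (h.grad b)
      rwa [zero_add, add_comm 1 k] at this
    · have h1 : ∀ a, pd a (fluxDefect A u V a i) y =
          ∑ b, pd a (A a b i) y * pd b (u i) y + ∑ b, A a b i y * pd a (pd b (u i)) y
            - pd a (V a i) y := by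
        intro a
        have : pd a (fluxDefect A u V a i) y =
          pd a (fun z => (∑ b, A a b i z * pd b (u i) z) - V a i z) y := rfl
        rw [this, pd_sub (Sm.sum fun b _ => (hA.smooth a b i).mul ((h.su i).pd b)) (h.sV a i),
          pd_sum fun b _ => (hA.smooth a b i).mul ((h.su i).pd b), ← Finset.sum_add_distrib]
        simp only [fun b => pd_mul (hA.smooth a b i) ((h.su i).pd b)]
      simp only [h1, fieldDiv, Finset.sum_sub_distrib, Finset.sum_add_distrib]
      ring
  have sS : ∀ a b, SmGraded 2 R (e + 1) (k + 1)
      (fun i y => ∑ j, y j * fieldDeriv (rotField j a) (pd b (u i)) y) := fun a b =>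
    SmGraded.sum fun j => SmGraded.smul hN hR (sc j) (st _ (tangentField_rot j a) b)
  have sX : ∀ a b, SmGraded 2 R (e + 1) (k + 1)
      (fun i => fieldDeriv (radialField a) (pd b (u i))) := fun a b =>
    st _ (tangentField_radial a) b
  have sQ := fun a b : Fin n => SmGraded.add (SmGraded.smul hN hR sr (sS a b))
    (SmGraded.smul hN hR (sc a) (SmGraded.sum (t := Finset.univ) fun c =>
      SmGraded.smul hN hR (sc c) (sS b c)))
  have sE := SmGraded.mul hR (sε (e + 1)) (SmGraded.add (SmGraded.sub hN hR
    (SmGraded.smul hN hR sr (SmGraded.smul hN hR sr sf))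
    (SmGraded.sum (t := Finset.univ) fun a => SmGraded.sum (t := Finset.univ) fun b =>
      SmGraded.mul hR (sA a b) (sQ a b)))
    (SmGraded.sum (t := Finset.univ) fun a => SmGraded.sum (t := Finset.univ) fun b =>
      SmGraded.smul hN hR (sc a) (SmGraded.smul hN hR (sc b) (sX a b))))
  refine Graded.succ_intro (h.grad b).one_of_succ fun a => ?_
  refine (SmGraded.add (SmGraded.add (sQ a b)
    (SmGraded.smul hN hR (sc a) (SmGraded.smul hN hR (sc b) sE)))
    (SmGraded.smul hN hR (sr.add (Sm.const 1)) (sX a b))).graded.congr fun i y hy => ?_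
  have key := hessian_recovery (fun c => y c) (fun a b => pd a (pd b (u i)) y)
    (fun a b => A a b i y) _ _ (ε i y) _ _ rfl (fun a b => pd_comm (h.su i) a b y)
    (fun a b => rfl) (fun a b => rfl) (hε i y (Metric.ball_subset_closedBall hy)) rfl a b
  rw [key]
  simp only [rotField_deriv, radialField_deriv, rho]

/-- Regularity for families of Dirichlet problems, by induction on the number of derivatives. -/
lemma DirichletData.regularity (hN : Weights N N) (hR : Weights N R)
    (hA : EllipticFamily N A lam) (hn : 0 < n) (h : DirichletData A R (e + 1) k u V)
    (b : Fin n) : Graded 2 R (e + 2) k (fun i => pd b (u i)) := by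
  induction e generalizing k u V b with
  | zero => exact h.grad_succ hN hR hA (fun s hs b => h.tangential_grad hN hR hA hn hs b) b
  | succ e ih => exact h.grad_succ hN hR hA (fun s hs b => ih (h.lie hN hR hA hs) b) b

lemma DirichletData.graded_all (hN : Weights N N) (hR : Weights N R)
    (hA : EllipticFamily N A lam) (hn : 0 < n) {u : ι → E' n → ℝ} {V : Fin n → ι → E' n → ℝ}
    (su : ∀ i, Sm (u i)) (sV : ∀ a i, Sm (V a i)) (h0 : ∀ i, ∀ y ∈ Sphere' n, u i y = 0)
    (hb : ∀ b, Graded 2 R 1 k (fun i => pd b (u i)))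
    (hF : ∀ d a, Graded 2 R d k (fluxDefect A u V a))
    (hV : ∀ d, Graded 2 R d (k + 1) (fun i => fieldDiv (fun a => V a i)))
    (d : ℕ) (b : Fin n) : Graded 2 R (d + 1) k (fun i => pd b (u i)) := by
  induction d generalizing b with
  | zero => exact hb b
  | succ d ih =>
    exact DirichletData.regularity (e := d) hN hR hA hn
      ⟨su, sV, h0, ih, hF _, hV _⟩ b

end NormalDerivatives

section Interpolation

/-- Approximate log-convexity implies the interpolation inequality between products. -/
lemma exists_mul_le_of_logConvex {D : ℝ} (hD : 0 ≤ D) (a b : ℕ) :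
    ∃ C : ℝ, 0 ≤ C ∧ ∀ m : ℕ → ℝ, (∀ k, 0 < m k) →
      (∀ k, m (k + 1) ^ 2 ≤ D * (m k * m (k + 2))) → m a * m b ≤ C * (m 0 * m (a + b)) := by
  have step : ∀ m : ℕ → ℝ, (∀ k, 0 < m k) → (∀ k, m (k + 1) ^ 2 ≤ D * (m k * m (k + 2))) →
      ∀ a l, m (a + 1) * m (a + l) ≤ D ^ l * (m a * m (a + l + 1)) := by
    intro m hm h a l
    induction l with
    | zero => simp [mul_comm]
    | succ l ih =>
      have h1 := h (a + l)
      have h2 := hm (a + l + 1)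
      refine le_of_mul_le_mul_right ?_ h2
      calc m (a + 1) * m (a + (l + 1)) * m (a + l + 1)
          = m (a + 1) * m (a + l + 1) ^ 2 := by rw [← add_assoc]; ring
        _ ≤ m (a + 1) * (D * (m (a + l) * m (a + l + 2))) := by
            gcongr
            exact (hm _).le
        _ = D * m (a + l + 2) * (m (a + 1) * m (a + l)) := by ring
        _ ≤ D * m (a + l + 2) * (D ^ l * (m a * m (a + l + 1))) := by
            have := (hm (a + l + 2)).le
            gcongr
        _ = _ := by rw [← add_assoc]; ring
  have main : ∀ a l, ∃ C : ℝ, 0 ≤ C ∧ ∀ m : ℕ → ℝ, (∀ k, 0 < m k) →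
      (∀ k, m (k + 1) ^ 2 ≤ D * (m k * m (k + 2))) →
        m a * m (a + l) ≤ C * (m 0 * m (a + (a + l))) := by
    intro a
    induction a with
    | zero => exact fun l => ⟨1, zero_le_one, fun m _ _ => by simp⟩
    | succ a ih =>
      intro l
      obtain ⟨C, hC0, hC⟩ := ih (l + 2)
      refine ⟨D ^ (l + 1) * C, by positivity, fun m hm h => ?_⟩
      have h1 := step m hm h a (l + 1)
      have h2 := hC m hm h
      have e1 : a + 1 + l = a + (l + 1) := by ring
      have e2 : a + (l + 1) + 1 = a + (l + 2) := by ring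
      have e3 : a + (a + (l + 2)) = a + 1 + (a + (l + 1)) := by ring
      rw [e2] at h1
      rw [e3] at h2
      rw [e1]
      refine h1.trans ?_
      rw [mul_assoc]
      gcongr
  rcases le_total a b with h | h
  · obtain ⟨l, rfl⟩ := Nat.exists_eq_add_of_le h
    exact main a l
  · obtain ⟨l, rfl⟩ := Nat.exists_eq_add_of_le h
    obtain ⟨C, hC0, hC⟩ := main b l
    refine ⟨C, hC0, fun m hm h => ?_⟩
    rw [mul_comm, add_comm (b + l) b]
    exact hC m hm h

lemma sq_le_of_forall_scale {a b x : ℝ} (ha : 0 ≤ a) (hab : a ≤ b) (hx : 0 ≤ x)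
    (h : ∀ t : ℝ, 0 < t → t ≤ 1 → x * t ≤ 4 * a + 8 * t ^ 2 * b) : x ^ 2 ≤ 144 * (a * b) := by
  rcases ha.eq_or_lt with h0 | h0
  · subst h0
    have : x ≤ 0 := by
      by_contra! hc
      have ht : 0 < min 1 (x / (16 * (b + 1))) := lt_min one_pos (by positivity)
      have h1 := h _ ht (min_le_left _ _)
      set t := min 1 (x / (16 * (b + 1)))
      have h2 : t ≤ x / (16 * (b + 1)) := min_le_right _ _
      rw [le_div_iff₀ (by positivity)] at h2
      have h3 : x ≤ 8 * t * b := by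
        refine le_of_mul_le_mul_right ?_ ht
        linarith
      nlinarith
    have : x = 0 := le_antisymm this hx
    simp [this]
  · have hb := h0.trans_le hab
    have ht : 0 < Real.sqrt (a / b) := Real.sqrt_pos.2 (by positivity)
    have h1 := h _ ht (Real.sqrt_le_one.2 ((div_le_one hb).2 hab))
    have hs : Real.sqrt (a / b) ^ 2 = a / b := Real.sq_sqrt (by positivity)
    rw [hs] at h1
    have h2 : 8 * (a / b) * b = 8 * a := by field_simp
    rw [h2] at h1
    have h3 : (x * Real.sqrt (a / b)) ^ 2 ≤ (12 * a) ^ 2 := by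
      refine pow_le_pow_left₀ (mul_nonneg hx ht.le) ?_ 2
      linarith
    rw [mul_pow, hs] at h3
    have h4 : x ^ 2 * a ≤ 144 * (a * b) * a := by
      have : x ^ 2 * (a / b) * b = x ^ 2 * a := by field_simp
      nlinarith
    exact le_of_mul_le_mul_right h4 h0

/-- Landau–Kolmogorov inequality on the unit ball. -/
lemma norm_fderiv_sq_le {G : Type*} [NormedAddCommGroup G] [NormedSpace ℝ G] {f : E' n → G}
    (hf : ContDiff ℝ (⊤ : ℕ∞) f) {M₀ M₂ : ℝ} (h02 : M₀ ≤ M₂)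
    (h0 : ∀ y ∈ Ball n, ‖f y‖ ≤ M₀)
    (h2 : ∀ y ∈ Ball n, ∀ z ∈ Ball n, ‖fderiv ℝ f z - fderiv ℝ f y‖ ≤ M₂ * ‖z - y‖)
    {y : E' n} (hy : y ∈ Ball n) : ‖fderiv ℝ f y‖ ^ 2 ≤ 144 * (M₀ * M₂) := by
  have hM0 : 0 ≤ M₀ := (norm_nonneg _).trans (h0 y hy)
  have hconv : Convex ℝ (Ball n) := convex_closedBall _ _
  have key : ∀ z ∈ Ball n, ∀ t : ℝ, 0 < t → t ≤ 1 →
      t * ‖fderiv ℝ f y (z - y)‖ ≤ 2 * M₀ + 4 * t ^ 2 * M₂ := by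
    intro z hz t ht ht1
    have hw : y + t • (z - y) ∈ Ball n := hconv.add_smul_sub_mem hy hz ⟨ht.le, ht1⟩
    set w := y + t • (z - y) with hwdef
    have hwy : w - y = t • (z - y) := by simp [hwdef]
    have hzy : ‖z - y‖ ≤ 2 := by
      have h1 : ‖z‖ ≤ 1 := by simpa [Ball] using hz
      have h2 : ‖y‖ ≤ 1 := by simpa [Ball] using hy
      linarith [norm_sub_le z y]
    have hwy2 : ‖w - y‖ ≤ t * 2 := by
      rw [hwy, norm_smul, Real.norm_of_nonneg ht.le]
      gcongr
    have hM2 : 0 ≤ M₂ := hM0.trans h02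
    have h3 : ‖f w - f y - fderiv ℝ f y (w - y)‖ ≤ (M₂ * (t * 2)) * ‖w - y‖ := by
      refine (convex_segment y w).norm_image_sub_le_of_norm_fderiv_le'
        (fun x _ => (hf.differentiable (by simp)) x) (fun x hx => ?_)
        (left_mem_segment ℝ y w) (right_mem_segment ℝ y w)
      refine (h2 y hy x (hconv.segment_subset hy hw hx)).trans ?_
      gcongr
      exact (norm_sub_le_of_mem_segment hx).trans hwy2
    have h4 : t * ‖fderiv ℝ f y (z - y)‖ = ‖fderiv ℝ f y (w - y)‖ := by
      rw [hwy, map_smul, norm_smul, Real.norm_of_nonneg ht.le]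
    have h5 : fderiv ℝ f y (w - y) = f w - f y - (f w - f y - fderiv ℝ f y (w - y)) := by abel
    rw [h4, h5]
    calc _ ≤ ‖f w‖ + ‖f y‖ + (M₂ * (t * 2)) * (t * 2) := by
          refine (norm_sub_le _ _).trans (add_le_add (norm_sub_le _ _) (h3.trans ?_))
          gcongr
      _ ≤ M₀ + M₀ + (M₂ * (t * 2)) * (t * 2) := by
          gcongr
          exacts [h0 w hw, h0 y hy]
      _ = _ := by ring
  refine sq_le_of_forall_scale hM0 h02 (norm_nonneg _) fun t ht ht1 => ?_
  have hz : (0 : E' n) ∈ Ball n := by simp [Ball]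
  have hC : 0 ≤ (4 * M₀ + 8 * t ^ 2 * M₂) / t := by
    have := hM0.trans h02
    positivity
  rw [← le_div_iff₀ ht]
  refine ContinuousLinearMap.opNorm_le_of_unit_norm hC fun e he => ?_
  have he' : e ∈ Ball n := by simp [Ball, he]
  rw [le_div_iff₀ ht, mul_comm]
  have e1 : fderiv ℝ f y e = fderiv ℝ f y (e - y) - fderiv ℝ f y (0 - y) := by
    rw [← map_sub]; congr 1; abel
  have k1 := key e he' t ht ht1
  have k2 := key 0 hz t ht ht1
  calc t * ‖fderiv ℝ f y e‖
      ≤ t * (‖fderiv ℝ f y (e - y)‖ + ‖fderiv ℝ f y (0 - y)‖) := by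
        rw [e1]; gcongr; exact norm_sub_le _ _
    _ ≤ _ := by linarith

/-- One summand of the `C^k` norm. -/
lemma norm_iteratedFDeriv_le_iSup {u : E' n → F} (hu : ContDiff ℝ (⊤ : ℕ∞) u) (j : ℕ)
    {y : E' n} (hy : y ∈ Ball n) :
    ‖iteratedFDeriv ℝ j u y‖ ≤ ⨆ z ∈ Ball n, ‖iteratedFDeriv ℝ j u z‖ := by
  have hc : Continuous (iteratedFDeriv ℝ j u) :=
    hu.continuous_iteratedFDeriv (by exact_mod_cast le_top)
  obtain ⟨M, hM⟩ := (isCompact_closedBall (0 : E' n) 1).exists_bound_of_continuousOn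
    hc.continuousOn
  have hM0 : 0 ≤ M := (norm_nonneg _).trans (hM y hy)
  have hb : BddAbove (Set.range fun z : E' n => ⨆ _ : z ∈ Ball n, ‖iteratedFDeriv ℝ j u z‖) := by
    refine ⟨M, ?_⟩
    rintro _ ⟨z, rfl⟩
    exact Real.iSup_le (fun hz => hM z hz) hM0
  refine le_trans ?_ (le_ciSup hb y)
  simp [hy]

lemma iSup_norm_nonneg (u : E' n → F) (j : ℕ) :
    0 ≤ ⨆ z ∈ Ball n, ‖iteratedFDeriv ℝ j u z‖ :=
  Real.iSup_nonneg fun _ => Real.iSup_nonneg fun _ => norm_nonneg _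

lemma ckNorm_nonneg (k : ℕ) (u : E' n → F) : 0 ≤ ckNorm k u :=
  Finset.sum_nonneg fun j _ => iSup_norm_nonneg u j

lemma ckNorm_succ (k : ℕ) (u : E' n → F) :
    ckNorm (k + 1) u = ckNorm k u + ⨆ z ∈ Ball n, ‖iteratedFDeriv ℝ (k + 1) u z‖ :=
  Finset.sum_range_succ _ _

lemma ckNorm_le_succ (k : ℕ) (u : E' n → F) : ckNorm k u ≤ ckNorm (k + 1) u := by
  rw [ckNorm_succ]
  linarith [iSup_norm_nonneg u (k + 1)]

lemma norm_iteratedFDeriv_le_ckNorm {u : E' n → F} (hu : ContDiff ℝ (⊤ : ℕ∞) u) (j : ℕ)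
    {y : E' n} (hy : y ∈ Ball n) : ‖iteratedFDeriv ℝ j u y‖ ≤ ckNorm j u :=
  (norm_iteratedFDeriv_le_iSup hu j hy).trans
    (Finset.single_le_sum (f := fun j => ⨆ z ∈ Ball n, ‖iteratedFDeriv ℝ j u z‖)
      (fun j _ => iSup_norm_nonneg u j) (Finset.self_mem_range_succ j))

lemma ckNorm_logConvex {u : E' n → F} (hu : ContDiff ℝ (⊤ : ℕ∞) u) (k : ℕ) :
    ckNorm (k + 1) u ^ 2 ≤ 290 * (ckNorm k u * ckNorm (k + 2) u) := by
  have hk2 : ckNorm k u ≤ ckNorm (k + 2) u := (ckNorm_le_succ k u).trans (ckNorm_le_succ _ u)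
  have hs : ∀ j, ContDiff ℝ (⊤ : ℕ∞) (iteratedFDeriv ℝ j u) := fun j =>
    hu.iteratedFDeriv_right (by exact_mod_cast le_top)
  have hm : (⨆ z ∈ Ball n, ‖iteratedFDeriv ℝ (k + 1) u z‖) ≤
      Real.sqrt (144 * (ckNorm k u * ckNorm (k + 2) u)) := by
    refine Real.iSup_le (fun y => Real.iSup_le (fun hy => ?_) (Real.sqrt_nonneg _))
      (Real.sqrt_nonneg _)
    refine Real.le_sqrt_of_sq_le ?_
    rw [← norm_fderiv_iteratedFDeriv]
    refine norm_fderiv_sq_le (hs k) hk2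
      (fun z hz => norm_iteratedFDeriv_le_ckNorm hu k hz) (fun z hz w hw => ?_) hy
    have e : ∀ z w, ‖fderiv ℝ (iteratedFDeriv ℝ k u) w - fderiv ℝ (iteratedFDeriv ℝ k u) z‖ =
        ‖iteratedFDeriv ℝ (k + 1) u w - iteratedFDeriv ℝ (k + 1) u z‖ := by
      intro z w
      have h := (continuousMultilinearCurryLeftEquiv ℝ (fun _ : Fin (k + 1) => E' n) F).dist_map
        (iteratedFDeriv ℝ (k + 1) u w) (iteratedFDeriv ℝ (k + 1) u z)
      rw [dist_eq_norm, dist_eq_norm] at h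
      rw [fderiv_iteratedFDeriv]
      exact h
    rw [e]
    refine (convex_closedBall (0 : E' n) 1).norm_image_sub_le_of_norm_fderiv_le
      (fun x _ => ((hs (k + 1)).differentiable (by simp)) x) (fun x hx => ?_) hz hw
    rw [norm_fderiv_iteratedFDeriv]
    exact norm_iteratedFDeriv_le_ckNorm hu (k + 2) hx
  have h0 := ckNorm_nonneg k u
  have h2 := ckNorm_nonneg (k + 2) u
  have hm2 : (⨆ z ∈ Ball n, ‖iteratedFDeriv ℝ (k + 1) u z‖) ^ 2 ≤
      144 * (ckNorm k u * ckNorm (k + 2) u) := by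
    rw [← Real.sq_sqrt (by positivity : 0 ≤ 144 * (ckNorm k u * ckNorm (k + 2) u))]
    have := iSup_norm_nonneg u (k + 1)
    gcongr
  rw [ckNorm_succ]
  nlinarith [sq_nonneg (ckNorm k u - ⨆ z ∈ Ball n, ‖iteratedFDeriv ℝ (k + 1) u z‖)]

end Interpolation

section NormBridges

lemma norm_iteratedFDeriv_clm_comp_le {G H : Type*} [NormedAddCommGroup G] [NormedSpace ℝ G]
    [NormedAddCommGroup H] [NormedSpace ℝ H] (L : G →L[ℝ] H) (hL : ‖L‖ ≤ 1) {f : E' n → G}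
    (hf : ContDiff ℝ (⊤ : ℕ∞) f) (j : ℕ) (y : E' n) :
    ‖iteratedFDeriv ℝ j (fun z => L (f z)) y‖ ≤ ‖iteratedFDeriv ℝ j f y‖ := by
  refine (L.norm_iteratedFDeriv_comp_left (contDiff_infty.1 hf j).contDiffAt le_rfl).trans ?_
  exact mul_le_of_le_one_left (norm_nonneg _) hL

lemma norm_iteratedFDeriv_pd_le {u : E' n → ℝ} (hu : Sm u) (a : Fin n) (j : ℕ) (y : E' n) :
    ‖iteratedFDeriv ℝ j (pd a u) y‖ ≤ ‖iteratedFDeriv ℝ (j + 1) u y‖ := by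
  have h : ContDiff ℝ (⊤ : ℕ∞) (fderiv ℝ u) := hu.fderiv_right (by simp)
  rw [← norm_iteratedFDeriv_fderiv]
  refine norm_iteratedFDeriv_clm_comp_le
    (ContinuousLinearMap.apply ℝ ℝ (EuclideanSpace.single a (1 : ℝ) : E' n)) ?_ h j y
  refine ContinuousLinearMap.opNorm_le_bound _ zero_le_one fun L => ?_
  simpa using L.le_opNorm (EuclideanSpace.single a (1 : ℝ))

lemma fderiv_eq_sum_pd (u : E' n → ℝ) (y : E' n) :
    fderiv ℝ u y = ∑ a, pd a u y • coordCLM a := by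
  ext v
  have hv : v = ∑ a, v a • (EuclideanSpace.single a (1 : ℝ) : E' n) := by
    ext b
    simp [Finset.sum_apply, Pi.single_apply]
  conv_lhs => rw [hv]
  simp [pd, coordCLM, mul_comm]

lemma norm_coordCLM_le (a : Fin n) : ‖coordCLM a‖ ≤ 1 :=
  ContinuousLinearMap.opNorm_le_bound _ zero_le_one fun v => by
    simpa [coordCLM] using PiLp.norm_apply_le v a

lemma norm_iteratedFDeriv_succ_le {u : E' n → ℝ} (hu : Sm u) (j : ℕ) (y : E' n) :
    ‖iteratedFDeriv ℝ (j + 1) u y‖ ≤ ∑ a, ‖iteratedFDeriv ℝ j (pd a u) y‖ := by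
  rw [← norm_iteratedFDeriv_fderiv]
  let L : Fin n → ℝ →L[ℝ] (E' n →L[ℝ] ℝ) := fun a =>
    (ContinuousLinearMap.id ℝ ℝ).smulRight (coordCLM a)
  have hL : ∀ a, ‖L a‖ ≤ 1 := fun a =>
    ContinuousLinearMap.opNorm_le_bound _ zero_le_one fun t => by
      simp only [L, ContinuousLinearMap.smulRight_apply, ContinuousLinearMap.id_apply, norm_smul]
      rw [one_mul]
      exact mul_le_of_le_one_right (norm_nonneg _) (norm_coordCLM_le a)
  have h : fderiv ℝ u = fun z => ∑ a, L a (pd a u z) := funext fun z => fderiv_eq_sum_pd u z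
  rw [h, iteratedFDeriv_sum (f := fun a z => L a (pd a u z)) fun a _ =>
    contDiff_infty.1 ((L a).contDiff.comp (hu.pd a)) j]
  rw [Finset.sum_apply]
  refine (norm_sum_le _ _).trans (Finset.sum_le_sum fun a _ => ?_)
  exact norm_iteratedFDeriv_clm_comp_le (L a) (hL a) (hu.pd a) j y

lemma norm_iteratedFDeriv_component_le {U : E' n → Fin n → ℝ} (hU : ContDiff ℝ (⊤ : ℕ∞) U)
    (a : Fin n) (j : ℕ) (y : E' n) :
    ‖iteratedFDeriv ℝ j (fun z => U z a) y‖ ≤ ‖iteratedFDeriv ℝ j U y‖ :=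
  norm_iteratedFDeriv_clm_comp_le (ContinuousLinearMap.proj (R := ℝ) (φ := fun _ => ℝ) a)
    (ContinuousLinearMap.opNorm_le_bound _ zero_le_one fun v => by
      simpa using norm_le_pi_norm v a) hU j y

lemma norm_iteratedFDeriv_le_sum_component {U : E' n → Fin n → ℝ}
    (hU : ∀ a, Sm (fun y => U y a)) (j : ℕ) (y : E' n) :
    ‖iteratedFDeriv ℝ j U y‖ ≤ ∑ a, ‖iteratedFDeriv ℝ j (fun z => U z a) y‖ := by
  let L : Fin n → ℝ →L[ℝ] (Fin n → ℝ) := fun a => ContinuousLinearMap.single ℝ (fun _ => ℝ) a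
  have hL : ∀ a, ‖L a‖ ≤ 1 := fun a =>
    ContinuousLinearMap.opNorm_le_bound _ zero_le_one fun t => by
      simp only [L, ContinuousLinearMap.single_apply]
      rw [one_mul, Pi.norm_single]
  have h : U = fun z => ∑ a, L a (U z a) := by
    funext z b
    simp [L, Finset.sum_apply, Pi.single_apply]
  conv_lhs => rw [h]
  rw [iteratedFDeriv_sum (f := fun a z => L a (U z a)) fun a _ =>
    contDiff_infty.1 ((L a).contDiff.comp (hU a)) j]
  rw [Finset.sum_apply]
  refine (norm_sum_le _ _).trans (Finset.sum_le_sum fun a _ => ?_)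
  exact norm_iteratedFDeriv_clm_comp_le (L a) (hL a) (hU a) j y

lemma ball_ae_eq_Ball : (Metric.ball (0 : E' n) 1 : Set (E' n)) =ᵐ[volume] Ball n := by
  refine Filter.EventuallyLE.antisymm
    (Filter.Eventually.of_forall fun y hy => Metric.ball_subset_closedBall hy) ?_
  have h : (volume : Measure (E' n)) (Metric.sphere 0 1) = 0 :=
    Measure.addHaar_sphere_of_ne_zero _ _ one_ne_zero
  have h2 : ∀ᵐ y ∂(volume : Measure (E' n)), y ∉ Metric.sphere (0 : E' n) 1 :=
    measure_eq_zero_iff_ae_notMem.1 h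
  filter_upwards [h2] with y hy hyB
  have h3 : ‖y‖ ≤ 1 := mem_closedBall_zero_iff.1 hyB
  have h4 : ‖y‖ ≠ 1 := by simpa using hy
  exact (by simpa using lt_of_le_of_ne h3 h4 : y ∈ Metric.ball (0 : E' n) 1)

lemma restrict_Ball : (volume : Measure (E' n)).restrict (Ball n) = ballMeas n :=
  (Measure.restrict_congr_set ball_ae_eq_Ball).symm

/-- Sobolev norms only see the values on the open ball. -/
lemma sobNorm_congr {u v : E' n → F} (h : EqOn u v (Metric.ball 0 1)) (r : ℕ) :
    sobNorm r u = sobNorm r v := by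
  unfold sobNorm
  refine Finset.sum_congr rfl fun j _ => ?_
  congr 1
  rw [restrict_Ball]
  refine integral_congr_ae (ae_ballMeas fun y hy => ?_)
  have h1 : u =ᶠ[𝓝 y] v := h.eventuallyEq_of_mem (Metric.isOpen_ball.mem_nhds hy)
  simp only [(h1.iteratedFDeriv ℝ j).eq_of_nhds]

lemma sobNorm_nonneg (r : ℕ) (u : E' n → F) : 0 ≤ sobNorm r u :=
  Finset.sum_nonneg fun _ _ => Real.rpow_nonneg (integral_nonneg fun _ => by positivity) _

lemma sobNorm_mono {r s : ℕ} (h : r ≤ s) (u : E' n → F) : sobNorm r u ≤ sobNorm s u := by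
  refine Finset.sum_le_sum_of_subset_of_nonneg (Finset.range_mono (by omega)) fun _ _ _ => ?_
  exact Real.rpow_nonneg (integral_nonneg fun _ => by positivity) _

lemma ofReal_sobNorm {u : E' n → F} (hu : ContDiff ℝ (⊤ : ℕ∞) u) (r : ℕ) :
    ENNReal.ofReal (sobNorm r u) =
      ∑ j ∈ Finset.range (r + 1), eLpNorm (iteratedFDeriv ℝ j u) 2 (ballMeas n) := by
  unfold sobNorm
  rw [ENNReal.ofReal_sum_of_nonneg fun _ _ =>
    Real.rpow_nonneg (integral_nonneg fun _ => by positivity) _]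
  refine Finset.sum_congr rfl fun j _ => ?_
  have hc : Continuous fun y => ‖iteratedFDeriv ℝ j u y‖ :=
    (hu.continuous_iteratedFDeriv (m := j) (by exact_mod_cast le_top)).norm
  have hm : MemLp (fun y => ‖iteratedFDeriv ℝ j u y‖) 2 (ballMeas n) := by
    refine (memLp_two_iff_integrable_sq hc.aestronglyMeasurable).2 ?_
    exact ((hc.pow 2).continuousOn.integrableOn_compact
      (isCompact_closedBall (0 : E' n) 1)).mono_set Metric.ball_subset_closedBall
  rw [restrict_Ball, ← eLpNorm_norm, hm.eLpNorm_eq_integral_rpow_norm (by simp) (by simp)]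
  simp

end NormBridges

section GradedNorms

variable {ι : Type*} {p : ℝ≥0∞} {N R : ι → ℕ → ℝ≥0∞}

lemma Graded.exists_eLpNorm_iteratedFDeriv_le [Fact (1 ≤ p)] {d k : ℕ} {u : ι → E' n → ℝ}
    (su : ∀ i, Sm (u i)) (hu : Graded p R (d + 1) k u) {j : ℕ} (hj : j ≤ d) :
    ∃ C : ℝ≥0, ∀ i, eLpNorm (iteratedFDeriv ℝ j (u i)) p (ballMeas n) ≤ C * R i (k + j) := by
  induction j generalizing d k u with
  | zero =>
    obtain ⟨C, hC⟩ := hu.1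
    refine ⟨C, fun i => le_trans (le_of_eq ?_) (hC i)⟩
    exact eLpNorm_congr_norm_ae (Filter.Eventually.of_forall fun y => norm_iteratedFDeriv_zero)
  | succ j ih =>
    obtain ⟨d, rfl⟩ : ∃ e, d = e + 1 := ⟨d - 1, by omega⟩
    choose C hC using fun a => ih (fun i => (su i).pd a) (hu.2 a) (by omega)
    refine ⟨∑ a, C a, fun i => ?_⟩
    have hc : ∀ a, Continuous fun y => ‖iteratedFDeriv ℝ j (pd a (u i)) y‖ := fun a =>
      (((su i).pd a).continuous_iteratedFDeriv (m := j) (by exact_mod_cast le_top)).norm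
    calc eLpNorm (iteratedFDeriv ℝ (j + 1) (u i)) p (ballMeas n)
        ≤ eLpNorm (∑ a, fun y => ‖iteratedFDeriv ℝ j (pd a (u i)) y‖) p (ballMeas n) := by
          refine eLpNorm_mono_real fun y => ?_
          simpa using norm_iteratedFDeriv_succ_le (su i) j y
      _ ≤ ∑ a, eLpNorm (fun y => ‖iteratedFDeriv ℝ j (pd a (u i)) y‖) p (ballMeas n) :=
          eLpNorm_sum_le (fun a _ => (hc a).aestronglyMeasurable) Fact.out
      _ ≤ ∑ a, C a * R i (k + (j + 1)) := by
          refine Finset.sum_le_sum fun a _ => ?_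
          rw [eLpNorm_norm]
          simpa [add_assoc, add_comm 1 j] using hC a i
      _ = _ := by rw [← Finset.sum_mul]; push_cast; rfl

lemma Graded.of_iteratedFDeriv {k : ℕ} {u : ι → E' n → ℝ} (su : ∀ i, Sm (u i))
    (h : ∀ j, ∃ C : ℝ≥0, ∀ i,
      eLpNorm (iteratedFDeriv ℝ j (u i)) p (ballMeas n) ≤ C * R i (k + j)) (d : ℕ) :
    Graded p R d k u := by
  induction d generalizing k u with
  | zero => trivial
  | succ d ih =>
    refine ⟨?_, fun a => ih (fun i => (su i).pd a) fun j => ?_⟩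
    · obtain ⟨C, hC⟩ := h 0
      refine ⟨C, fun i => le_trans (le_of_eq ?_) (hC i)⟩
      exact (eLpNorm_congr_norm_ae
        (Filter.Eventually.of_forall fun y => norm_iteratedFDeriv_zero)).symm
    · obtain ⟨C, hC⟩ := h (j + 1)
      refine ⟨C, fun i => (eLpNorm_mono fun y => norm_iteratedFDeriv_pd_le (su i) a j y).trans ?_⟩
      simpa [add_assoc, add_comm 1 j] using hC i

lemma le_mul_of_step (hR : ∀ k, ∃ C : ℝ≥0, ∀ i, R i k ≤ C * R i (k + 1)) (k l : ℕ) :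
    ∃ C : ℝ≥0, ∀ i, R i k ≤ C * R i (k + l) := by
  induction l with
  | zero => exact ⟨1, fun i => by simp⟩
  | succ l ih =>
    obtain ⟨C, hC⟩ := ih
    obtain ⟨D, hD⟩ := hR (k + l)
    refine ⟨C * D, fun i => (hC i).trans ?_⟩
    rw [ENNReal.coe_mul, mul_assoc]
    exact mul_le_mul' le_rfl (hD i)

lemma Graded.exists_sobNorm_le (hR : ∀ k, ∃ C : ℝ≥0, ∀ i, R i k ≤ C * R i (k + 1)) {r : ℕ}
    {u : ι → E' n → ℝ} (su : ∀ i, Sm (u i)) (hu : Graded 2 R (r + 1) 0 u) :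
    ∃ C : ℝ≥0, ∀ i, ENNReal.ofReal (sobNorm r (u i)) ≤ C * R i r := by
  have h : ∀ j : Fin (r + 1), ∃ C : ℝ≥0, ∀ i,
      eLpNorm (iteratedFDeriv ℝ (j : ℕ) (u i)) 2 (ballMeas n) ≤ C * R i r := by
    intro j
    obtain ⟨C, hC⟩ := hu.exists_eLpNorm_iteratedFDeriv_le su (Nat.lt_succ_iff.1 j.2)
    obtain ⟨D, hD⟩ := le_mul_of_step hR j (r - j)
    refine ⟨C * D, fun i => (hC i).trans ?_⟩
    rw [ENNReal.coe_mul, mul_assoc, zero_add]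
    refine mul_le_mul' le_rfl ((hD i).trans (le_of_eq ?_))
    rw [Nat.add_sub_cancel' (Nat.lt_succ_iff.1 j.2)]
  choose C hC using h
  refine ⟨∑ j, C j, fun i => ?_⟩
  rw [ofReal_sobNorm (su i), Finset.sum_range]
  refine (Finset.sum_le_sum fun j _ => hC j i).trans (le_of_eq ?_)
  rw [← Finset.sum_mul]
  push_cast
  rfl

lemma eLpNorm_iteratedFDeriv_le_sobNorm {u : E' n → F} (hu : ContDiff ℝ (⊤ : ℕ∞) u) (j : ℕ) :
    eLpNorm (iteratedFDeriv ℝ j u) 2 (ballMeas n) ≤ ENNReal.ofReal (sobNorm j u) := by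
  rw [ofReal_sobNorm hu]
  exact Finset.single_le_sum (f := fun j => eLpNorm (iteratedFDeriv ℝ j u) 2 (ballMeas n))
    (fun _ _ => zero_le) (Finset.self_mem_range_succ j)

lemma sobNorm_component_le {U : E' n → Fin n → ℝ} (hU : ∀ a, Sm (fun y => U y a)) (a : Fin n)
    (r : ℕ) : sobNorm r (fun y => U y a) ≤ sobNorm r U := by
  have hU' : ContDiff ℝ (⊤ : ℕ∞) U := contDiff_pi.2 hU
  rw [← ENNReal.ofReal_le_ofReal_iff (sobNorm_nonneg _ _), ofReal_sobNorm (hU a),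
    ofReal_sobNorm hU']
  exact Finset.sum_le_sum fun j _ =>
    eLpNorm_mono fun y => norm_iteratedFDeriv_component_le hU' a j y

lemma sobNorm_le_sum_component {U : E' n → Fin n → ℝ} (hU : ∀ a, Sm (fun y => U y a)) (r : ℕ) :
    sobNorm r U ≤ ∑ a, sobNorm r (fun y => U y a) := by
  have hU' : ContDiff ℝ (⊤ : ℕ∞) U := contDiff_pi.2 hU
  have hc : ∀ a j, Continuous fun y => ‖iteratedFDeriv ℝ j (fun z => U z a) y‖ := fun a j =>
    ((hU a).continuous_iteratedFDeriv (m := j) (by exact_mod_cast le_top)).norm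
  rw [← ENNReal.ofReal_le_ofReal_iff (Finset.sum_nonneg fun _ _ => sobNorm_nonneg _ _),
    ENNReal.ofReal_sum_of_nonneg fun _ _ => sobNorm_nonneg _ _, ofReal_sobNorm hU']
  simp only [fun a => ofReal_sobNorm (hU a) r]
  rw [Finset.sum_comm]
  refine Finset.sum_le_sum fun j _ => ?_
  calc eLpNorm (iteratedFDeriv ℝ j U) 2 (ballMeas n)
      ≤ eLpNorm (∑ a, fun y => ‖iteratedFDeriv ℝ j (fun z => U z a) y‖) 2 (ballMeas n) := by
        refine eLpNorm_mono_real fun y => ?_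
        simpa using norm_iteratedFDeriv_le_sum_component hU j y
    _ ≤ ∑ a, eLpNorm (fun y => ‖iteratedFDeriv ℝ j (fun z => U z a) y‖) 2 (ballMeas n) :=
        eLpNorm_sum_le (fun a _ => (hc a j).aestronglyMeasurable) (by norm_num)
    _ = _ := by simp only [eLpNorm_norm]

lemma sobNorm_succ_le {u : E' n → ℝ} (hu : Sm u) (r : ℕ) :
    sobNorm (r + 1) u ≤ sobNorm 0 u + ∑ a, sobNorm r (pd a u) := by
  have hc : ∀ a j, Continuous fun y => ‖iteratedFDeriv ℝ j (pd a u) y‖ := fun a j =>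
    ((hu.pd a).continuous_iteratedFDeriv (m := j) (by exact_mod_cast le_top)).norm
  have h0 : 0 ≤ ∑ a, sobNorm r (pd a u) := Finset.sum_nonneg fun _ _ => sobNorm_nonneg _ _
  rw [← ENNReal.ofReal_le_ofReal_iff (add_nonneg (sobNorm_nonneg _ _) h0),
    ENNReal.ofReal_add (sobNorm_nonneg _ _) h0,
    ENNReal.ofReal_sum_of_nonneg fun _ _ => sobNorm_nonneg _ _, ofReal_sobNorm hu,
    ofReal_sobNorm hu, Finset.sum_range_succ']
  simp only [fun a => ofReal_sobNorm (hu.pd a) r]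
  rw [Finset.sum_comm, add_comm]
  simp only [zero_add, Finset.sum_range_one]
  refine add_le_add le_rfl (Finset.sum_le_sum fun j _ => ?_)
  calc eLpNorm (iteratedFDeriv ℝ (j + 1) u) 2 (ballMeas n)
      ≤ eLpNorm (∑ a, fun y => ‖iteratedFDeriv ℝ j (pd a u) y‖) 2 (ballMeas n) := by
        refine eLpNorm_mono_real fun y => ?_
        simpa using norm_iteratedFDeriv_succ_le hu j y
    _ ≤ ∑ a, eLpNorm (fun y => ‖iteratedFDeriv ℝ j (pd a u) y‖) 2 (ballMeas n) :=
        eLpNorm_sum_le (fun a _ => (hc a j).aestronglyMeasurable) (by norm_num)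
    _ = _ := by simp only [eLpNorm_norm]

lemma eLpNorm_top_iteratedFDeriv_le_ckNorm {u : E' n → ℝ} (hu : Sm u) (j : ℕ) :
    eLpNorm (iteratedFDeriv ℝ j u) ∞ (ballMeas n) ≤ ENNReal.ofReal (ckNorm j u) := by
  rw [eLpNorm_exponent_top]
  exact eLpNormEssSup_le_of_ae_bound (ae_ballMeas fun y hy =>
    norm_iteratedFDeriv_le_ckNorm hu j (Metric.ball_subset_closedBall hy))

end GradedNorms

section MetricWeights

/-- Smooth coordinates on the ball satisfying the coordinate condition with constant `c₁`. -/
structure Admissible (c₁ : ℝ) (x : E' n → E' n) : Prop where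
  smooth : ContDiff ℝ (⊤ : ℕ∞) x
  det_ne : ∀ y ∈ Ball n, (jacM x y).det ≠ 0
  coord : ∀ y ∈ Ball n, coordCond x c₁ y

/-- The sum of the `C^k` norms of the components of the metric. -/
def metNorm (x : E' n → E' n) (k : ℕ) : ℝ := ∑ a, ∑ b, ckNorm k (fun y => gMet x y a b)

/-- The weights given by the `C^k` norms of a family of metrics. -/
def metWeight {ι : Type*} (X : ι → E' n → E' n) (i : ι) (k : ℕ) : ℝ≥0∞ :=
  ENNReal.ofReal (metNorm (X i) k)

variable {x : E' n → E' n} {c₁ : ℝ}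

lemma sm_jacM (hx : ContDiff ℝ (⊤ : ℕ∞) x) (i a : Fin n) : Sm (fun y => jacM x y i a) :=
  Sm.pd ((coordCLM i).contDiff.comp hx : Sm (fun z => x z i)) a

lemma gMet_apply (x : E' n → E' n) (y : E' n) (a b : Fin n) :
    gMet x y a b = ∑ i, jacM x y i a * jacM x y i b := by
  simp [gMet, Matrix.mul_apply]

lemma sm_gMet (hx : ContDiff ℝ (⊤ : ℕ∞) x) (a b : Fin n) : Sm (fun y => gMet x y a b) := by
  simp only [gMet_apply]
  exact Sm.sum fun i _ => (sm_jacM hx i a).mul (sm_jacM hx i b)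

lemma metNorm_nonneg (x : E' n → E' n) (k : ℕ) : 0 ≤ metNorm x k :=
  Finset.sum_nonneg fun _ _ => Finset.sum_nonneg fun _ _ => ckNorm_nonneg _ _

lemma metNorm_le_succ (x : E' n → E' n) (k : ℕ) : metNorm x k ≤ metNorm x (k + 1) :=
  Finset.sum_le_sum fun _ _ => Finset.sum_le_sum fun _ _ => ckNorm_le_succ _ _

lemma ckNorm_le_metNorm (x : E' n → E' n) (k : ℕ) (a b : Fin n) :
    ckNorm k (fun y => gMet x y a b) ≤ metNorm x k := by
  refine le_trans ?_ (Finset.single_le_sum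
    (f := fun a => ∑ b, ckNorm k (fun y => gMet x y a b))
    (fun _ _ => Finset.sum_nonneg fun _ _ => ckNorm_nonneg _ _) (Finset.mem_univ a))
  exact Finset.single_le_sum (f := fun b => ckNorm k (fun y => gMet x y a b))
    (fun _ _ => ckNorm_nonneg _ _) (Finset.mem_univ b)

lemma metNorm_logConvex (hx : ContDiff ℝ (⊤ : ℕ∞) x) (k : ℕ) :
    metNorm x (k + 1) ^ 2 ≤ (n ^ 2 * 290 : ℝ) * (metNorm x k * metNorm x (k + 2)) := by
  have h1 : ∀ k, metNorm x k = ∑ c : Fin n × Fin n, ckNorm k (fun y => gMet x y c.1 c.2) := by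
    intro k
    rw [metNorm, Fintype.sum_prod_type]
  calc metNorm x (k + 1) ^ 2
      ≤ (n ^ 2 : ℝ) * ∑ c : Fin n × Fin n, ckNorm (k + 1) (fun y => gMet x y c.1 c.2) ^ 2 := by
        rw [h1]
        refine (sq_sum_le_card_mul_sum_sq).trans (le_of_eq ?_)
        simp [sq]
    _ ≤ (n ^ 2 : ℝ) * ∑ c : Fin n × Fin n, 290 * (ckNorm k (fun y => gMet x y c.1 c.2) *
          metNorm x (k + 2)) := by
        gcongr with c
        refine (ckNorm_logConvex (sm_gMet hx c.1 c.2) k).trans ?_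
        gcongr
        · exact ckNorm_nonneg _ _
        · exact ckNorm_le_metNorm x (k + 2) c.1 c.2
    _ = _ := by rw [← Finset.mul_sum, ← Finset.sum_mul, ← h1]; ring

lemma Admissible.sq_jacM_le (hx : Admissible c₁ x) {y : E' n} (hy : y ∈ Ball n) :
    (∑ i, ∑ a, jacM x y i a ^ 2) ≤ c₁ ^ 2 := by
  have h : 0 ≤ ∑ i, ∑ a, ((jacM x y)⁻¹ i a) ^ 2 := by positivity
  have := hx.coord y hy
  unfold coordCond at this
  linarith

lemma Admissible.sq_inv_jacM_le (hx : Admissible c₁ x) {y : E' n} (hy : y ∈ Ball n) :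
    (∑ i, ∑ a, (jacM x y)⁻¹ i a ^ 2) ≤ c₁ ^ 2 := by
  have h : 0 ≤ ∑ i, ∑ a, (jacM x y i a) ^ 2 := by positivity
  have := hx.coord y hy
  unfold coordCond at this
  linarith

lemma abs_le_of_sum_sq_le {M : Matrix (Fin n) (Fin n) ℝ} {c : ℝ}
    (h : ∑ i, ∑ a, M i a ^ 2 ≤ c ^ 2) (i a : Fin n) : |M i a| ≤ |c| := by
  refine sq_le_sq.1 (le_trans ?_ h)
  refine le_trans ?_ (Finset.single_le_sum (f := fun i => ∑ a, M i a ^ 2)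
    (fun _ _ => Finset.sum_nonneg fun _ _ => sq_nonneg _) (Finset.mem_univ i))
  exact Finset.single_le_sum (f := fun a => M i a ^ 2) (fun _ _ => sq_nonneg _)
    (Finset.mem_univ a)

lemma Admissible.sq_card_le (hx : Admissible c₁ x) {y : E' n} (hy : y ∈ Ball n) :
    (n ^ 2 : ℝ) ≤ (∑ a, gMet x y a a) * c₁ ^ 2 := by
  have h1 : (n : ℝ) = ∑ c : Fin n × Fin n, jacM x y c.1 c.2 * (jacM x y)⁻¹ c.2 c.1 := by
    have h := Matrix.mul_nonsing_inv (jacM x y) (isUnit_iff_ne_zero.2 (hx.det_ne y hy))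
    have h2 := congrArg Matrix.trace h
    rw [Matrix.trace_one, Fintype.card_fin] at h2
    rw [← h2, Fintype.sum_prod_type]
    simp [Matrix.trace, Matrix.mul_apply]
  have h2 := Finset.sum_mul_sq_le_sq_mul_sq (Finset.univ : Finset (Fin n × Fin n))
    (fun c => jacM x y c.1 c.2) (fun c => (jacM x y)⁻¹ c.2 c.1)
  rw [← h1] at h2
  have h3 : ∑ c : Fin n × Fin n, jacM x y c.1 c.2 ^ 2 = ∑ a, gMet x y a a := by
    rw [Fintype.sum_prod_type, Finset.sum_comm]
    simp [gMet_apply, sq]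
  have h4 : ∑ c : Fin n × Fin n, (jacM x y)⁻¹ c.2 c.1 ^ 2 ≤ c₁ ^ 2 := by
    rw [Fintype.sum_prod_type, Finset.sum_comm]
    exact hx.sq_inv_jacM_le hy
  rw [h3] at h2
  refine h2.trans ?_
  gcongr
  refine Finset.sum_nonneg fun a _ => ?_
  rw [gMet_apply]
  exact Finset.sum_nonneg fun i _ => mul_self_nonneg _

lemma Admissible.metNorm_zero_le (hx : Admissible c₁ x) : metNorm x 0 ≤ (n ^ 2 : ℝ) * c₁ ^ 2 := by
  have h : ∀ a b, ckNorm 0 (fun y => gMet x y a b) ≤ c₁ ^ 2 := by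
    intro a b
    simp only [ckNorm, zero_add, Finset.sum_range_one, norm_iteratedFDeriv_zero]
    refine Real.iSup_le (fun y => Real.iSup_le (fun hy => ?_) (sq_nonneg _)) (sq_nonneg _)
    rw [gMet_apply, Real.norm_eq_abs]
    have h2 : ∀ c, ∑ i, jacM x y i c ^ 2 ≤ c₁ ^ 2 := fun c => by
      refine le_trans ?_ (hx.sq_jacM_le hy)
      rw [Finset.sum_comm]
      exact Finset.single_le_sum (f := fun a => ∑ i, jacM x y i a ^ 2)
        (fun _ _ => Finset.sum_nonneg fun _ _ => sq_nonneg _) (Finset.mem_univ c)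
    refine abs_le_of_sq_le_sq ?_ (sq_nonneg _)
    refine (Finset.sum_mul_sq_le_sq_mul_sq _ _ _).trans ?_
    rw [sq (c₁ ^ 2)]
    exact mul_le_mul (h2 a) (h2 b) (Finset.sum_nonneg fun _ _ => sq_nonneg _) (sq_nonneg _)
  calc metNorm x 0 ≤ ∑ _a : Fin n, ∑ _b : Fin n, c₁ ^ 2 :=
        Finset.sum_le_sum fun a _ => Finset.sum_le_sum fun b _ => h a b
    _ = _ := by simp; ring

lemma Admissible.sq_card_le_metNorm (hx : Admissible c₁ x) :
    (n ^ 2 : ℝ) ≤ metNorm x 0 * c₁ ^ 2 := by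
  have h0 : (0 : E' n) ∈ Ball n := by simp [Ball]
  refine (hx.sq_card_le h0).trans ?_
  gcongr
  refine Finset.sum_le_sum fun a _ => ?_
  refine le_trans ?_ (Finset.single_le_sum (f := fun b => ckNorm 0 (fun y => gMet x y a b))
    (fun _ _ => ckNorm_nonneg _ _) (Finset.mem_univ a))
  have h := norm_iteratedFDeriv_le_ckNorm (sm_gMet hx.smooth a a) 0 h0
  rw [norm_iteratedFDeriv_zero] at h
  exact (le_abs_self _).trans h

lemma Admissible.metNorm_pos (hn : 0 < n) (hx : Admissible c₁ x) (k : ℕ) : 0 < metNorm x k := by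
  have hn' : (0 : ℝ) < n := by exact_mod_cast hn
  induction k with
  | zero =>
    refine (metNorm_nonneg x 0).lt_of_ne fun h => ?_
    have := hx.sq_card_le_metNorm
    rw [← h, zero_mul] at this
    nlinarith
  | succ k ih => exact ih.trans_le (metNorm_le_succ x k)

lemma exists_metNorm_mul_le (hn : 0 < n) (c₁ : ℝ) (k l : ℕ) :
    ∃ C : ℝ, 0 ≤ C ∧ ∀ x : E' n → E' n, Admissible c₁ x →
      metNorm x k * metNorm x l ≤ C * metNorm x (k + l) := by
  obtain ⟨C, hC, h⟩ := exists_mul_le_of_logConvex (D := (n ^ 2 * 290 : ℝ)) (by positivity) k l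
  refine ⟨C * (n ^ 2 * c₁ ^ 2), by positivity, fun x hx => ?_⟩
  refine (h (metNorm x) (hx.metNorm_pos hn) (metNorm_logConvex hx.smooth)).trans ?_
  rw [mul_assoc]
  gcongr
  · exact metNorm_nonneg _ _
  · exact hx.metNorm_zero_le

variable {ι : Type*} {X : ι → E' n → E' n}

/-- The weights built from a family of metrics, a sequence of nonnegative numbers and a further
nonnegative number. -/
def dataWeight (X : ι → E' n → E' n) (e : ℕ) (f : ι → ℕ → ℝ) (w : ι → ℝ) (i : ι) (m : ℕ) :
    ℝ≥0∞ :=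
  ENNReal.ofReal (∑ s ∈ Finset.range (m + e), metNorm (X i) (m + e - 1 - s) * f i s +
    metNorm (X i) m * w i)

lemma one_le_metWeight (hn : 0 < n) (hX : ∀ i, Admissible c₁ (X i)) :
    ∃ C : ℝ≥0, ∀ i, 1 ≤ C * metWeight X i 0 := by
  refine ⟨(c₁ ^ 2).toNNReal, fun i => ?_⟩
  have hn' : (1 : ℝ) ≤ n := by exact_mod_cast hn
  have h := (hX i).sq_card_le_metNorm
  change (1 : ℝ≥0∞) ≤ ENNReal.ofReal (c₁ ^ 2) * _
  rw [metWeight, ← ENNReal.ofReal_mul (sq_nonneg _), ENNReal.one_le_ofReal]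
  nlinarith

lemma weights_dataWeight (hn : 0 < n) (hX : ∀ i, Admissible c₁ (X i)) (e : ℕ)
    {f : ι → ℕ → ℝ} {w : ι → ℝ} (hf : ∀ i s, 0 ≤ f i s) (hw : ∀ i, 0 ≤ w i) :
    Weights (metWeight X) (dataWeight X e f w) where
  mul k l := by
    choose D hD0 hD using fun j => exists_metNorm_mul_le (n := n) hn c₁ k j
    set C : ℝ := ∑ j ∈ Finset.range (l + e + 1), D j with hC
    have hDC : ∀ j < l + e + 1, D j ≤ C := fun j hj =>
      Finset.single_le_sum (fun j _ => hD0 j) (Finset.mem_range.2 hj)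
    have hC0 : 0 ≤ C := Finset.sum_nonneg fun j _ => hD0 j
    have hm : ∀ i j, j < l + e + 1 → metNorm (X i) k * metNorm (X i) j ≤
        C * metNorm (X i) (k + j) := fun i j hj =>
      (hD j (X i) (hX i)).trans (mul_le_mul_of_nonneg_right (hDC j hj) (metNorm_nonneg _ _))
    refine ⟨C.toNNReal, fun i => ?_⟩
    change _ ≤ ENNReal.ofReal C * _
    rw [metWeight, dataWeight, dataWeight, ← ENNReal.ofReal_mul (metNorm_nonneg _ _),
      ← ENNReal.ofReal_mul hC0]
    refine ENNReal.ofReal_le_ofReal ?_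
    rw [mul_add, mul_add, ← mul_assoc, ← mul_assoc, Finset.mul_sum]
    refine add_le_add ?_ (mul_le_mul_of_nonneg_right (hm i l (by omega)) (hw i))
    calc ∑ s ∈ Finset.range (l + e), metNorm (X i) k * (metNorm (X i) (l + e - 1 - s) * f i s)
        ≤ ∑ s ∈ Finset.range (l + e), C * (metNorm (X i) (k + l + e - 1 - s) * f i s) := by
          refine Finset.sum_le_sum fun s hs => ?_
          have hs' := Finset.mem_range.1 hs
          rw [← mul_assoc, ← mul_assoc]
          refine mul_le_mul_of_nonneg_right ?_ (hf i s)
          have := hm i (l + e - 1 - s) (by omega)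
          rwa [show k + (l + e - 1 - s) = k + l + e - 1 - s by omega] at this
      _ ≤ ∑ s ∈ Finset.range (k + l + e), C * (metNorm (X i) (k + l + e - 1 - s) * f i s) := by
          refine Finset.sum_le_sum_of_subset_of_nonneg (Finset.range_mono (by omega))
            fun s _ _ => ?_
          exact mul_nonneg hC0 (mul_nonneg (metNorm_nonneg _ _) (hf i s))
      _ = _ := by rw [Finset.mul_sum]
  one := one_le_metWeight hn hX
  mono k := by
    refine ⟨1, fun i => ?_⟩
    rw [ENNReal.coe_one, one_mul]
    refine ENNReal.ofReal_le_ofReal (add_le_add ?_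
      (mul_le_mul_of_nonneg_right (metNorm_le_succ _ _) (hw i)))
    calc ∑ s ∈ Finset.range (k + e), metNorm (X i) (k + e - 1 - s) * f i s
        ≤ ∑ s ∈ Finset.range (k + e), metNorm (X i) (k + 1 + e - 1 - s) * f i s := by
          refine Finset.sum_le_sum fun s hs => ?_
          have hs' := Finset.mem_range.1 hs
          refine mul_le_mul_of_nonneg_right ?_ (hf i s)
          rw [show k + 1 + e - 1 - s = (k + e - 1 - s) + 1 by omega]
          exact metNorm_le_succ _ _
      _ ≤ _ := Finset.sum_le_sum_of_subset_of_nonneg (Finset.range_mono (by omega))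
          fun s _ _ => mul_nonneg (metNorm_nonneg _ _) (hf i s)

lemma weights_metWeight (hn : 0 < n) (hX : ∀ i, Admissible c₁ (X i)) :
    Weights (metWeight X) (metWeight X) := by
  have h := weights_dataWeight hn hX 0 (f := fun _ _ => 0) (w := fun _ => 1) (fun _ _ => le_rfl)
    fun _ => zero_le_one
  have e : dataWeight X 0 (fun _ _ => 0) (fun _ => 1) = metWeight X := by
    funext i m
    simp [dataWeight, metWeight]
  rwa [e] at h

lemma graded_gMet (hX : ∀ i, Admissible c₁ (X i)) (a b : Fin n) (d : ℕ) :
    SmGraded ∞ (metWeight X) d 0 (fun i y => gMet (X i) y a b) := by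
  have s : ∀ i, Sm (fun y => gMet (X i) y a b) := fun i => sm_gMet (hX i).smooth a b
  refine ⟨s, Graded.of_iteratedFDeriv s (fun j => ⟨1, fun i => ?_⟩) d⟩
  rw [ENNReal.coe_one, one_mul, zero_add]
  exact (eLpNorm_top_iteratedFDeriv_le_ckNorm (s i) j).trans
    (ENNReal.ofReal_le_ofReal (ckNorm_le_metNorm _ _ _ _))

/-- Functions controlled by the data sequence. -/
lemma graded_of_sobNorm_le (hn : 0 < n) (hX : ∀ i, Admissible c₁ (X i)) {e k : ℕ} (he : k + e = 1)
    {f : ι → ℕ → ℝ} {w : ι → ℝ} (hf : ∀ i s, 0 ≤ f i s) (hw : ∀ i, 0 ≤ w i)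
    {u : ι → E' n → ℝ} (su : ∀ i, Sm (u i)) (hu : ∀ i j, sobNorm j (u i) ≤ f i j) (d : ℕ) :
    Graded 2 (dataWeight X e f w) d k u := by
  obtain ⟨C, hC⟩ := one_le_metWeight hn hX
  refine Graded.of_iteratedFDeriv su (fun j => ⟨C, fun i => ?_⟩) d
  calc eLpNorm (iteratedFDeriv ℝ j (u i)) 2 (ballMeas n)
      ≤ 1 * ENNReal.ofReal (f i j) := by
        rw [one_mul]
        exact (eLpNorm_iteratedFDeriv_le_sobNorm (su i) j).trans
          (ENNReal.ofReal_le_ofReal (hu i j))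
    _ ≤ C * metWeight X i 0 * ENNReal.ofReal (f i j) := mul_le_mul' (hC i) le_rfl
    _ ≤ _ := by
        rw [mul_assoc, metWeight, ← ENNReal.ofReal_mul (metNorm_nonneg _ _)]
        refine mul_le_mul' le_rfl (ENNReal.ofReal_le_ofReal ?_)
        refine le_add_of_le_of_nonneg ?_ (mul_nonneg (metNorm_nonneg _ _) (hw i))
        have h := Finset.single_le_sum
          (f := fun s => metNorm (X i) (k + j + e - 1 - s) * f i s)
          (fun s _ => mul_nonneg (metNorm_nonneg _ _) (hf i s))
          (Finset.mem_range.2 (show j < k + j + e by omega))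
        simpa only [show k + j + e - 1 - j = 0 by omega] using h

/-- Functions whose `L²` norm is controlled by the additional number. -/
lemma graded_one_of_sobNorm_le (hn : 0 < n) (hX : ∀ i, Admissible c₁ (X i)) {e : ℕ}
    {f : ι → ℕ → ℝ} {w : ι → ℝ} (hf : ∀ i s, 0 ≤ f i s)
    {u : ι → E' n → ℝ} (su : ∀ i, Sm (u i)) (hu : ∀ i, sobNorm 0 (u i) ≤ w i) :
    Graded 2 (dataWeight X e f w) 1 0 u := by
  obtain ⟨C, hC⟩ := one_le_metWeight hn hX
  refine ⟨⟨C, fun i => ?_⟩, fun _ => trivial⟩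
  calc eLpNorm (u i) 2 (ballMeas n)
      ≤ 1 * ENNReal.ofReal (w i) := by
        rw [one_mul]
        refine le_trans (le_of_eq ?_) ((eLpNorm_iteratedFDeriv_le_sobNorm (su i) 0).trans
          (ENNReal.ofReal_le_ofReal (hu i)))
        exact (eLpNorm_congr_norm_ae
          (Filter.Eventually.of_forall fun y => norm_iteratedFDeriv_zero)).symm
    _ ≤ C * metWeight X i 0 * ENNReal.ofReal (w i) := mul_le_mul' (hC i) le_rfl
    _ ≤ _ := by
        rw [mul_assoc, metWeight, ← ENNReal.ofReal_mul (metNorm_nonneg _ _)]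
        exact mul_le_mul' le_rfl (ENNReal.ofReal_le_ofReal (le_add_of_nonneg_left
          (Finset.sum_nonneg fun s _ => mul_nonneg (metNorm_nonneg _ _) (hf i s))))

end MetricWeights

section Density

variable {x : E' n → E' n} {c₁ : ℝ}

/-- A bound for the Jacobian determinant and its inverse. -/
def detBound (n : ℕ) (c₁ : ℝ) : ℝ := n.factorial * |c₁| ^ n + 1

lemma detBound_pos (n : ℕ) (c₁ : ℝ) : 0 < detBound n c₁ := by
  unfold detBound
  positivity

/-- `σ` is the sign of the Jacobian determinant `κ` on the ball, and `e` extends `1 / |κ|`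
smoothly. -/
structure Density (x : E' n → E' n) (B σ : ℝ) (e : E' n → ℝ) : Prop where
  sign : σ * σ = 1
  smooth : Sm e
  pos : ∀ y, 0 < e y
  inv : ∀ y ∈ Ball n, e y * (σ * kappa x y) = 1
  le : ∀ y ∈ Ball n, e y ≤ B

lemma sm_kappa (hx : ContDiff ℝ (⊤ : ℕ∞) x) : Sm (kappa x) := by
  have : kappa x = fun y => ∑ τ : Equiv.Perm (Fin n),
      (Equiv.Perm.sign τ : ℝ) * ∏ i, jacM x y (τ i) i := by
    funext y
    simp [kappa, Matrix.det_apply']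
  rw [this]
  exact Sm.sum fun τ _ => (Sm.const _).mul (contDiff_prod fun i _ => sm_jacM hx (τ i) i)

lemma abs_det_le_detBound {M : Matrix (Fin n) (Fin n) ℝ}
    (h : ∑ i, ∑ a, M i a ^ 2 ≤ c₁ ^ 2) : |M.det| ≤ detBound n c₁ := by
  have := Matrix.det_le (A := M) (abv := AbsoluteValue.abs) (x := |c₁|)
    (abs_le_of_sum_sq_le h)
  simp only [AbsoluteValue.abs_apply, Fintype.card_fin, nsmul_eq_mul] at this
  unfold detBound
  linarith

lemma Admissible.exists_density (hx : Admissible c₁ x) :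
    ∃ σ e, Density x (detBound n c₁) σ e := by
  have hB := detBound_pos n c₁
  have hki : ∀ y ∈ Ball n, |(kappa x y)⁻¹| ≤ detBound n c₁ := fun y hy => by
    have := abs_det_le_detBound (hx.sq_inv_jacM_le hy)
    rwa [Matrix.det_nonsing_inv, Ring.inverse_eq_inv'] at this
  have hpre : IsPreconnected (Ball n) := (convex_closedBall _ _).isPreconnected
  have h0 : (0 : E' n) ∈ Ball n := by simp [Ball]
  have hne : ∀ y ∈ Ball n, kappa x y ≠ 0 := hx.det_ne
  have hsign : ∃ σ : ℝ, σ * σ = 1 ∧ ∀ y ∈ Ball n, 0 < σ * kappa x y := by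
    have hcont : ContinuousOn (kappa x) (Ball n) := (sm_kappa hx.smooth).continuous.continuousOn
    rcases lt_or_gt_of_ne (hne 0 h0) with h | h
    · refine ⟨-1, by norm_num, fun y hy => ?_⟩
      by_contra! hc
      obtain ⟨z, hz, hz0⟩ := hpre.intermediate_value h0 hy hcont
        (show (0 : ℝ) ∈ Icc (kappa x 0) (kappa x y) from ⟨h.le, by linarith⟩)
      exact hne z hz hz0
    · refine ⟨1, by norm_num, fun y hy => ?_⟩
      by_contra! hc
      obtain ⟨z, hz, hz0⟩ := hpre.intermediate_value hy h0 hcont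
        (show (0 : ℝ) ∈ Icc (kappa x y) (kappa x 0) from ⟨by linarith, h.le⟩)
      exact hne z hz hz0
  obtain ⟨σ, hσ, hpos⟩ := hsign
  have hσ1 : |σ| = 1 := by
    rw [← Real.sqrt_sq_eq_abs, sq, hσ, Real.sqrt_one]
  have habs : ∀ y ∈ Ball n, σ * kappa x y = |kappa x y| := fun y hy => by
    rw [← abs_of_pos (hpos y hy), abs_mul, hσ1, one_mul]
  obtain ⟨e, se, pe, he⟩ := exists_smooth_recip (D := fun y => σ * kappa x y)
    ((Sm.const σ).mul (sm_kappa hx.smooth)) (inv_pos.2 hB)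
  have hlow : ∀ y ∈ Ball n, (detBound n c₁)⁻¹ ≤ σ * kappa x y := fun y hy => by
    have := hki y hy
    rw [abs_inv, ← habs y hy] at this
    exact inv_le_of_inv_le₀ (hpos y hy) this
  refine ⟨σ, e, hσ, se, pe, fun y hy => he y (hlow y hy), fun y hy => ?_⟩
  have h1 := he y (hlow y hy)
  have h2 := hki y hy
  rw [abs_inv, ← habs y hy] at h2
  rwa [eq_inv_of_mul_eq_one_left h1]

lemma det_gMet (x : E' n → E' n) (y : E' n) : (gMet x y).det = kappa x y ^ 2 := by
  simp [gMet, kappa, sq]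

variable {B σ : ℝ} {e : E' n → ℝ}

lemma Density.sq_mul_det (he : Density x B σ e) {y : E' n} (hy : y ∈ Ball n) :
    e y ^ 2 * (gMet x y).det = 1 := by
  rw [det_gMet]
  linear_combination (e y * σ * kappa x y + 1) * he.inv y hy -
    e y ^ 2 * kappa x y ^ 2 * he.sign

/-- The coefficient matrix `|κ| g⁻¹` of the divergence form operator. -/
def fluxMat (x : E' n → E' n) (e : E' n → ℝ) (a b : Fin n) (y : E' n) : ℝ :=
  e y * (gMet x y).adjugate a b

lemma Density.inv_gMet_apply (he : Density x B σ e) {y : E' n} (hy : y ∈ Ball n) (a b : Fin n) :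
    (gMet x y)⁻¹ a b = e y * fluxMat x e a b y := by
  have h : ((gMet x y).det)⁻¹ = e y ^ 2 :=
    (eq_inv_of_mul_eq_one_left (he.sq_mul_det hy)).symm
  rw [Matrix.inv_def, Ring.inverse_eq_inv', h, Matrix.smul_apply, fluxMat, smul_eq_mul]
  ring

lemma Density.kappa_mul_inv_gMet (he : Density x B σ e) {y : E' n} (hy : y ∈ Ball n)
    (a b : Fin n) : kappa x y * (gMet x y)⁻¹ a b = σ * fluxMat x e a b y := by
  rw [he.inv_gMet_apply hy]
  linear_combination σ * fluxMat x e a b y * he.inv y hy -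
    kappa x y * e y * fluxMat x e a b y * he.sign

lemma Density.inv_kappa (he : Density x B σ e) {y : E' n} (hy : y ∈ Ball n) :
    (kappa x y)⁻¹ = σ * e y :=
  inv_eq_of_mul_eq_one_left (by linear_combination he.inv y hy)

/-- Recovering a covector from its image under the inverse metric. -/
lemma Density.sum_gMet_mul (he : Density x B σ e) {y : E' n} (hy : y ∈ Ball n) (ξ : Fin n → ℝ)
    (b : Fin n) : ∑ a, gMet x y b a * ∑ c, (gMet x y)⁻¹ a c * ξ c = ξ b := by
  have hu : IsUnit (gMet x y).det := by
    refine isUnit_iff_ne_zero.2 fun h => ?_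
    have := he.sq_mul_det hy
    rw [h, mul_zero] at this
    exact zero_ne_one this
  have h := congrFun (congrArg (fun M => M.mulVec ξ) (Matrix.mul_nonsing_inv _ hu)) b
  simp only [Matrix.one_mulVec, ← Matrix.mulVec_mulVec] at h
  exact h

lemma Density.elliptic (hx : Admissible c₁ x) (he : Density x (detBound n c₁) σ e) {y : E' n}
    (hy : y ∈ Ball n) (ξ : Fin n → ℝ) :
    (detBound n c₁ * (c₁ ^ 2 + 1))⁻¹ * ∑ a, ξ a ^ 2 ≤
      ∑ a, ∑ b, fluxMat x e a b y * ξ a * ξ b := by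
  have hB := detBound_pos n c₁
  set J := jacM x y with hJ
  have hJu : IsUnit J.det := isUnit_iff_ne_zero.2 (hx.det_ne y hy)
  set η : Fin n → ℝ := fun i => ∑ a, J⁻¹ a i * ξ a with hη
  have hξ : ∀ a, ξ a = ∑ i, J i a * η i := by
    intro a
    have h := congrFun (congrArg (fun M => M.vecMul ξ) (Matrix.nonsing_inv_mul J hJu)) a
    simp only [Matrix.vecMul_one, ← Matrix.vecMul_vecMul] at h
    rw [← h]
    simp [Matrix.vecMul, dotProduct, hη, mul_comm]
  have h1 : ∑ a, ξ a ^ 2 ≤ (c₁ ^ 2 + 1) * ∑ i, η i ^ 2 := by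
    calc ∑ a, ξ a ^ 2 ≤ ∑ a, (∑ i, J i a ^ 2) * ∑ i, η i ^ 2 := by
          refine Finset.sum_le_sum fun a _ => ?_
          rw [hξ a]
          exact Finset.sum_mul_sq_le_sq_mul_sq _ _ _
      _ = (∑ i, ∑ a, J i a ^ 2) * ∑ i, η i ^ 2 := by
          rw [← Finset.sum_mul, Finset.sum_comm]
      _ ≤ _ := by
          gcongr
          linarith [hx.sq_jacM_le hy]
  have h2 : ∑ a, ∑ b, (gMet x y)⁻¹ a b * ξ a * ξ b = ∑ i, η i ^ 2 := by
    have h3 : (gMet x y)⁻¹ = J⁻¹ * J⁻¹ᵀ := by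
      rw [gMet, Matrix.mul_inv_rev, Matrix.transpose_nonsing_inv]
    have h4 : ∀ i, η i ^ 2 = ∑ a, ∑ b, J⁻¹ a i * J⁻¹ b i * ξ a * ξ b := fun i => by
      rw [sq, hη, Finset.sum_mul_sum]
      exact Finset.sum_congr rfl fun a _ => Finset.sum_congr rfl fun b _ => by ring
    simp only [h3, h4, Matrix.mul_apply, Matrix.transpose_apply, Finset.sum_mul]
    rw [Finset.sum_comm (γ := Fin n) (s := Finset.univ) (t := Finset.univ)
      (f := fun i a => ∑ b, J⁻¹ a i * J⁻¹ b i * ξ a * ξ b)]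
    exact Finset.sum_congr rfl fun a _ => Finset.sum_comm
  have hk0 : (detBound n c₁)⁻¹ ≤ σ * kappa x y := by
    rw [eq_inv_of_mul_eq_one_right (he.inv y hy)]
    exact inv_anti₀ (he.pos y) (he.le y hy)
  have h4 : ∑ a, ∑ b, fluxMat x e a b y * ξ a * ξ b = σ * kappa x y * ∑ i, η i ^ 2 := by
    rw [← h2, Finset.mul_sum]
    refine Finset.sum_congr rfl fun a _ => ?_
    rw [Finset.mul_sum]
    refine Finset.sum_congr rfl fun b _ => ?_
    linear_combination (-σ * ξ a * ξ b) * he.kappa_mul_inv_gMet hy a b -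
      fluxMat x e a b y * ξ a * ξ b * he.sign
  rw [h4, mul_inv, mul_assoc]
  refine mul_le_mul hk0 ?_ (by positivity) ((inv_nonneg.2 hB.le).trans hk0)
  rwa [inv_mul_le_iff₀ (by positivity)]

end Density

section MetricFamily

variable {ι : Type*} {N : ι → ℕ → ℝ≥0∞} {d : ℕ}

lemma SmGraded.prod (hN : Weights N N) {κ : Type*} (t : Finset κ) {w : κ → ι → E' n → ℝ}
    (hw : ∀ c, SmGraded ∞ N d 0 (w c)) : SmGraded ∞ N d 0 (fun i y => ∏ c ∈ t, w c i y) := by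
  classical
  induction t using Finset.induction_on with
  | empty => simpa using SmGraded.fixed hN (Sm.const 1)
  | insert c t hc ih =>
    simp only [Finset.prod_insert hc]
    exact SmGraded.mul hN (hw c) ih

lemma SmGraded.det (hN : Weights N N) {M : ι → E' n → Matrix (Fin n) (Fin n) ℝ}
    (hM : ∀ a b, SmGraded ∞ N d 0 (fun i y => M i y a b)) :
    SmGraded ∞ N d 0 (fun i y => (M i y).det) := by
  simp only [Matrix.det_apply']
  exact SmGraded.sum fun τ => SmGraded.smul hN hN (Sm.const _)
    (SmGraded.prod hN _ fun c => hM (τ c) c)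

lemma SmGraded.adjugate (hN : Weights N N) {M : ι → E' n → Matrix (Fin n) (Fin n) ℝ}
    (hM : ∀ a b, SmGraded ∞ N d 0 (fun i y => M i y a b)) (a b : Fin n) :
    SmGraded ∞ N d 0 (fun i y => (M i y).adjugate a b) := by
  simp only [Matrix.adjugate_apply]
  refine SmGraded.det hN fun c c' => ?_
  by_cases h : c = b
  · subst h
    simpa using SmGraded.fixed hN (Sm.const _)
  · simpa [Matrix.updateRow_ne h] using hM c c'

variable {X : ι → E' n → E' n} {c₁ : ℝ} {σ : ι → ℝ} {e : ι → E' n → ℝ}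

lemma graded_density (hn : 0 < n) (hX : ∀ i, Admissible c₁ (X i))
    (he : ∀ i, Density (X i) (detBound n c₁) (σ i) (e i)) (d : ℕ) :
    SmGraded ∞ (metWeight X) d 0 e := by
  have hN := weights_metWeight hn hX
  have se : ∀ i, Sm (e i) := fun i => (he i).smooth
  have hD : ∀ d, SmGraded ∞ (metWeight X) d 0 (fun i y => (gMet (X i) y).det) := fun d =>
    SmGraded.det hN fun a b => graded_gMet hX a b d
  refine ⟨se, Graded.of_bootstrap hN (M := detBound n c₁) (fun i y hy => ?_)
    (fun d hd a => ?_) d⟩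
  · rw [abs_of_pos ((he i).pos y)]
    exact (he i).le y (Metric.ball_subset_closedBall hy)
  · have h1 : SmGraded ∞ (metWeight X) d 0 e := ⟨se, hd⟩
    have h2 : SmGraded ∞ (metWeight X) d 1 (fun i => pd a (fun y => (gMet (X i) y).det)) :=
      ⟨fun i => ((hD 0).smooth i).pd a, (hD (d + 1)).graded.2 a⟩
    refine (SmGraded.smul hN hN (Sm.const (-1 / 2))
      (h1.mul hN (h1.mul hN (h1.mul hN h2)))).graded.congr fun i y hy => ?_
    have h3 := pd_eqOn_ball (u := fun y => (e i y * e i y) * (gMet (X i) y).det)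
      (v := fun _ => 1) (fun z hz => by
        simpa [sq] using (he i).sq_mul_det (Metric.ball_subset_closedBall hz)) a hy
    rw [pd_mul ((se i).mul (se i)) ((hD 0).smooth i), pd_mul (se i) (se i), pd_const] at h3
    have h4 := (he i).sq_mul_det (Metric.ball_subset_closedBall hy)
    linear_combination (-(e i y / 2)) * h3 + pd a (e i) y * h4

lemma graded_fluxMat (hn : 0 < n) (hX : ∀ i, Admissible c₁ (X i))
    (he : ∀ i, Density (X i) (detBound n c₁) (σ i) (e i)) (a b : Fin n) (d : ℕ) :
    SmGraded ∞ (metWeight X) d 0 (fun i => fluxMat (X i) (e i) a b) :=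
  (graded_density hn hX he d).mul (weights_metWeight hn hX)
    (SmGraded.adjugate (weights_metWeight hn hX) (fun a b => graded_gMet hX a b d) a b)

/-- A smooth family agreeing with `|κ|` on the ball. -/
lemma graded_kappa (hn : 0 < n) (hX : ∀ i, Admissible c₁ (X i))
    (he : ∀ i, Density (X i) (detBound n c₁) (σ i) (e i)) (d : ℕ) :
    SmGraded ∞ (metWeight X) d 0 (fun i y => e i y * (gMet (X i) y).det) :=
  (graded_density hn hX he d).mul (weights_metWeight hn hX)
    (SmGraded.det (weights_metWeight hn hX) fun a b => graded_gMet hX a b d)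

lemma Density.mul_det {x : E' n → E' n} {B σ : ℝ} {e : E' n → ℝ} (he : Density x B σ e)
    {y : E' n} (hy : y ∈ Ball n) : e y * (gMet x y).det = σ * kappa x y := by
  rw [det_gMet]
  linear_combination (σ * kappa x y) * he.inv y hy - e y * kappa x y ^ 2 * he.sign

lemma ellipticFamily_fluxMat (hn : 0 < n) (hX : ∀ i, Admissible c₁ (X i))
    (he : ∀ i, Density (X i) (detBound n c₁) (σ i) (e i)) :
    EllipticFamily (metWeight X) (fun a b i => fluxMat (X i) (e i) a b)
      (detBound n c₁ * (c₁ ^ 2 + 1))⁻¹ where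
  smooth a b := (graded_fluxMat hn hX he a b 0).smooth
  graded a b d := (graded_fluxMat hn hX he a b d).graded
  pos := by
    have := detBound_pos n c₁
    positivity
  elliptic i _ hy ξ := (he i).elliptic (hX i) hy ξ

end MetricFamily

section GradientEstimates

/-- The gradient of a function with respect to the metric. -/
def gradMet (x : E' n → E' n) (q : E' n → ℝ) (y : E' n) (a : Fin n) : ℝ :=
  ∑ b, (gMet x y)⁻¹ a b * pd b q y

/-- The flux `|κ| g⁻¹ ∂q`. -/
def fluxVec (x : E' n → E' n) (e q : E' n → ℝ) (a : Fin n) (y : E' n) : ℝ :=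
  ∑ b, fluxMat x e a b y * pd b q y

variable {x : E' n → E' n} {B s : ℝ} {ρ : E' n → ℝ}

lemma Density.gradMet_eq (he : Density x B s ρ) (q : E' n → ℝ) {y : E' n} (hy : y ∈ Ball n)
    (a : Fin n) : gradMet x q y a = ρ y * fluxVec x ρ q a y := by
  simp only [gradMet, fluxVec, he.inv_gMet_apply hy, Finset.mul_sum, mul_assoc]

lemma Density.divergence_eq (he : Density x B s ρ) {V Z : Fin n → E' n → ℝ}
    (sV : ∀ a, Sm (V a)) (hZ : ∀ a, ∀ y ∈ Ball n, Z a y = s * V a y) {y : E' n}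
    (hy : y ∈ Metric.ball (0 : E' n) 1) :
    (kappa x y)⁻¹ * ∑ a, pd a (Z a) y = ρ y * fieldDiv V y := by
  have h : ∀ a, pd a (Z a) y = s * pd a (V a) y := fun a => by
    have h1 := pd_eqOn_ball (u := Z a) (v := fun z => s * V a z)
      (fun z hz => hZ a z (Metric.ball_subset_closedBall hz)) a hy
    rw [h1, pd_mul (Sm.const s) (sV a), pd_const]
    ring
  simp only [h, ← Finset.mul_sum, he.inv_kappa (Metric.ball_subset_closedBall hy), fieldDiv]
  linear_combination (ρ y * ∑ a, pd a (V a) y) * he.sign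

lemma Density.lapl_eq (he : Density x B s ρ) {q : E' n → ℝ} (sV : ∀ a, Sm (fluxVec x ρ q a))
    {y : E' n} (hy : y ∈ Metric.ball (0 : E' n) 1) :
    lapl x q y = ρ y * fieldDiv (fluxVec x ρ q) y := by
  refine he.divergence_eq sV (fun a z hz => ?_) hy
  simp only [fluxVec, Finset.mul_sum]
  exact Finset.sum_congr rfl fun b _ => by
    rw [← mul_assoc, he.kappa_mul_inv_gMet hz, mul_assoc]

lemma Density.divL_eq (he : Density x B s ρ) {U : E' n → Fin n → ℝ}
    (sV : ∀ a, Sm (fun y => ρ y * (gMet x y).det * U y a)) {y : E' n}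
    (hy : y ∈ Metric.ball (0 : E' n) 1) :
    divL x U y = ρ y * fieldDiv (fun a z => ρ z * (gMet x z).det * U z a) y := by
  refine he.divergence_eq sV (fun a z hz => ?_) hy
  rw [he.mul_det hz]
  linear_combination -(kappa x z * U z a) * he.sign

variable {ι : Type*} {R : ι → ℕ → ℝ≥0∞} {X : ι → E' n → E' n} {c₁ : ℝ} {σ : ι → ℝ}
  {e q : ι → E' n → ℝ}

lemma exists_sobNorm_vec_le (hR : ∀ k, ∃ C : ℝ≥0, ∀ i, R i k ≤ C * R i (k + 1)) {r : ℕ}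
    {U : ι → E' n → Fin n → ℝ} (hU : ∀ a, SmGraded 2 R (r + 1) 0 (fun i y => U i y a)) :
    ∃ C : ℝ≥0, ∀ i, ENNReal.ofReal (sobNorm r (U i)) ≤ C * R i r := by
  choose C hC using fun a => (hU a).graded.exists_sobNorm_le hR (hU a).smooth
  refine ⟨∑ a, C a, fun i => ?_⟩
  calc ENNReal.ofReal (sobNorm r (U i))
      ≤ ∑ a, ENNReal.ofReal (sobNorm r (fun y => U i y a)) := by
        rw [← ENNReal.ofReal_sum_of_nonneg fun _ _ => sobNorm_nonneg _ _]
        exact ENNReal.ofReal_le_ofReal (sobNorm_le_sum_component (fun a => (hU a).smooth i) r)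
    _ ≤ ∑ a, C a * R i r := Finset.sum_le_sum fun a _ => hC a i
    _ = _ := by rw [← Finset.sum_mul]; push_cast; rfl

lemma graded_fluxVec (hn : 0 < n) (hX : ∀ i, Admissible c₁ (X i))
    (he : ∀ i, Density (X i) (detBound n c₁) (σ i) (e i))
    (hR : Weights (metWeight X) R) {d : ℕ}
    (hq : ∀ b, SmGraded 2 R d 0 (fun i => pd b (q i))) (a : Fin n) :
    SmGraded 2 R d 0 (fun i => fluxVec (X i) (e i) (q i) a) :=
  SmGraded.sum fun b => (graded_fluxMat hn hX he a b d).mul hR (hq b)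

lemma sm_fluxVec (hn : 0 < n) (hX : ∀ i, Admissible c₁ (X i))
    (he : ∀ i, Density (X i) (detBound n c₁) (σ i) (e i))
    (sq : ∀ i, Sm (q i)) (a : Fin n) (i : ι) :
    Sm (fluxVec (X i) (e i) (q i) a) :=
  Sm.sum fun b _ => ((graded_fluxMat hn hX he a b 0).smooth i).mul ((sq i).pd b)

/-- The energy estimate as a base case of the regularity theory. -/
lemma graded_one_of_fieldDiv (hn : 0 < n) (hX : ∀ i, Admissible c₁ (X i))
    (he : ∀ i, Density (X i) (detBound n c₁) (σ i) (e i))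
    {V : Fin n → ι → E' n → ℝ} (sq : ∀ i, Sm (q i))
    (sV : ∀ a i, Sm (V a i)) (h0 : ∀ i, ∀ y ∈ Sphere' n, q i y = 0)
    (hF : ∀ a, Graded 2 R 1 0 (fluxDefect (fun a b i => fluxMat (X i) (e i) a b) q V a))
    (hV : Graded 2 R 1 0 (fun i => fieldDiv (fun a => V a i))) (b : Fin n) :
    Graded 2 R 1 0 (fun i => pd b (q i)) :=
  energy_family (ellipticFamily_fluxMat hn hX he) hn (tangentField_radial ⟨0, hn⟩) sq
    (f₀ := fun _ _ => 0) (f₁ := fun i => fieldDiv (fun a => V a i)) (fun _ => Sm.const 0)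
    (fun i => Sm.sum fun a _ => (sV a i).pd a) sV h0
    (fun i y _ => by simp [fieldDeriv, pd_const]) hF Graded.zero hV b

lemma graded_pd_of_lapl (hn : 0 < n) (hX : ∀ i, Admissible c₁ (X i))
    (he : ∀ i, Density (X i) (detBound n c₁) (σ i) (e i))
    (hR : Weights (metWeight X) R) (sq : ∀ i, Sm (q i))
    (h0 : ∀ i, ∀ y ∈ Sphere' n, q i y = 0)
    (hb : ∀ b, Graded 2 R 1 0 (fun i => pd b (q i)))
    (hV : ∀ d, Graded 2 R d 1 (fun i => fieldDiv (fluxVec (X i) (e i) (q i)))) (d : ℕ)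
    (b : Fin n) : SmGraded 2 R (d + 1) 0 (fun i => pd b (q i)) := by
  refine ⟨fun i => (sq i).pd b, ?_⟩
  refine DirichletData.graded_all (weights_metWeight hn hX) hR (ellipticFamily_fluxMat hn hX he)
    hn (V := fun a i => fluxVec (X i) (e i) (q i) a) sq (fun a i => sm_fluxVec hn hX he sq a i)
    h0 hb (fun d a => ?_) hV d b
  exact Graded.zero.congr fun i y _ => by simp [fluxDefect, fluxVec]

lemma graded_fieldDiv_flux (hn : 0 < n) (hX : ∀ i, Admissible c₁ (X i))
    (he : ∀ i, Density (X i) (detBound n c₁) (σ i) (e i))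
    {d k : ℕ} (hR : Weights (metWeight X) R) (sq : ∀ i, Sm (q i))
    (hL : Graded 2 R d k (fun i y => e i y * fieldDiv (fluxVec (X i) (e i) (q i)) y)) :
    Graded 2 R d k (fun i => fieldDiv (fluxVec (X i) (e i) (q i))) := by
  have sL : ∀ i, Sm (fun y => e i y * fieldDiv (fluxVec (X i) (e i) (q i)) y) := fun i =>
    (he i).smooth.mul (Sm.sum fun a _ => (sm_fluxVec hn hX he sq a i).pd a)
  refine ((graded_kappa hn hX he d).mul hR ⟨sL, hL⟩).graded.congr fun i y hy => ?_
  linear_combination fieldDiv (fluxVec (X i) (e i) (q i)) y *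
    (he i).sq_mul_det (Metric.ball_subset_closedBall hy)

lemma exists_sobNorm_gradMet_le (hn : 0 < n) (hX : ∀ i, Admissible c₁ (X i))
    (he : ∀ i, Density (X i) (detBound n c₁) (σ i) (e i))
    (hR : Weights (metWeight X) R) {r : ℕ}
    (hq : ∀ b, SmGraded 2 R (r + 1) 0 (fun i => pd b (q i))) :
    ∃ C : ℝ≥0, ∀ i, ENNReal.ofReal (sobNorm r (gradMet (X i) (q i))) ≤ C * R i r := by
  obtain ⟨C, hC⟩ := exists_sobNorm_vec_le hR.mono
    (U := fun i y a => e i y * fluxVec (X i) (e i) (q i) a y) fun a =>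
      (graded_density hn hX he _).mul hR (graded_fluxVec hn hX he hR hq a)
  refine ⟨C, fun i => le_trans (le_of_eq ?_) (hC i)⟩
  congr 1
  exact sobNorm_congr (fun y hy => funext fun a =>
    (he i).gradMet_eq (q i) (Metric.ball_subset_closedBall hy) a) r

end GradientEstimates

section TameEstimates

variable {ι : Type*} {X : ι → E' n → E' n} {c₁ : ℝ} {σ : ι → ℝ} {e q : ι → E' n → ℝ}

/-- The norms of the Laplacians of a family of functions. -/
def laplNorm (X : ι → E' n → E' n) (q : ι → E' n → ℝ) (i : ι) (s : ℕ) : ℝ :=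
  sobNorm s (lapl (X i) (q i))

lemma sobNorm_flux_eq (hn : 0 < n) (hX : ∀ i, Admissible c₁ (X i))
    (he : ∀ i, Density (X i) (detBound n c₁) (σ i) (e i)) (sq : ∀ i, Sm (q i)) (i : ι) (s : ℕ) :
    sobNorm s (fun y => e i y * fieldDiv (fluxVec (X i) (e i) (q i)) y) = laplNorm X q i s :=
  sobNorm_congr (fun _ hy => ((he i).lapl_eq (fun a => sm_fluxVec hn hX he sq a i) hy).symm) s

lemma sm_mul_fieldDiv_flux (hn : 0 < n) (hX : ∀ i, Admissible c₁ (X i))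
    (he : ∀ i, Density (X i) (detBound n c₁) (σ i) (e i)) (sq : ∀ i, Sm (q i)) (i : ι) :
    Sm (fun y => e i y * fieldDiv (fluxVec (X i) (e i) (q i)) y) :=
  (he i).smooth.mul (Sm.sum fun a _ => (sm_fluxVec hn hX he sq a i).pd a)

lemma graded_fieldDiv_flux_of_lapl (hn : 0 < n) (hX : ∀ i, Admissible c₁ (X i))
    (he : ∀ i, Density (X i) (detBound n c₁) (σ i) (e i)) (sq : ∀ i, Sm (q i)) {w : ι → ℝ}
    (hw : ∀ i, 0 ≤ w i) (d : ℕ) :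
    Graded 2 (dataWeight X 0 (laplNorm X q) w) d 1
      (fun i => fieldDiv (fluxVec (X i) (e i) (q i))) := by
  have hf : ∀ i s, 0 ≤ laplNorm X q i s := fun _ _ => sobNorm_nonneg _ _
  refine graded_fieldDiv_flux hn hX he (weights_dataWeight hn hX 0 hf hw) sq ?_
  exact graded_of_sobNorm_le hn hX (k := 1) (e := 0) rfl hf hw
    (sm_mul_fieldDiv_flux hn hX he sq) (fun i s => (sobNorm_flux_eq hn hX he sq i s).le) d

/-- The gradient is recovered from the metric gradient. -/
lemma graded_one_of_gradMet (hn : 0 < n) (hX : ∀ i, Admissible c₁ (X i))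
    (he : ∀ i, Density (X i) (detBound n c₁) (σ i) (e i)) (sq : ∀ i, Sm (q i))
    {f : ι → ℕ → ℝ} (hf : ∀ i s, 0 ≤ f i s) (b : Fin n) :
    Graded 2 (dataWeight X 0 f (fun i => sobNorm 0 (gradMet (X i) (q i)))) 1 0
      (fun i => pd b (q i)) := by
  have hR := weights_dataWeight hn hX 0 hf
    (w := fun i => sobNorm 0 (gradMet (X i) (q i))) fun _ => sobNorm_nonneg _ _
  have sW : ∀ a i, Sm (fun y => e i y * fluxVec (X i) (e i) (q i) a y) := fun a i =>
    (he i).smooth.mul (sm_fluxVec hn hX he sq a i)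
  have hW : ∀ i, EqOn (fun y a => e i y * fluxVec (X i) (e i) (q i) a y) (gradMet (X i) (q i))
      (Metric.ball 0 1) := fun i y hy => funext fun a =>
    ((he i).gradMet_eq (q i) (Metric.ball_subset_closedBall hy) a).symm
  have h : ∀ a, SmGraded 2 (dataWeight X 0 f (fun i => sobNorm 0 (gradMet (X i) (q i)))) 1 0
      (fun i y => e i y * fluxVec (X i) (e i) (q i) a y) := fun a =>
    ⟨sW a, graded_one_of_sobNorm_le hn hX hf (sW a) fun i =>
      (sobNorm_component_le (fun a => sW a i) a 0).trans (sobNorm_congr (hW i) 0).le⟩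
  refine (SmGraded.sum (t := Finset.univ) fun a =>
    (graded_gMet hX b a 1).mul hR (h a)).graded.congr fun i y hy => ?_
  have hy' : y ∈ Ball n := Metric.ball_subset_closedBall hy
  rw [← (he i).sum_gMet_mul hy' (fun c => pd c (q i) y) b]
  exact Finset.sum_congr rfl fun a _ => congrArg (gMet (X i) y b a * ·)
    ((he i).gradMet_eq (q i) hy' a).symm

/-- The base case obtained from the energy estimate for the Dirichlet problem. -/
lemma graded_one_of_lapl (hn : 0 < n) (hX : ∀ i, Admissible c₁ (X i))
    (he : ∀ i, Density (X i) (detBound n c₁) (σ i) (e i)) (sq : ∀ i, Sm (q i))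
    (h0 : ∀ i, ∀ y ∈ Sphere' n, q i y = 0) (b : Fin n) :
    Graded 2 (dataWeight X 0 (laplNorm X q) (fun i => laplNorm X q i 0)) 1 0
      (fun i => pd b (q i)) := by
  have hf : ∀ i s, 0 ≤ laplNorm X q i s := fun _ _ => sobNorm_nonneg _ _
  have hR := weights_dataWeight hn hX 0 hf (w := fun i => laplNorm X q i 0) fun _ => hf _ _
  refine graded_one_of_fieldDiv hn hX he (V := fun a i => fluxVec (X i) (e i) (q i) a) sq
    (fun a i => sm_fluxVec hn hX he sq a i) h0 (fun a => ?_) ?_ b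
  · exact Graded.zero.congr fun i y _ => by simp [fluxDefect, fluxVec]
  · exact graded_fieldDiv_flux hn hX he hR sq (graded_one_of_sobNorm_le hn hX hf
      (sm_mul_fieldDiv_flux hn hX he sq) fun i => (sobNorm_flux_eq hn hX he sq i 0).le)

lemma sobNorm_zero_eq_normL2 {u : E' n → ℝ} (hu : Sm u) : sobNorm 0 u = normL2 u := by
  rw [← ENNReal.toReal_ofReal (sobNorm_nonneg 0 u), ofReal_sobNorm hu,
    ← ENNReal.toReal_ofReal (normL2_nonneg u), ← eLpNorm_eq_normL2 hu]
  simp only [zero_add, Finset.sum_range_one]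
  exact congrArg _ (eLpNorm_congr_norm_ae
    (Filter.Eventually.of_forall fun y => norm_iteratedFDeriv_zero))

lemma sobNorm_zero_le_pd {u : E' n → ℝ} (hu : Sm u) (h0 : ∀ y ∈ Sphere' n, u y = 0)
    (a : Fin n) : sobNorm 0 u ≤ 2 * sobNorm 0 (pd a u) := by
  rw [sobNorm_zero_eq_normL2 hu, sobNorm_zero_eq_normL2 (hu.pd a)]
  exact normL2_le_normGrad hu h0 a

/-- Passing from all derivatives of first order to the full norm of one order more. -/
lemma exists_sobNorm_succ_le (hn : 0 < n) {R : ι → ℕ → ℝ≥0∞} {r : ℕ} (sq : ∀ i, Sm (q i))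
    (h0 : ∀ i, ∀ y ∈ Sphere' n, q i y = 0)
    (hR : ∀ k, ∃ C : ℝ≥0, ∀ i, R i k ≤ C * R i (k + 1))
    (hq : ∀ b, Graded 2 R (r + 1) 0 (fun i => pd b (q i))) :
    ∃ C : ℝ≥0, ∀ i, ENNReal.ofReal (sobNorm (r + 1) (q i)) ≤ C * R i r := by
  choose C hC using fun b => (hq b).exists_sobNorm_le hR (fun i => (sq i).pd b)
  refine ⟨2 * C ⟨0, hn⟩ + ∑ b, C b, fun i => ?_⟩
  have h1 : sobNorm 0 (q i) ≤ 2 * sobNorm r (pd ⟨0, hn⟩ (q i)) :=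
    (sobNorm_zero_le_pd (sq i) (h0 i) ⟨0, hn⟩).trans
      (mul_le_mul_of_nonneg_left (sobNorm_mono (Nat.zero_le r) _) zero_le_two)
  calc ENNReal.ofReal (sobNorm (r + 1) (q i))
      ≤ 2 * ENNReal.ofReal (sobNorm r (pd ⟨0, hn⟩ (q i)))
        + ∑ b, ENNReal.ofReal (sobNorm r (pd b (q i))) := by
        rw [← ENNReal.ofReal_sum_of_nonneg fun _ _ => sobNorm_nonneg _ _,
          ← ENNReal.ofReal_ofNat 2, ← ENNReal.ofReal_mul zero_le_two,
          ← ENNReal.ofReal_add (mul_nonneg zero_le_two (sobNorm_nonneg _ _))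
            (Finset.sum_nonneg fun _ _ => sobNorm_nonneg _ _)]
        exact ENNReal.ofReal_le_ofReal ((sobNorm_succ_le (sq i) r).trans (by gcongr))
    _ ≤ 2 * (C ⟨0, hn⟩ * R i r) + ∑ b, C b * R i r :=
        add_le_add (mul_le_mul' le_rfl (hC _ i)) (Finset.sum_le_sum fun b _ => hC b i)
    _ = _ := by
        rw [← Finset.sum_mul, ← mul_assoc, ← add_mul]
        push_cast
        rfl

/-- The gradient of the solution of `Δ p = div U` is controlled by `U`. -/
lemma graded_pd_of_divL {p : ι → E' n → ℝ} {U : ι → E' n → Fin n → ℝ} (hn : 0 < n)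
    (hX : ∀ i, Admissible c₁ (X i))
    (he : ∀ i, Density (X i) (detBound n c₁) (σ i) (e i)) (sp : ∀ i, Sm (p i))
    (sU : ∀ a i, Sm (fun y => U i y a)) (h0 : ∀ i, ∀ y ∈ Sphere' n, p i y = 0)
    (hp : ∀ i, ∀ y ∈ Ball n, lapl (X i) (p i) y = divL (X i) (U i) y) (d : ℕ) (b : Fin n) :
    SmGraded 2 (dataWeight X 1 (fun i s => sobNorm s (U i)) 0) (d + 1) 0
      (fun i => pd b (p i)) := by
  have hf : ∀ i s, 0 ≤ sobNorm s (U i) := fun _ _ => sobNorm_nonneg _ _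
  have hR := weights_dataWeight hn hX 1 hf (w := 0) fun _ => le_rfl
  have sF := fun a i => sm_fluxVec hn hX he sp a i
  have gU : ∀ d a, SmGraded 2 (dataWeight X 1 (fun i s => sobNorm s (U i)) 0) d 0
      (fun i y => e i y * (gMet (X i) y).det * U i y a) := fun d a =>
    (graded_kappa hn hX he d).mul hR ⟨sU a, graded_of_sobNorm_le hn hX rfl hf (fun _ => le_rfl)
      (sU a) (fun i j => sobNorm_component_le (fun a => sU a i) a j) d⟩
  have sV : ∀ a i, Sm (fun y => fluxVec (X i) (e i) (p i) a y
      - e i y * (gMet (X i) y).det * U i y a) := fun a i =>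
    (sF a i).sub ((gU 0 a).smooth i)
  have hF : ∀ d a, Graded 2 (dataWeight X 1 (fun i s => sobNorm s (U i)) 0) d 0
      (fluxDefect (fun a b i => fluxMat (X i) (e i) a b) p
        (fun a i y => fluxVec (X i) (e i) (p i) a y - e i y * (gMet (X i) y).det * U i y a) a) :=
    fun d a => (gU d a).graded.congr fun i y _ => by simp [fluxDefect, fluxVec]
  have hV : ∀ d k, Graded 2 (dataWeight X 1 (fun i s => sobNorm s (U i)) 0) d k
      (fun i => fieldDiv (fun a y => fluxVec (X i) (e i) (p i) a y
        - e i y * (gMet (X i) y).det * U i y a)) := fun d k =>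
    Graded.zero.congr fun i y hy => by
      have hy' : y ∈ Ball n := Metric.ball_subset_closedBall hy
      have h := hp i y hy'
      rw [(he i).lapl_eq (fun a => sF a i) hy, (he i).divL_eq (fun a => (gU 0 a).smooth i) hy] at h
      have h' := mul_left_cancel₀ ((he i).pos y).ne' h
      simp only [fieldDiv] at h' ⊢
      rw [← sub_eq_zero, ← Finset.sum_sub_distrib] at h'
      rw [← h']
      exact Finset.sum_congr rfl fun a _ => (pd_sub (sF a i) ((gU 0 a).smooth i) a y).symm
  exact ⟨fun i => (sp i).pd b, DirichletData.graded_all (weights_metWeight hn hX) hR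
    (ellipticFamily_fluxMat hn hX he) hn sp sV h0
    (fun b => graded_one_of_fieldDiv hn hX he sp sV h0 (hF 1) (hV 1 0) b) hF
    (fun d => hV d 1) d b⟩

end TameEstimates

section TameBounds

variable {c₁ : ℝ}

lemma le_of_ofReal_le_dataWeight {ι : Type*} {X : ι → E' n → E' n} {ε r : ℕ} {f : ι → ℕ → ℝ}
    {w : ι → ℝ} (hf : ∀ i s, 0 ≤ f i s) (hw : ∀ i, 0 ≤ w i) {t : ℝ} {C : ℝ≥0} {i : ι}
    (h : ENNReal.ofReal t ≤ C * dataWeight X ε f w i r) :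
    t ≤ C * (∑ s ∈ Finset.range (r + ε), metNorm (X i) (r + ε - 1 - s) * f i s +
      metNorm (X i) r * w i) := by
  rw [dataWeight, ← ENNReal.ofReal_coe_nnreal, ← ENNReal.ofReal_mul C.coe_nonneg] at h
  refine (ENNReal.ofReal_le_ofReal_iff (mul_nonneg C.coe_nonneg (add_nonneg
    (Finset.sum_nonneg fun s _ => mul_nonneg (metNorm_nonneg _ _) (hf i s))
    (mul_nonneg (metNorm_nonneg _ _) (hw i))))).1 h

/-- The metric gradient in terms of the Laplacian and its own `L²` norm. -/
theorem exists_sobNorm_gradMet_le_lapl_add (hn : 0 < n) (c₁ : ℝ) (r : ℕ) :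
    ∃ C : ℝ, 0 ≤ C ∧ ∀ x : E' n → E' n, Admissible c₁ x → ∀ q : E' n → ℝ, Sm q →
      (∀ y ∈ Sphere' n, q y = 0) → sobNorm r (gradMet x q) ≤
        C * (∑ s ∈ Finset.range r, metNorm x (r - 1 - s) * sobNorm s (lapl x q)
          + metNorm x r * sobNorm 0 (gradMet x q)) := by
  let ι := {z : (E' n → E' n) × (E' n → ℝ) //
    Admissible c₁ z.1 ∧ Sm z.2 ∧ ∀ y ∈ Sphere' n, z.2 y = 0}
  have hX : ∀ i : ι, Admissible c₁ i.1.1 := fun i => i.2.1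
  have sq : ∀ i : ι, Sm i.1.2 := fun i => i.2.2.1
  choose σ e he using fun i => (hX i).exists_density
  have hf : ∀ (i : ι) s, 0 ≤ laplNorm (fun i : ι => i.1.1) (fun i => i.1.2) i s :=
    fun _ _ => sobNorm_nonneg _ _
  have hw : ∀ i : ι, 0 ≤ sobNorm 0 (gradMet i.1.1 i.1.2) := fun _ => sobNorm_nonneg _ _
  have hR := weights_dataWeight hn hX 0 hf hw
  obtain ⟨C, hC⟩ := exists_sobNorm_gradMet_le hn hX he hR (r := r) fun b =>
    graded_pd_of_lapl hn hX he hR sq (fun i => i.2.2.2)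
      (graded_one_of_gradMet hn hX he sq hf) (graded_fieldDiv_flux_of_lapl hn hX he sq hw) r b
  refine ⟨C, C.coe_nonneg, fun x hx q hq h0 => ?_⟩
  have h1 := le_of_ofReal_le_dataWeight hf hw (hC ⟨(x, q), hx, hq, h0⟩)
  simpa only [laplNorm, Nat.add_zero] using h1

/-- The Dirichlet problem: metric gradient and solution in terms of the Laplacian. -/
theorem exists_sobNorm_le_lapl (hn : 0 < n) (c₁ : ℝ) {r : ℕ} (hr : 1 ≤ r) :
    ∃ C : ℝ, 0 ≤ C ∧ ∀ x : E' n → E' n, Admissible c₁ x → ∀ q : E' n → ℝ, Sm q →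
      (∀ y ∈ Sphere' n, q y = 0) → sobNorm r (gradMet x q) + sobNorm (r + 1) q ≤
        C * ∑ s ∈ Finset.range r, metNorm x (r - s) * sobNorm s (lapl x q) := by
  let ι := {z : (E' n → E' n) × (E' n → ℝ) //
    Admissible c₁ z.1 ∧ Sm z.2 ∧ ∀ y ∈ Sphere' n, z.2 y = 0}
  have hX : ∀ i : ι, Admissible c₁ i.1.1 := fun i => i.2.1
  have sq : ∀ i : ι, Sm i.1.2 := fun i => i.2.2.1
  choose σ e he using fun i => (hX i).exists_density
  have hf : ∀ (i : ι) s, 0 ≤ laplNorm (fun i : ι => i.1.1) (fun i => i.1.2) i s :=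
    fun _ _ => sobNorm_nonneg _ _
  have hw := fun i => hf i 0
  have hR := weights_dataWeight hn hX 0 hf hw
  have hq := fun b => graded_pd_of_lapl hn hX he hR sq (fun i => i.2.2.2)
    (graded_one_of_lapl hn hX he sq fun i => i.2.2.2)
    (graded_fieldDiv_flux_of_lapl hn hX he sq hw) r b
  obtain ⟨C, hC⟩ := exists_sobNorm_gradMet_le hn hX he hR hq
  obtain ⟨D, hD⟩ := exists_sobNorm_succ_le hn sq (fun i => i.2.2.2) hR.mono
    fun b => (hq b).graded
  refine ⟨(C + D) * 2, mul_nonneg (add_nonneg C.coe_nonneg D.coe_nonneg) zero_le_two,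
    fun x hx q hq h0 => ?_⟩
  have h1 := le_of_ofReal_le_dataWeight hf hw (hC ⟨(x, q), hx, hq, h0⟩)
  have h2 := le_of_ofReal_le_dataWeight hf hw (hD ⟨(x, q), hx, hq, h0⟩)
  simp only [laplNorm, Nat.add_zero] at h1 h2
  have hm : ∀ s, 0 ≤ metNorm x (r - s) * sobNorm s (lapl x q) := fun s =>
    mul_nonneg (metNorm_nonneg _ _) (sobNorm_nonneg _ _)
  have h3 : ∑ s ∈ Finset.range r, metNorm x (r - 1 - s) * sobNorm s (lapl x q) ≤
      ∑ s ∈ Finset.range r, metNorm x (r - s) * sobNorm s (lapl x q) := by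
    refine Finset.sum_le_sum fun s hs => mul_le_mul_of_nonneg_right ?_ (sobNorm_nonneg _ _)
    have := Finset.mem_range.1 hs
    rw [show r - s = (r - 1 - s) + 1 by omega]
    exact metNorm_le_succ _ _
  have h4 : metNorm x r * sobNorm 0 (lapl x q) ≤
      ∑ s ∈ Finset.range r, metNorm x (r - s) * sobNorm s (lapl x q) := by
    have h := Finset.single_le_sum (f := fun s => metNorm x (r - s) * sobNorm s (lapl x q))
      (fun s _ => hm s) (Finset.mem_range.2 (show 0 < r from hr))
    rwa [Nat.sub_zero] at h
  have h5 := mul_le_mul_of_nonneg_left (add_le_add h3 h4) (add_nonneg C.coe_nonneg D.coe_nonneg)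
  linarith

/-- The projection onto divergence-free vector fields. -/
theorem exists_sobNorm_sub_gradMet_le (hn : 0 < n) (c₁ : ℝ) (r : ℕ) :
    ∃ C : ℝ, 0 ≤ C ∧ ∀ x : E' n → E' n, Admissible c₁ x → ∀ U : E' n → Fin n → ℝ,
      (∀ a, Sm (fun y => U y a)) → ∀ p : E' n → ℝ, Sm p → (∀ y ∈ Sphere' n, p y = 0) →
      (∀ y ∈ Ball n, lapl x p y = divL x U y) →
      sobNorm r (fun y a => U y a - gradMet x p y a) ≤
        C * ∑ s ∈ Finset.range (r + 1), metNorm x (r - s) * sobNorm s U := by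
  let ι := {z : (E' n → E' n) × (E' n → Fin n → ℝ) × (E' n → ℝ) //
    Admissible c₁ z.1 ∧ (∀ a, Sm (fun y => z.2.1 y a)) ∧ Sm z.2.2 ∧
      (∀ y ∈ Sphere' n, z.2.2 y = 0) ∧ ∀ y ∈ Ball n, lapl z.1 z.2.2 y = divL z.1 z.2.1 y}
  have hX : ∀ i : ι, Admissible c₁ i.1.1 := fun i => i.2.1
  have sU : ∀ a (i : ι), Sm (fun y => i.1.2.1 y a) := fun a i => i.2.2.1 a
  choose σ e he using fun i => (hX i).exists_density
  have hf : ∀ (i : ι) s, 0 ≤ sobNorm s i.1.2.1 := fun _ _ => sobNorm_nonneg _ _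
  have hR := weights_dataWeight hn hX 1 hf (w := 0) fun _ => le_rfl
  have sp : ∀ i : ι, Sm i.1.2.2 := fun i => i.2.2.2.1
  have h0 : ∀ i : ι, ∀ y ∈ Sphere' n, i.1.2.2 y = 0 := fun i => i.2.2.2.2.1
  have hdiv : ∀ i : ι, ∀ y ∈ Ball n, lapl i.1.1 i.1.2.2 y = divL i.1.1 i.1.2.1 y :=
    fun i => i.2.2.2.2.2
  have hp := graded_pd_of_divL hn hX he sp sU h0 hdiv r
  obtain ⟨C, hC⟩ := exists_sobNorm_vec_le hR.mono
    (U := fun (i : ι) y a => i.1.2.1 y a - e i y * fluxVec i.1.1 (e i) i.1.2.2 a y) fun a =>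
      SmGraded.sub (weights_metWeight hn hX) hR
        ⟨sU a, graded_of_sobNorm_le hn hX rfl hf (fun _ => le_rfl) (sU a)
          (fun i j => sobNorm_component_le (fun a => sU a i) a j) (r + 1)⟩
        ((graded_density hn hX he _).mul hR (graded_fluxVec hn hX he hR hp a))
  refine ⟨C, C.coe_nonneg, fun x hx U hU p sp h0 h => ?_⟩
  have h1 := le_of_ofReal_le_dataWeight hf (fun _ => le_rfl) (hC ⟨(x, U, p), hx, hU, sp, h0, h⟩)
  simp only [Nat.add_sub_cancel, mul_zero, add_zero] at h1
  refine le_trans (le_of_eq (sobNorm_congr (fun y hy => funext fun a => ?_) r)) h1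
  rw [(he ⟨(x, U, p), hx, hU, sp, h0, h⟩).gradMet_eq p (Metric.ball_subset_closedBall hy) a]

end TameBounds

/-- tame `L²` estimates for the Dirichlet problem and the
divergence-free projection (Proposition 8.1, (8.2), (8.3), (8.6)). -/
theorem stmt13 (n : ℕ) (hn : 2 ≤ n) (r : ℕ) (c₁ : ℝ) :
    ∃ K₁ > 0, ∀ x : E' n → E' n, ContDiff ℝ (⊤ : ℕ∞) x →
      (∀ y ∈ Ball n, (jacM x y).det ≠ 0) →
      (∀ y ∈ Ball n, coordCond x c₁ y) →
      -- (a) and (b): estimates for W^a = g^{ab} ∂_b q with q = 0 on the boundary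
      (∀ q : E' n → ℝ, ContDiff ℝ (⊤ : ℕ∞) q → (∀ y ∈ Sphere' n, q y = 0) →
        (sobNorm r (fun y a => ∑ b, (gMet x y)⁻¹ a b * pd b q y) ≤
            K₁ * (∑ s ∈ Finset.range r,
                (∑ a, ∑ b, ckNorm (r - 1 - s) (fun y => gMet x y a b)) * sobNorm s (lapl x q))
              + K₁ * (∑ a, ∑ b, ckNorm r (fun y => gMet x y a b)) *
                  sobNorm 0 (fun y a => ∑ b, (gMet x y)⁻¹ a b * pd b q y)) ∧
        (1 ≤ r →
          sobNorm r (fun y a => ∑ b, (gMet x y)⁻¹ a b * pd b q y) + sobNorm (r + 1) q ≤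
            K₁ * ∑ s ∈ Finset.range r,
              (∑ a, ∑ b, ckNorm (r - s) (fun y => gMet x y a b)) * sobNorm s (lapl x q))) ∧
      -- (c): the orthogonal projection onto divergence-free vector fields
      (∀ U : E' n → Fin n → ℝ, (∀ a, ContDiff ℝ (⊤ : ℕ∞) (fun y => U y a)) →
        ∀ pU : E' n → ℝ, ContDiff ℝ (⊤ : ℕ∞) pU → (∀ y ∈ Sphere' n, pU y = 0) →
          (∀ y ∈ Ball n, lapl x pU y = divL x U y) →
          sobNorm r (fun y a => U y a - ∑ b, (gMet x y)⁻¹ a b * pd b pU y) ≤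
            K₁ * ∑ s ∈ Finset.range (r + 1),
              (∑ a, ∑ b, ckNorm (r - s) (fun y => gMet x y a b)) * sobNorm s U) := by
  have hn0 : 0 < n := by omega
  obtain ⟨A, hA0, hA⟩ := exists_sobNorm_gradMet_le_lapl_add hn0 c₁ r
  obtain ⟨D, hD0, hD⟩ := exists_sobNorm_sub_gradMet_le hn0 c₁ r
  obtain ⟨B, hB0, hB⟩ : ∃ B : ℝ, 0 ≤ B ∧ (1 ≤ r → ∀ x : E' n → E' n, Admissible c₁ x →
      ∀ q : E' n → ℝ, Sm q → (∀ y ∈ Sphere' n, q y = 0) →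
      sobNorm r (gradMet x q) + sobNorm (r + 1) q ≤
        B * ∑ s ∈ Finset.range r, metNorm x (r - s) * sobNorm s (lapl x q)) := by
    by_cases hr : 1 ≤ r
    · obtain ⟨B, hB0, hB⟩ := exists_sobNorm_le_lapl hn0 c₁ hr
      exact ⟨B, hB0, fun _ => hB⟩
    · exact ⟨0, le_rfl, fun h => absurd h hr⟩
  have hsum : ∀ (x : E' n → E' n) (t : Finset ℕ) (k : ℕ → ℕ) (f : ℕ → ℝ), (∀ s, 0 ≤ f s) →
      0 ≤ ∑ s ∈ t, metNorm x (k s) * f s := fun x t k f hf =>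
    Finset.sum_nonneg fun s _ => mul_nonneg (metNorm_nonneg _ _) (hf s)
  refine ⟨A + B + D + 1, by positivity, fun x sx hdet hcoord => ?_⟩
  have hx : Admissible c₁ x := ⟨sx, hdet, hcoord⟩
  refine ⟨fun q sq h0 => ⟨?_, fun hr => ?_⟩, fun U sU p sp h0 hdiv => ?_⟩
  · refine ((hA x hx q sq h0).trans (mul_le_mul_of_nonneg_right
      (show A ≤ A + B + D + 1 by linarith) ?_)).trans (le_of_eq ?_)
    · exact add_nonneg (hsum x _ _ _ fun _ => sobNorm_nonneg _ _)
        (mul_nonneg (metNorm_nonneg _ _) (sobNorm_nonneg _ _))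
    · rw [mul_add, mul_assoc]
      rfl
  · exact (hB hr x hx q sq h0).trans (mul_le_mul_of_nonneg_right
      (show B ≤ A + B + D + 1 by linarith) (hsum x _ _ _ fun _ => sobNorm_nonneg _ _))
  · exact (hD x hx U sU p sp h0 hdiv).trans (mul_le_mul_of_nonneg_right
      (show D ≤ A + B + D + 1 by linarith) (hsum x _ _ _ fun _ => sobNorm_nonneg _ _))

end
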